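/- Let Ω ⊂ ℝⁿ be a bounded John domain with n ≥ 3, let 1 < p < ∞ and β ≥ 0. Then there exists a constant C such that for every vector field v ∈ W^{1,p}(Ω, ℝⁿ, ρ^β), inf over all vector fields w with l(w) = 0 of (∫_Ω |Dv − Dw|^p ρ^{pβ} dx)^{1/p} ≤ C (∫_Ω |l(v)|^p ρ^{pβ} dx)^{1/p}. -/

import Mathlib

open MeasureTheory Metric Set Matrix
open scoped BigOperators ENNReal

noncomputable section

abbrev Euc (n : ℕ) := EuclideanSpace ℝ (Fin n)

/-- Differential matrix `(Dv)_{ij} = ∂v_i/∂x_j` (computed via the Fréchet derivative). -/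
def Dmat {n : ℕ} (v : Euc n → Euc n) (x : Euc n) : Matrix (Fin n) (Fin n) ℝ :=
  fun i j => fderiv ℝ v x (EuclideanSpace.single j 1) i

/-- Symmetric part of the differential matrix. -/
def epsMat {n : ℕ} (v : Euc n → Euc n) (x : Euc n) : Matrix (Fin n) (Fin n) ℝ :=
  (1 / 2 : ℝ) • (Dmat v x + (Dmat v x)ᵀ)

/-- Trace-free part of the symmetric part of the differential matrix. -/
def lMat {n : ℕ} (v : Euc n → Euc n) (x : Euc n) : Matrix (Fin n) (Fin n) ℝ :=
  epsMat v x - (Matrix.trace (Dmat v x) / (n : ℝ)) • (1 : Matrix (Fin n) (Fin n) ℝ)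

/-- Frobenius (Euclidean) norm of a matrix. -/
def matNorm {n : ℕ} (M : Matrix (Fin n) (Fin n) ℝ) : ℝ :=
  Real.sqrt (∑ i, ∑ j, (M i j) ^ 2)

/-- `M : N = Σ_{ij} M_{ij} N_{ij}`. -/
def matDot {n : ℕ} (M N : Matrix (Fin n) (Fin n) ℝ) : ℝ := ∑ i, ∑ j, M i j * N i j

/-- Distance to the boundary of `Ω`. -/
def distBd {n : ℕ} (Ω : Set (Euc n)) (x : Euc n) : ℝ := Metric.infDist x (frontier Ω)

/-- Open axis-parallel cube with center `c` and side length `h`. -/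
def openCube {n : ℕ} (c : Euc n) (h : ℝ) : Set (Euc n) := {x | ∀ i, |x i - c i| < h / 2}

/-- Closed axis-parallel cube with center `c` and side length `h`. -/
def closedCube {n : ℕ} (c : Euc n) (h : ℝ) : Set (Euc n) := {x | ∀ i, |x i - c i| ≤ h / 2}

/-- Bounded John domain: there are `C > 1` and a distinguished point `x₀ ∈ Ω` such that
every point of `Ω` is joined to `x₀` by a rectifiable curve, parameterized by arc length
(hence 1-Lipschitz), along which the distance to the boundary grows linearly. -/
def IsJohnDomain {n : ℕ} (Ω : Set (Euc n)) : Prop :=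
  ∃ C > (1 : ℝ), ∃ x₀ ∈ Ω, ∀ y ∈ Ω, ∃ L : ℝ, 0 ≤ L ∧ ∃ γ : ℝ → Euc n,
    γ 0 = y ∧ γ L = x₀ ∧ (∀ t ∈ Icc 0 L, γ t ∈ Ω) ∧
    (∀ s ∈ Icc 0 L, ∀ t ∈ Icc 0 L, dist (γ s) (γ t) ≤ |s - t|) ∧
    (∀ t ∈ Icc 0 L, t / C ≤ Metric.infDist (γ t) (frontier Ω))

/-- The matrix-valued functions `H_i`. -/
def Hmat {n : ℕ} (i : Fin n) (z : Euc n) : Matrix (Fin n) (Fin n) ℝ :=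
  fun j k => if j = k then z i else if k = i then z j else if j = i then -z k else 0

/-- The finite-dimensional space `V = D(Σ)`:
`φ(x) = A + λ I + Σ_i b_i H_i(x − y)` with `A` skew-symmetric. -/
def Vset (n : ℕ) : Set (Euc n → Matrix (Fin n) (Fin n) ℝ) :=
  {φ | ∃ (A : Matrix (Fin n) (Fin n) ℝ) (lam : ℝ) (b : Fin n → ℝ) (y : Euc n),
    Aᵀ = -A ∧ ∀ x, φ x = A + lam • (1 : Matrix (Fin n) (Fin n) ℝ) + ∑ i, b i • Hmat i (x - y)}

/-- The Bellman function of the bilinear embedding, for `p ≥ 2` and `q` dual to `p`. -/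
def bellman (p q : ℝ) (z : ℝ × ℝ) : ℝ :=
  21 / (q * (q - 1)) * z.2 ^ q + z.1 ^ 2 * (z.1 ^ p + z.2 ^ q) ^ (1 - 2 / p)

lemma bellman_bracket_bound {p q r θ η a b : ℝ} (hp : 2 ≤ p) (hq1 : 1 < q) (hq2 : q ≤ 2)
    (hr : r = 1 - 2 / p) (hθ : 0 < θ) (hη : 0 < η) (h1 : θ + η = 1) :
    a ^ 2 - 20 * η * b ^ 2 ≤ 2 * a ^ 2 + 4 * r * a * (p * θ * a + q * η * b)
      - r * (1 - r) * (p * θ * a + q * η * b) ^ 2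
      + r * (p * (p - 1) * θ * a ^ 2 + q * (q - 1) * η * b ^ 2) := by
  have hp0 : 0 < p := by linarith
  have hrp : (1 - r) * p = 2 := by rw [hr]; field_simp; ring
  have hr0 : 0 ≤ r := by
    rw [hr, sub_nonneg, div_le_one hp0]; exact hp
  have hr1 : 0 < 1 - r := by
    rw [hr]; ring_nf; positivity
  have key : 2 * a ^ 2 + 4 * r * a * (p * θ * a + q * η * b)
      - r * (1 - r) * (p * θ * a + q * η * b) ^ 2
      + r * (p * (p - 1) * θ * a ^ 2 + q * (q - 1) * η * b ^ 2)
      = a ^ 2 * (2 + 4 * r * p * θ - r * ((1 - r) * p) * p * θ ^ 2 + r * p * (p - 1) * θ)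
        + a * b * (4 * r * q * η - 2 * r * ((1 - r) * p) * q * θ * η)
        + b ^ 2 * (r * q * (q - 1) * η - r * (1 - r) * q ^ 2 * η ^ 2) := by ring
  rw [key, hrp]
  have e1 : 2 ≤ 2 + 4 * r * p * θ - r * 2 * p * θ ^ 2 + r * p * (p - 1) * θ := by
    have : 0 ≤ r * p * θ * (4 - 2 * θ + (p - 1)) := by
      apply mul_nonneg (by positivity); linarith
    nlinarith
  have hθe : θ = 1 - η := by linarith
  have e2 : 4 * r * q * η - 2 * r * 2 * q * θ * η = 4 * (r * q) * η ^ 2 := by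
    rw [hθe]; ring
  have hη1 : η ≤ 1 := by linarith
  have hrq : r * q ≤ 2 := by nlinarith
  have hrq0 : 0 ≤ r * q := by positivity
  have e3 : -(4 * η) ≤ r * q * (q - 1) * η - r * (1 - r) * q ^ 2 * η ^ 2 := by
    have h1 : 0 ≤ r * q * (q - 1) * η := by
      have : 0 ≤ q - 1 := by linarith
      positivity
    have h2 : r * (1 - r) * q ^ 2 * η ^ 2 ≤ 1 * 4 * η := by
      have : r * (1 - r) ≤ 1 := by nlinarith
      have h3 : q ^ 2 ≤ 4 := by nlinarith
      have h4 : η ^ 2 ≤ η := by nlinarith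
      have h5 : r * (1 - r) * q ^ 2 ≤ 1 * 4 := mul_le_mul this h3 (by positivity) (by norm_num)
      exact mul_le_mul h5 h4 (by positivity) (by norm_num)
    linarith
  rw [e2]
  have e4 : -(a ^ 2 + 16 * η * b ^ 2) ≤ a * b * (4 * (r * q) * η ^ 2) := by
    set k := 2 * (r * q) * η ^ 2 with hk
    have hk0 : 0 ≤ k := by positivity
    have hk4 : k ^ 2 ≤ 16 * η := by
      have : k ≤ 4 * η ^ 2 := by rw [hk]; nlinarith [sq_nonneg η]
      have h' : k ≤ 4 * η := by nlinarith
      nlinarith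
    have : a * b * (4 * (r * q) * η ^ 2) = 2 * a * (k * b) := by rw [hk]; ring
    rw [this]
    nlinarith [sq_nonneg (a + k * b), mul_le_mul_of_nonneg_right hk4 (sq_nonneg b)]
  have m1 := mul_le_mul_of_nonneg_left e1 (sq_nonneg a)
  have m2 := mul_le_mul_of_nonneg_left e3 (sq_nonneg b)
  have m3 : b ^ 2 * -(4 * η) = -(4 * η * b ^ 2) := by ring
  rw [m3] at m2
  linarith only [m1, m2, e4]

set_option maxHeartbeats 800000 in
lemma bellman_hessian_bound {p q r u v α β : ℝ} (hp : 2 ≤ p) (hpq : p⁻¹ + q⁻¹ = 1)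
    (hr : r = 1 - 2 / p) (hu : 0 < u) (hv : 0 < v) :
    2 * |α * β| ≤ 21 / (q * (q - 1)) * (q * ((q - 1) * v ^ (q - 2) * β * β)) +
      (2 * α * α * (u ^ p + v ^ q) ^ r
        + 2 * (2 * u * α * (r * (u ^ p + v ^ q) ^ (r - 1) *
            (p * u ^ (p - 1) * α + q * v ^ (q - 1) * β)))
        + u ^ 2 * (r * ((r - 1) * (u ^ p + v ^ q) ^ (r - 2) *
              (p * u ^ (p - 1) * α + q * v ^ (q - 1) * β) ^ 2
            + (u ^ p + v ^ q) ^ (r - 1) *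
              (p * ((p - 1) * u ^ (p - 2) * α * α) + q * ((q - 1) * v ^ (q - 2) * β * β))))) := by
  have hp0 : 0 < p := by linarith
  have hqi : q⁻¹ = 1 - p⁻¹ := by linarith
  have hpi : p⁻¹ ≤ 2⁻¹ := by gcongr
  have hpi0 : 0 < p⁻¹ := by positivity
  have hq0 : 0 < q := by
    have : 0 < q⁻¹ := by rw [hqi]; linarith
    exact inv_pos.1 this
  have hq1 : 1 < q := by
    have : q⁻¹ < 1 := by linarith
    exact (inv_lt_one₀ hq0).1 this
  have hq2 : q ≤ 2 := by
    have : (2:ℝ)⁻¹ ≤ q⁻¹ := by linarith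
    exact (inv_le_inv₀ (by norm_num) hq0).1 this
  have hr0 : 0 ≤ r := by rw [hr, sub_nonneg, div_le_one hp0]; exact hp
  set s := u ^ p with hs
  set t := v ^ q with ht
  have hs0 : 0 < s := by positivity
  have ht0 : 0 < t := by positivity
  have hW0 : 0 < s + t := by positivity
  set Wr := (s + t) ^ r with hWr
  have hWr0 : 0 < Wr := by positivity
  obtain ⟨a, rfl⟩ : ∃ a, α = a * u := ⟨α / u, by field_simp⟩
  obtain ⟨b, rfl⟩ : ∃ b, β = b * v := ⟨β / v, by field_simp⟩
  have g1 : u ^ (p - 1) = s / u := by rw [Real.rpow_sub_one hu.ne']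
  have g2 : v ^ (q - 1) = t / v := by rw [Real.rpow_sub_one hv.ne']
  have g3 : u ^ (p - 2) = s / u ^ 2 := by
    rw [Real.rpow_sub hu]; norm_num [hs]
  have g4 : v ^ (q - 2) = t / v ^ 2 := by
    rw [Real.rpow_sub hv]; norm_num [ht]
  have g5 : (s + t) ^ (r - 1) = Wr / (s + t) := by rw [Real.rpow_sub_one hW0.ne']
  have g6 : (s + t) ^ (r - 2) = Wr / (s + t) ^ 2 := by
    rw [Real.rpow_sub hW0]; norm_num [hWr]
  rw [g1, g2, g3, g4, g5, g6]
  have hb := @bellman_bracket_bound p q r (s / (s + t)) (t / (s + t)) a b hp hq1 hq2 hr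
    (by positivity) (by positivity) (by field_simp)
  set Z := u ^ 2 * Wr with hZ
  have hZ0 : 0 < Z := by positivity
  have hs2 : u ^ 2 = s ^ (2 / p) := by
    rw [hs, ← Real.rpow_mul hu.le, mul_div_cancel₀ _ hp0.ne']; norm_num
  have hZW : Z ≤ s + t := by
    have : s ^ (2 / p) ≤ (s + t) ^ (2 / p) := by gcongr; linarith
    calc Z ≤ (s + t) ^ (2 / p) * (s + t) ^ r := by rw [hZ, hs2]; gcongr
      _ = s + t := by
        rw [← Real.rpow_add hW0, hr]; norm_num
  have hZt : (u * v) ^ 2 ≤ Z * t := by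
    have h1 : t ^ r ≤ Wr := by rw [hWr]; gcongr; linarith
    have h2 : t ^ r * t = v ^ 2 := by
      rw [← Real.rpow_add_one ht0.ne', ht, ← Real.rpow_mul hv.le]
      have : q * (r + 1) = 2 := by
        have h3 : r + 1 = 2 * q⁻¹ := by rw [hr, hqi]; ring
        rw [h3]; field_simp
      rw [this]; norm_num
    calc (u * v) ^ 2 = u ^ 2 * (t ^ r * t) := by rw [h2]; ring
      _ ≤ u ^ 2 * (Wr * t) := by gcongr
      _ = Z * t := by rw [hZ]; ring
  have hq10 : q - 1 ≠ 0 := by linarith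
  have hE : 21 / (q * (q - 1)) * (q * ((q - 1) * (t / v ^ 2) * (b * v) * (b * v))) +
      (2 * (a * u) * (a * u) * Wr
        + 2 * (2 * u * (a * u) * (r * (Wr / (s + t)) *
            (p * (s / u) * (a * u) + q * (t / v) * (b * v))))
        + u ^ 2 * (r * ((r - 1) * (Wr / (s + t) ^ 2) *
              (p * (s / u) * (a * u) + q * (t / v) * (b * v)) ^ 2
            + (Wr / (s + t)) *
              (p * ((p - 1) * (s / u ^ 2) * (a * u) * (a * u)) +
                q * ((q - 1) * (t / v ^ 2) * (b * v) * (b * v)))))) =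
      21 * t * b ^ 2 + Z * (2 * a ^ 2 +
        4 * r * a * (p * (s / (s + t)) * a + q * (t / (s + t)) * b)
      - r * (1 - r) * (p * (s / (s + t)) * a + q * (t / (s + t)) * b) ^ 2
      + r * (p * (p - 1) * (s / (s + t)) * a ^ 2 + q * (q - 1) * (t / (s + t)) * b ^ 2)) := by
    have i1 : 21 / (q * (q - 1)) * (q * ((q - 1) * (t / v ^ 2) * (b * v) * (b * v)))
        = 21 * t * b ^ 2 := by field_simp
    have i2 : p * (s / u) * (a * u) + q * (t / v) * (b * v) = p * s * a + q * t * b := by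
      field_simp
    have i3 : p * ((p - 1) * (s / u ^ 2) * (a * u) * (a * u)) +
                q * ((q - 1) * (t / v ^ 2) * (b * v) * (b * v))
        = p * (p - 1) * s * a ^ 2 + q * (q - 1) * t * b ^ 2 := by field_simp
    rw [i1, i2, i3, hZ]
    field_simp
    ring
  rw [hE]
  have hZη : Z * (t / (s + t)) ≤ t := by
    rw [mul_div_assoc', div_le_iff₀ hW0]; nlinarith
  have hfin : Z * a ^ 2 + t * b ^ 2 ≤ 21 * t * b ^ 2 + Z * (2 * a ^ 2 +
        4 * r * a * (p * (s / (s + t)) * a + q * (t / (s + t)) * b)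
      - r * (1 - r) * (p * (s / (s + t)) * a + q * (t / (s + t)) * b) ^ 2
      + r * (p * (p - 1) * (s / (s + t)) * a ^ 2 + q * (q - 1) * (t / (s + t)) * b ^ 2)) := by
    have m1 := mul_le_mul_of_nonneg_left hb hZ0.le
    have m2 := mul_le_mul_of_nonneg_right hZη (sq_nonneg b)
    have m3 : Z * (a ^ 2 - 20 * (t / (s + t)) * b ^ 2) =
      Z * a ^ 2 - 20 * (Z * (t / (s + t)) * b ^ 2) := by ring
    rw [m3] at m1
    linarith only [m1, m2]
  refine le_trans ?_ hfin
  have hab : |a * u * (b * v)| = (u * v) * |a * b| := by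
    rw [show a * u * (b * v) = (u * v) * (a * b) by ring, abs_mul, abs_of_pos (by positivity)]
  rw [hab]
  have h4 : (2 * (u * v * |a * b|)) ^ 2 ≤ (Z * a ^ 2 + t * b ^ 2) ^ 2 := by
    have h5 : (2 * (u * v * |a * b|)) ^ 2 = 4 * (u * v) ^ 2 * (a * b) ^ 2 := by
      rw [mul_pow, mul_pow, sq_abs]; ring
    rw [h5]
    have m1 := mul_le_mul_of_nonneg_right hZt (sq_nonneg (a * b))
    have m2 : (Z * a ^ 2 + t * b ^ 2) ^ 2 =
      4 * (Z * t * (a * b) ^ 2) + (Z * a ^ 2 - t * b ^ 2) ^ 2 := by ring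
    have m3 := sq_nonneg (Z * a ^ 2 - t * b ^ 2)
    rw [m2]
    linarith only [m1, m3]
  exact (abs_le_of_sq_le_sq' h4 (by positivity)).2

lemma bellman_continuous {p q : ℝ} (hp : 2 ≤ p) (hq : 0 < q) : Continuous (bellman p q) := by
  have hp0 : 0 < p := by linarith
  have hr0 : 0 ≤ 1 - 2 / p := by rw [sub_nonneg, div_le_one hp0]; exact hp
  unfold bellman
  have h1 : Continuous fun z : ℝ × ℝ => z.1 ^ p := continuous_fst.rpow_const fun _ => Or.inr hp0.le
  have h2 : Continuous fun z : ℝ × ℝ => z.2 ^ q := continuous_snd.rpow_const fun _ => Or.inr hq.le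
  exact (continuous_const.mul h2).add
    ((continuous_fst.pow 2).mul ((h1.add h2).rpow_const fun _ => Or.inr hr0))

lemma bellman_segment_pos {p q : ℝ} (hp : 2 ≤ p) (hpq : p⁻¹ + q⁻¹ = 1)
    {a b : ℝ × ℝ} (ha1 : 0 < a.1) (ha2 : 0 < a.2) (hb1 : 0 < b.1) (hb2 : 0 < b.2)
    {s : ℝ} (hs : s ∈ Icc (0:ℝ) 1) :
    bellman p q ((1 - s) • a + s • b) + s * (1 - s) * |(b.1 - a.1) * (b.2 - a.2)|
      ≤ (1 - s) * bellman p q a + s * bellman p q b := by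
  obtain ⟨r, hr⟩ : ∃ r, r = 1 - 2 / p := ⟨_, rfl⟩
  set α := b.1 - a.1 with hα
  set β := b.2 - a.2 with hβ
  set u : ℝ → ℝ := fun t => a.1 + t * α with hu
  set v : ℝ → ℝ := fun t => a.2 + t * β with hv
  have hupos : ∀ t ∈ Icc (0:ℝ) 1, 0 < u t := by
    intro t ht
    have h : u t = (1 - t) * a.1 + t * b.1 := by simp only [hu, hα]; ring
    rw [h]
    rcases eq_or_lt_of_le ht.1 with h0 | h0
    · rw [← h0]; simpa using ha1
    · have := mul_pos h0 hb1
      have := mul_nonneg (sub_nonneg.2 ht.2) ha1.le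
      linarith
  have hvpos : ∀ t ∈ Icc (0:ℝ) 1, 0 < v t := by
    intro t ht
    have h : v t = (1 - t) * a.2 + t * b.2 := by simp only [hv, hβ]; ring
    rw [h]
    rcases eq_or_lt_of_le ht.1 with h0 | h0
    · rw [← h0]; simpa using ha2
    · have := mul_pos h0 hb2
      have := mul_nonneg (sub_nonneg.2 ht.2) ha2.le
      linarith
  have hdu : ∀ t, HasDerivAt u α t := fun t => by
    simpa [hu] using ((hasDerivAt_id' t).mul_const α).const_add a.1
  have hdv : ∀ t, HasDerivAt v β t := fun t => by
    simpa [hv] using ((hasDerivAt_id' t).mul_const β).const_add a.2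
  set c := 21 / (q * (q - 1)) with hc
  let W : ℝ → ℝ := fun t => u t ^ p + v t ^ q
  let W1 : ℝ → ℝ := fun t => p * u t ^ (p - 1) * α + q * v t ^ (q - 1) * β
  let W2 : ℝ → ℝ := fun t =>
    p * ((p - 1) * u t ^ (p - 2) * α * α) + q * ((q - 1) * v t ^ (q - 2) * β * β)
  have hWpos : ∀ t ∈ Icc (0:ℝ) 1, 0 < W t := fun t ht =>
    add_pos (Real.rpow_pos_of_pos (hupos t ht) _) (Real.rpow_pos_of_pos (hvpos t ht) _)
  have hpw : ∀ (w : ℝ → ℝ) (w' m t : ℝ), HasDerivAt w w' t → 0 < w t →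
      HasDerivAt (fun t => w t ^ m) (m * w t ^ (m - 1) * w') t := by
    intro w w' m t h h0
    have := h.rpow_const (p := m) (Or.inl h0.ne')
    convert this using 1; ring
  have hW : ∀ t ∈ Icc (0:ℝ) 1, HasDerivAt W (W1 t) t := fun t ht =>
    (hpw u α p t (hdu t) (hupos t ht)).add (hpw v β q t (hdv t) (hvpos t ht))
  have hW1 : ∀ t ∈ Icc (0:ℝ) 1, HasDerivAt W1 (W2 t) t := fun t ht => by
    have h1 := ((hpw u α (p-1) t (hdu t) (hupos t ht)).const_mul p).mul_const α
    have h2 := ((hpw v β (q-1) t (hdv t) (hvpos t ht)).const_mul q).mul_const β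
    refine (h1.add h2).congr_deriv ?_
    simp only [W2]
    rw [show p - 1 - 1 = p - 2 by ring, show q - 1 - 1 = q - 2 by ring]
    ring
  let g : ℝ → ℝ := fun t => c * v t ^ q + u t ^ 2 * W t ^ r - |α * β| * t ^ 2
  let g1 : ℝ → ℝ := fun t => c * (q * v t ^ (q - 1) * β) +
    (2 * u t * α * W t ^ r + u t ^ 2 * (r * W t ^ (r - 1) * W1 t)) - |α * β| * (2 * t)
  let g2 : ℝ → ℝ := fun t => c * (q * ((q - 1) * v t ^ (q - 2) * β * β)) +
      (2 * α * α * (u t ^ p + v t ^ q) ^ r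
        + 2 * (2 * u t * α * (r * (u t ^ p + v t ^ q) ^ (r - 1) *
            (p * u t ^ (p - 1) * α + q * v t ^ (q - 1) * β)))
        + u t ^ 2 * (r * ((r - 1) * (u t ^ p + v t ^ q) ^ (r - 2) *
              (p * u t ^ (p - 1) * α + q * v t ^ (q - 1) * β) ^ 2
            + (u t ^ p + v t ^ q) ^ (r - 1) *
              (p * ((p - 1) * u t ^ (p - 2) * α * α) + q * ((q - 1) * v t ^ (q - 2) * β * β)))))
      - 2 * |α * β|
  have hg : ∀ t ∈ Icc (0:ℝ) 1, HasDerivAt g (g1 t) t := fun t ht => by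
    have h1 := (hpw v β q t (hdv t) (hvpos t ht)).const_mul c
    have h2 := ((hdu t).pow 2).mul (hpw W _ r t (hW t ht) (hWpos t ht))
    have h3 := ((hasDerivAt_id t).pow 2).const_mul |α * β|
    refine ((h1.add h2).sub h3).congr_deriv ?_
    simp [g1]
  have hg1 : ∀ t ∈ Icc (0:ℝ) 1, HasDerivAt g1 (g2 t) t := fun t ht => by
    have h1 := (((hpw v β (q-1) t (hdv t) (hvpos t ht)).const_mul q).mul_const β).const_mul c
    have h2 := (((hdu t).const_mul 2).mul_const α).mul (hpw W _ r t (hW t ht) (hWpos t ht))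
    have h3 := ((hdu t).pow 2).mul
      (((hpw W _ (r-1) t (hW t ht) (hWpos t ht)).const_mul r).mul (hW1 t ht))
    have h4 := ((hasDerivAt_id t).const_mul 2).const_mul |α * β|
    refine ((h1.add (h2.add h3)).sub h4).congr_deriv ?_ |>.congr_of_eventuallyEq ?_
    · simp only [g2, W1, W2, W, Nat.cast_ofNat]
      rw [show r - 1 - 1 = r - 2 by ring, show q - 1 - 1 = q - 2 by ring]
      norm_num
      ring
    · refine Filter.Eventually.of_forall fun y => ?_
      simp only [g1, Pi.add_apply, Pi.sub_apply, Pi.mul_apply, Pi.pow_apply, id]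
  have hInt : ∀ t ∈ interior (Icc (0:ℝ) 1), t ∈ Icc (0:ℝ) 1 := fun t ht => interior_subset ht
  have hconv : ConvexOn ℝ (Icc (0:ℝ) 1) g := by
    refine convexOn_of_hasDerivWithinAt2_nonneg (convex_Icc 0 1)
      (fun t ht => (hg t ht).continuousAt.continuousWithinAt)
      (fun t ht => (hg t (hInt t ht)).hasDerivWithinAt)
      (fun t ht => (hg1 t (hInt t ht)).hasDerivWithinAt) fun t ht => ?_
    have := bellman_hessian_bound (α := α) (β := β) hp hpq hr (hupos t (hInt t ht))
      (hvpos t (hInt t ht))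
    exact sub_nonneg.2 this
  have key := hconv.2 (left_mem_Icc.2 zero_le_one) (right_mem_Icc.2 zero_le_one)
    (sub_nonneg.2 hs.2) hs.1 (sub_add_cancel 1 s)
  have e0 : g 0 = bellman p q a := by
    simp [g, W, bellman, u, v, hr, hc]
  have e1 : g 1 = bellman p q b - |α * β| := by
    simp [g, W, bellman, u, v, hr, hc, hα, hβ]
  have es : g s = bellman p q ((1 - s) • a + s • b) - |α * β| * s ^ 2 := by
    have h1 : u s = (1 - s) * a.1 + s * b.1 := by simp only [hu, hα]; ring
    have h2 : v s = (1 - s) * a.2 + s * b.2 := by simp only [hv, hβ]; ring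
    simp [g, W, bellman, h1, h2, hr, hc]
  simp only [smul_eq_mul, mul_zero, mul_one, zero_add] at key
  rw [e0, e1, es] at key
  linarith only [key]

lemma bellman_segment {p q : ℝ} (hp : 2 ≤ p) (hpq : p⁻¹ + q⁻¹ = 1) (hq : 0 < q)
    {a b : ℝ × ℝ} (ha : 0 ≤ a) (hb : 0 ≤ b) {s : ℝ} (hs : s ∈ Icc (0:ℝ) 1) :
    bellman p q ((1 - s) • a + s • b) + s * (1 - s) * |(b.1 - a.1) * (b.2 - a.2)|
      ≤ (1 - s) * bellman p q a + s * bellman p q b := by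
  have hB := bellman_continuous hp hq
  have key : ∀ ε ∈ Ioi (0:ℝ),
      bellman p q ((1 - s) • (a + (ε, ε)) + s • (b + (ε, ε)))
        + s * (1 - s) * |(b.1 - a.1) * (b.2 - a.2)|
      ≤ (1 - s) * bellman p q (a + (ε, ε)) + s * bellman p q (b + (ε, ε)) := by
    intro ε hε
    have hε : 0 < ε := hε
    have h1 := bellman_segment_pos hp hpq (a := a + (ε, ε)) (b := b + (ε, ε))
      (add_pos_of_nonneg_of_pos ha.1 hε) (add_pos_of_nonneg_of_pos ha.2 hε)
      (add_pos_of_nonneg_of_pos hb.1 hε) (add_pos_of_nonneg_of_pos hb.2 hε) hs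
    simpa using h1
  have c1 : Continuous fun ε : ℝ => bellman p q ((1 - s) • (a + (ε, ε)) + s • (b + (ε, ε)))
        + s * (1 - s) * |(b.1 - a.1) * (b.2 - a.2)| := by fun_prop
  have c2 : Continuous fun ε : ℝ =>
      (1 - s) * bellman p q (a + (ε, ε)) + s * bellman p q (b + (ε, ε)) := by fun_prop
  have h1 := le_of_tendsto_of_tendsto (c1.tendsto 0 |>.mono_left nhdsWithin_le_nhds)
    (c2.tendsto 0 |>.mono_left nhdsWithin_le_nhds)
    (Filter.eventually_of_mem (self_mem_nhdsWithin (s := Ioi (0:ℝ))) key)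
  simpa only [Prod.mk_zero_zero, add_zero] using h1

lemma bellman_nonneg {p q : ℝ} (hq : 1 < q) {a : ℝ × ℝ} (ha : 0 ≤ a) :
    0 ≤ bellman p q a := by
  have h1 : 0 ≤ a.1 := ha.1
  have h2 : 0 ≤ a.2 := ha.2
  have : 0 ≤ q - 1 := by linarith
  unfold bellman
  positivity

lemma bellman_le {p q : ℝ} (hp : 2 ≤ p) (hq : 1 < q) {a : ℝ × ℝ} (ha : 0 ≤ a) :
    bellman p q a ≤ (21 / (q * (q - 1)) + 1) * (a.1 ^ p + a.2 ^ q) := by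
  have h1 : 0 ≤ a.1 := ha.1
  have h2 : 0 ≤ a.2 := ha.2
  have hq1 : 0 < q - 1 := by linarith
  have hp0 : 0 < p := by linarith
  have hX : 0 ≤ a.1 ^ p := by positivity
  have hY : 0 ≤ a.2 ^ q := by positivity
  have h3 : a.1 ^ 2 * (a.1 ^ p + a.2 ^ q) ^ (1 - 2 / p) ≤ a.1 ^ p + a.2 ^ q := by
    rcases eq_or_lt_of_le (add_nonneg hX hY) with h0 | h0
    · have : a.1 ^ p = 0 := by linarith
      have h4 : a.1 = 0 := (Real.rpow_eq_zero h1 hp0.ne').1 this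
      rw [h4]; simp; positivity
    · have h5 : a.1 ^ 2 ≤ (a.1 ^ p + a.2 ^ q) ^ (2 / p) := by
        calc a.1 ^ 2 = (a.1 ^ p) ^ (2 / p) := by
              rw [← Real.rpow_mul h1, mul_div_cancel₀ _ hp0.ne']; norm_num
          _ ≤ _ := by gcongr; linarith
      calc _ ≤ (a.1 ^ p + a.2 ^ q) ^ (2 / p) * (a.1 ^ p + a.2 ^ q) ^ (1 - 2 / p) := by gcongr
        _ = _ := by rw [← Real.rpow_add h0]; norm_num
  have h4 : 21 / (q * (q - 1)) * a.2 ^ q ≤ 21 / (q * (q - 1)) * (a.1 ^ p + a.2 ^ q) := by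
    gcongr; linarith
  unfold bellman
  linarith

/-- For every conjugate pair of exponents there is a nonnegative convex function on the quadrant,
controlled by `u ^ p + v ^ q`, whose convexity defect dominates `|Δu| |Δv|`. -/
lemma exists_bellman {p q : ℝ} (hpq : p.HolderConjugate q) :
    ∃ C : ℝ, 0 < C ∧ ∃ Φ : ℝ × ℝ → ℝ, Continuous Φ ∧ (∀ a, 0 ≤ a → 0 ≤ Φ a) ∧
      (∀ a, 0 ≤ a → Φ a ≤ C * (a.1 ^ p + a.2 ^ q)) ∧
      ∀ a b : ℝ × ℝ, 0 ≤ a → 0 ≤ b → ∀ s ∈ Icc (0:ℝ) 1,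
        Φ ((1 - s) • a + s • b) + s * (1 - s) * (|b.1 - a.1| * |b.2 - a.2|)
          ≤ (1 - s) * Φ a + s * Φ b := by
  have hp1 := hpq.lt
  have hq1 := hpq.symm.lt
  have hinv := hpq.inv_add_inv_eq_one
  rcases le_total 2 p with hp | hp
  · refine ⟨21 / (q * (q - 1)) + 1, ?_, bellman p q, bellman_continuous hp (by linarith),
      fun a ha => bellman_nonneg hq1 ha, fun a ha => bellman_le hp hq1 ha, ?_⟩
    · have : 0 < q - 1 := by linarith
      positivity
    · intro a b ha hb s hs
      rw [← abs_mul]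
      exact bellman_segment hp hinv (by linarith) ha hb hs
  · have hq : 2 ≤ q := by
      have h1 : (2:ℝ)⁻¹ ≤ p⁻¹ := by gcongr
      have h2 : q⁻¹ ≤ 2⁻¹ := by linarith
      exact (inv_le_inv₀ (by linarith) (by norm_num)).1 h2
    refine ⟨21 / (p * (p - 1)) + 1, ?_, fun z => bellman q p z.swap,
      (bellman_continuous hq (by linarith)).comp continuous_swap,
      fun a ha => bellman_nonneg hp1 ⟨ha.2, ha.1⟩,
      fun a ha => (bellman_le hq hp1 (a := a.swap) ⟨ha.2, ha.1⟩).trans_eq (by simp [add_comm]), ?_⟩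
    · have : 0 < p - 1 := by linarith
      positivity
    · intro a b ha hb s hs
      rw [← abs_mul, mul_comm (b.1 - a.1)]
      exact bellman_segment (a := a.swap) (b := b.swap) hq (by linarith) (by linarith)
        ⟨ha.2, ha.1⟩ ⟨hb.2, hb.1⟩ hs

/-- Continuous compactly supported functions. -/
def ccFun (E : Type*) [TopologicalSpace E] : Submodule ℝ (E → ℝ) where
  carrier := {f | Continuous f ∧ HasCompactSupport f}
  add_mem' hf hg := ⟨hf.1.add hg.1, hf.2.add hg.2⟩
  zero_mem' := ⟨continuous_const, HasCompactSupport.zero⟩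
  smul_mem' c _ hf := ⟨hf.1.const_smul c, hf.2.smul_left (f := fun _ => c)⟩

section Walk

variable {n : ℕ} {ι : Type} [Fintype ι]

/-- Translation of functions. -/
def shiftOp (a : Euc n) : Module.End ℝ (Euc n → ℝ) := LinearMap.funLeft ℝ ℝ (fun x => x + a)

lemma shiftOp_apply (a : Euc n) (f : Euc n → ℝ) (x : Euc n) : shiftOp a f x = f (x + a) := rfl

lemma shiftOp_mul (a b : Euc n) : shiftOp a * shiftOp b = shiftOp (a + b) := by
  ext f x
  simp [Module.End.mul_apply, shiftOp_apply, add_assoc]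

lemma shiftOp_commute (a b : Euc n) : Commute (shiftOp a) (shiftOp b) := by
  rw [Commute, SemiconjBy, shiftOp_mul, shiftOp_mul, add_comm]

/-- Average of the two translates by `a` and `-a`. -/
def midOp (a : Euc n) : Module.End ℝ (Euc n → ℝ) := (1 / 2 : ℝ) • (shiftOp a + shiftOp (-a))

/-- Symmetric difference operator. -/
def difOp (a : Euc n) : Module.End ℝ (Euc n → ℝ) := shiftOp a - shiftOp (-a)

/-- Averaging operator of a symmetric random walk with steps `e i`. -/
def walkOp (e : ι → Euc n) : Module.End ℝ (Euc n → ℝ) :=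
  (1 / Fintype.card ι : ℝ) • ∑ i, midOp (e i) * midOp (e i)

lemma midOp_apply (a : Euc n) (f : Euc n → ℝ) (x : Euc n) :
    midOp a f x = (1 / 2) * (f (x + a) + f (x - a)) := by
  simp [midOp, shiftOp_apply, sub_eq_add_neg]; ring

lemma difOp_apply (a : Euc n) (f : Euc n → ℝ) (x : Euc n) :
    difOp a f x = f (x + a) - f (x - a) := by
  simp [difOp, shiftOp_apply, sub_eq_add_neg]

lemma walkOp_apply (e : ι → Euc n) (f : Euc n → ℝ) (x : Euc n) :
    walkOp e f x = (1 / Fintype.card ι : ℝ) * ∑ i, midOp (e i) (midOp (e i) f) x := by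
  simp [walkOp, Finset.sum_apply]

lemma one_sub_walkOp [Nonempty ι] (e : ι → Euc n) :
    1 - walkOp e = -((1 / (4 * Fintype.card ι) : ℝ) • ∑ i, difOp (e i) * difOp (e i)) := by
  have h : ∀ a : Euc n, midOp a * midOp a = 1 + (1 / 4 : ℝ) • (difOp a * difOp a) := by
    intro a
    ext f x
    simp only [Module.End.mul_apply, midOp_apply, difOp_apply, LinearMap.add_apply, Pi.add_apply,
      Module.End.one_apply, LinearMap.smul_apply, Pi.smul_apply, smul_eq_mul, add_sub_cancel_right,
      sub_add_cancel]
    ring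
  have hc : (Fintype.card ι : ℝ) ≠ 0 := by positivity
  unfold walkOp
  simp only [h, Finset.sum_add_distrib, Finset.sum_const, Finset.card_univ, ← Finset.smul_sum,
    smul_add, smul_smul]
  rw [← Nat.cast_smul_eq_nsmul ℝ, smul_smul, one_div_mul_cancel hc, one_smul]
  rw [show (1 / (Fintype.card ι : ℝ) * (1 / 4)) = 1 / (4 * Fintype.card ι) by field_simp]
  abel

lemma commute_difOp_midOp (a b : Euc n) : Commute (difOp a) (midOp b) := by
  unfold difOp midOp
  refine Commute.smul_right ?_ _
  exact ((shiftOp_commute _ _).add_right (shiftOp_commute _ _)).sub_left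
    ((shiftOp_commute _ _).add_right (shiftOp_commute _ _))

lemma commute_difOp_walkOp (a : Euc n) (e : ι → Euc n) : Commute (difOp a) (walkOp e) := by
  unfold walkOp
  refine Commute.smul_right (Commute.sum_right _ _ _ fun i _ => ?_) _
  exact (commute_difOp_midOp _ _).mul_right (commute_difOp_midOp _ _)

lemma shiftOp_mem {f : Euc n → ℝ} (hf : f ∈ ccFun (Euc n)) (a : Euc n) :
    shiftOp a f ∈ ccFun (Euc n) :=
  ⟨hf.1.comp (continuous_id.add continuous_const),
    hf.2.comp_homeomorph (Homeomorph.addRight a)⟩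

lemma midOp_mem {f : Euc n → ℝ} (hf : f ∈ ccFun (Euc n)) (a : Euc n) :
    midOp a f ∈ ccFun (Euc n) :=
  (ccFun _).smul_mem _ ((ccFun _).add_mem (shiftOp_mem hf _) (shiftOp_mem hf _))

lemma difOp_mem {f : Euc n → ℝ} (hf : f ∈ ccFun (Euc n)) (a : Euc n) :
    difOp a f ∈ ccFun (Euc n) :=
  (ccFun _).sub_mem (shiftOp_mem hf _) (shiftOp_mem hf _)

lemma walkOp_mem {f : Euc n → ℝ} (hf : f ∈ ccFun (Euc n)) (e : ι → Euc n) :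
    walkOp e f ∈ ccFun (Euc n) := by
  unfold walkOp
  rw [LinearMap.smul_apply, LinearMap.sum_apply]
  exact (ccFun _).smul_mem _ ((ccFun _).sum_mem fun i _ => midOp_mem (midOp_mem hf _) _)

lemma walkOp_pow_mem {f : Euc n → ℝ} (hf : f ∈ ccFun (Euc n)) (e : ι → Euc n) (k : ℕ) :
    (walkOp e ^ k) f ∈ ccFun (Euc n) := by
  induction k with
  | zero => exact hf
  | succ k ih => rw [pow_succ', Module.End.mul_apply]; exact walkOp_mem ih e

lemma midOp_nonneg {f : Euc n → ℝ} (hf : 0 ≤ f) (a : Euc n) : 0 ≤ midOp a f := fun x => by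
  rw [midOp_apply]
  have h1 : 0 ≤ f (x + a) := hf _
  have h2 : 0 ≤ f (x - a) := hf _
  simp only [Pi.zero_apply]; positivity

lemma walkOp_nonneg {f : Euc n → ℝ} (hf : 0 ≤ f) (e : ι → Euc n) : 0 ≤ walkOp e f := fun x => by
  rw [walkOp_apply]
  have : ∀ i, 0 ≤ midOp (e i) (midOp (e i) f) x := fun i => midOp_nonneg (midOp_nonneg hf _) _ x
  exact mul_nonneg (by positivity) (Finset.sum_nonneg fun i _ => this i)

lemma walkOp_pow_nonneg {f : Euc n → ℝ} (hf : 0 ≤ f) (e : ι → Euc n) (k : ℕ) :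
    0 ≤ (walkOp e ^ k) f := by
  induction k with
  | zero => exact hf
  | succ k ih => rw [pow_succ', Module.End.mul_apply]; exact walkOp_nonneg ih e

lemma integral_mul_shiftOp (f g : Euc n → ℝ) (a : Euc n) :
    ∫ x, shiftOp a f x * g x = ∫ x, f x * shiftOp (-a) g x := by
  rw [← integral_add_right_eq_self (fun x => f x * shiftOp (-a) g x) a]
  simp [shiftOp_apply]

lemma ccFun_integrable {f : Euc n → ℝ} (hf : f ∈ ccFun (Euc n)) : Integrable f :=
  hf.1.integrable_of_hasCompactSupport hf.2

lemma ccFun_mul {f g : Euc n → ℝ} (hf : f ∈ ccFun (Euc n)) (hg : g ∈ ccFun (Euc n)) :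
    (fun x => f x * g x) ∈ ccFun (Euc n) :=
  ⟨hf.1.mul hg.1, hf.2.mul_right⟩

lemma ccFun_comp {f : Euc n → ℝ} (hf : f ∈ ccFun (Euc n)) {Φ : ℝ → ℝ} (hΦ : Continuous Φ)
    (h0 : Φ 0 = 0) : (fun x => Φ (f x)) ∈ ccFun (Euc n) :=
  ⟨hΦ.comp hf.1, hf.2.comp_left h0⟩

lemma ccFun_comp₂ {f g : Euc n → ℝ} (hf : f ∈ ccFun (Euc n)) (hg : g ∈ ccFun (Euc n))
    {Φ : ℝ × ℝ → ℝ} (hΦ : Continuous Φ)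
    (h0 : Φ 0 = 0) : (fun x => Φ (f x, g x)) ∈ ccFun (Euc n) :=
  ⟨hΦ.comp (hf.1.prodMk hg.1), hf.2.comp₂_left (m := fun a b => Φ (a, b)) hg.2 h0⟩

lemma integral_mul_midOp {f g : Euc n → ℝ} (hf : f ∈ ccFun (Euc n)) (hg : g ∈ ccFun (Euc n))
    (a : Euc n) : ∫ x, midOp a f x * g x = ∫ x, f x * midOp a g x := by
  have i1 := ccFun_integrable (ccFun_mul (shiftOp_mem hf a) hg)
  have i2 := ccFun_integrable (ccFun_mul (shiftOp_mem hf (-a)) hg)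
  have i3 := ccFun_integrable (ccFun_mul hf (shiftOp_mem hg a))
  have i4 := ccFun_integrable (ccFun_mul hf (shiftOp_mem hg (-a)))
  have e1 : ∀ x, midOp a f x * g x = (1 / 2) * (shiftOp a f x * g x + shiftOp (-a) f x * g x) := by
    intro x; simp [midOp]; ring
  have e2 : ∀ x, f x * midOp a g x = (1 / 2) * (f x * shiftOp a g x + f x * shiftOp (-a) g x) := by
    intro x; simp [midOp]; ring
  simp_rw [e1, e2]
  rw [integral_const_mul, integral_const_mul, integral_add i1 i2, integral_add i3 i4,
    integral_mul_shiftOp, integral_mul_shiftOp, neg_neg, add_comm]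

lemma integral_mul_difOp {f g : Euc n → ℝ} (hf : f ∈ ccFun (Euc n)) (hg : g ∈ ccFun (Euc n))
    (a : Euc n) : ∫ x, difOp a f x * g x = -∫ x, f x * difOp a g x := by
  have i1 := ccFun_integrable (ccFun_mul (shiftOp_mem hf a) hg)
  have i2 := ccFun_integrable (ccFun_mul (shiftOp_mem hf (-a)) hg)
  have i3 := ccFun_integrable (ccFun_mul hf (shiftOp_mem hg a))
  have i4 := ccFun_integrable (ccFun_mul hf (shiftOp_mem hg (-a)))
  have e1 : ∀ x, difOp a f x * g x = shiftOp a f x * g x - shiftOp (-a) f x * g x := by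
    intro x; simp [difOp]; ring
  have e2 : ∀ x, f x * difOp a g x = f x * shiftOp a g x - f x * shiftOp (-a) g x := by
    intro x; simp [difOp]; ring
  simp_rw [e1, e2]
  rw [integral_sub i1 i2, integral_sub i3 i4,
    integral_mul_shiftOp, integral_mul_shiftOp, neg_neg]
  ring

lemma integral_mul_walkOp {f g : Euc n → ℝ} (hf : f ∈ ccFun (Euc n)) (hg : g ∈ ccFun (Euc n))
    (e : ι → Euc n) : ∫ x, walkOp e f x * g x = ∫ x, f x * walkOp e g x := by
  have i1 : ∀ i ∈ Finset.univ, Integrable fun x => midOp (e i) (midOp (e i) f) x * g x :=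
    fun i _ => ccFun_integrable (ccFun_mul (midOp_mem (midOp_mem hf _) _) hg)
  have i2 : ∀ i ∈ Finset.univ, Integrable fun x => f x * midOp (e i) (midOp (e i) g) x :=
    fun i _ => ccFun_integrable (ccFun_mul hf (midOp_mem (midOp_mem hg _) _))
  have e1 : ∀ x, walkOp e f x * g x
      = (1 / Fintype.card ι : ℝ) * ∑ i, midOp (e i) (midOp (e i) f) x * g x := by
    intro x; rw [walkOp_apply, mul_assoc, Finset.sum_mul]
  have e2 : ∀ x, f x * walkOp e g x
      = (1 / Fintype.card ι : ℝ) * ∑ i, f x * midOp (e i) (midOp (e i) g) x := by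
    intro x; rw [walkOp_apply, mul_left_comm, Finset.mul_sum]
  simp_rw [e1, e2]
  rw [integral_const_mul, integral_const_mul, integral_finsetSum _ i1, integral_finsetSum _ i2]
  congr 1
  refine Finset.sum_congr rfl fun i _ => ?_
  rw [integral_mul_midOp (midOp_mem hf _) hg, integral_mul_midOp hf (midOp_mem hg _)]

lemma integral_mul_walkOp_pow {f g : Euc n → ℝ} (hf : f ∈ ccFun (Euc n))
    (hg : g ∈ ccFun (Euc n)) (e : ι → Euc n) (k : ℕ) :
    ∫ x, (walkOp e ^ k) f x * g x = ∫ x, f x * (walkOp e ^ k) g x := by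
  induction k generalizing g with
  | zero => rfl
  | succ k ih =>
    rw [pow_succ']
    simp only [Module.End.mul_apply]
    rw [integral_mul_walkOp (walkOp_pow_mem hf e k) hg, ih (walkOp_mem hg e)]
    rw [← Module.End.mul_apply, ← pow_succ, pow_succ', Module.End.mul_apply]

lemma integral_shiftOp (f : Euc n → ℝ) (a : Euc n) : ∫ x, f (x + a) = ∫ x, f x :=
  integral_add_right_eq_self f a

/-- Integrated convexity gain under averaging of two translates. -/
lemma integral_midOp_gain {Φ : ℝ × ℝ → ℝ} (hΦ : Continuous Φ) (h0 : Φ 0 = 0)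
    (hgain : ∀ a b : ℝ × ℝ, 0 ≤ a → 0 ≤ b → ∀ s ∈ Icc (0:ℝ) 1,
        Φ ((1 - s) • a + s • b) + s * (1 - s) * (|b.1 - a.1| * |b.2 - a.2|)
          ≤ (1 - s) * Φ a + s * Φ b)
    {f g : Euc n → ℝ} (hf : f ∈ ccFun (Euc n)) (hg : g ∈ ccFun (Euc n)) (hf0 : 0 ≤ f)
    (hg0 : 0 ≤ g) (a : Euc n) :
    (∫ x, Φ (midOp a f x, midOp a g x)) + (1 / 4) * ∫ x, |difOp a f x| * |difOp a g x|
      ≤ ∫ x, Φ (f x, g x) := by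
  have i0 := ccFun_comp₂ hf hg hΦ h0
  have i1 := ccFun_integrable (ccFun_comp₂ (midOp_mem hf a) (midOp_mem hg a) hΦ h0)
  have i2 := ccFun_integrable (ccFun_mul (ccFun_comp (difOp_mem hf a) continuous_abs abs_zero)
    (ccFun_comp (difOp_mem hg a) continuous_abs abs_zero))
  have i3 := ccFun_integrable (shiftOp_mem i0 a)
  have i4 := ccFun_integrable (shiftOp_mem i0 (-a))
  have e : ∫ x, Φ (f x, g x) = ∫ x, ((1 / 2) * shiftOp a (fun x => Φ (f x, g x)) x
      + (1 / 2) * shiftOp (-a) (fun x => Φ (f x, g x)) x) := by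
    rw [integral_add (i3.const_mul _) (i4.const_mul _), integral_const_mul, integral_const_mul]
    simp only [shiftOp_apply]
    rw [integral_shiftOp (fun x => Φ (f x, g x)), integral_shiftOp (fun x => Φ (f x, g x))]
    ring
  rw [e, ← integral_const_mul, ← integral_add i1 (i2.const_mul _)]
  refine integral_mono (i1.add (i2.const_mul _)) ((i3.const_mul _).add (i4.const_mul _)) fun x => ?_
  have := hgain (f (x - a), g (x - a)) (f (x + a), g (x + a)) ⟨hf0 _, hg0 _⟩ ⟨hf0 _, hg0 _⟩ (1 / 2)
    (by constructor <;> norm_num)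
  have em : ((1 - 1 / 2 : ℝ) • (f (x - a), g (x - a)) + (1 / 2 : ℝ) • (f (x + a), g (x + a)))
      = (midOp a f x, midOp a g x) := by
    simp only [midOp_apply, Prod.smul_mk, Prod.mk_add_mk, smul_eq_mul]
    congr 1 <;> ring
  rw [em] at this
  simp only [shiftOp_apply, difOp_apply, ← sub_eq_add_neg]
  simp only at this
  linarith only [this]

lemma integral_walkOp_gain [Nonempty ι] {Φ : ℝ × ℝ → ℝ} (hΦ : Continuous Φ) (h0 : Φ 0 = 0)
    (hgain : ∀ a b : ℝ × ℝ, 0 ≤ a → 0 ≤ b → ∀ s ∈ Icc (0:ℝ) 1,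
        Φ ((1 - s) • a + s • b) + s * (1 - s) * (|b.1 - a.1| * |b.2 - a.2|)
          ≤ (1 - s) * Φ a + s * Φ b)
    {f g : Euc n → ℝ} (hf : f ∈ ccFun (Euc n)) (hg : g ∈ ccFun (Euc n)) (hf0 : 0 ≤ f)
    (hg0 : 0 ≤ g) (e : ι → Euc n) :
    (∫ x, Φ (walkOp e f x, walkOp e g x))
        + (1 / (4 * Fintype.card ι)) * ∑ i, ∫ x, |difOp (e i) f x| * |difOp (e i) g x|
      ≤ ∫ x, Φ (f x, g x) := by
  have hc : (0 : ℝ) < Fintype.card ι := by positivity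
  have hconv : ConvexOn ℝ (Ici (0 : ℝ × ℝ)) Φ := by
    refine ⟨convex_Ici 0, fun a ha b hb s t hs ht hst => ?_⟩
    have hs' : s = 1 - t := by linarith
    subst hs'
    have := hgain a b ha hb t ⟨ht, by linarith⟩
    have h2 : 0 ≤ t * (1 - t) * (|b.1 - a.1| * |b.2 - a.2|) := by positivity
    simp only [smul_eq_mul]
    linarith
  have hstep : ∀ i, (∫ x, Φ (midOp (e i) (midOp (e i) f) x, midOp (e i) (midOp (e i) g) x))
      + (1 / 4) * ∫ x, |difOp (e i) f x| * |difOp (e i) g x| ≤ ∫ x, Φ (f x, g x) := by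
    intro i
    have h1 := integral_midOp_gain hΦ h0 hgain hf hg hf0 hg0 (e i)
    have h2 := integral_midOp_gain hΦ h0 hgain (midOp_mem hf (e i)) (midOp_mem hg (e i))
      (midOp_nonneg hf0 _) (midOp_nonneg hg0 _) (e i)
    have h3 : 0 ≤ ∫ x, |difOp (e i) (midOp (e i) f) x| * |difOp (e i) (midOp (e i) g) x| :=
      integral_nonneg fun x => by positivity
    linarith
  have hI : ∀ i, Integrable
      fun x => Φ (midOp (e i) (midOp (e i) f) x, midOp (e i) (midOp (e i) g) x) := fun i =>
    ccFun_integrable (ccFun_comp₂ (midOp_mem (midOp_mem hf _) _) (midOp_mem (midOp_mem hg _) _) hΦ h0)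
  have hJ : (∫ x, Φ (walkOp e f x, walkOp e g x)) ≤ (1 / Fintype.card ι : ℝ) *
      ∑ i, ∫ x, Φ (midOp (e i) (midOp (e i) f) x, midOp (e i) (midOp (e i) g) x) := by
    rw [← integral_finsetSum _ fun i _ => hI i, ← integral_const_mul]
    refine integral_mono (ccFun_integrable (ccFun_comp₂ (walkOp_mem hf e) (walkOp_mem hg e) hΦ h0))
      ((integrable_finsetSum _ fun i _ => hI i).const_mul _) fun x => ?_
    have := hconv.map_sum_le (t := Finset.univ) (w := fun _ : ι => (1 / Fintype.card ι : ℝ))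
      (p := fun i => (midOp (e i) (midOp (e i) f) x, midOp (e i) (midOp (e i) g) x))
      (fun i _ => by positivity) (by simp [hc.ne'])
      (fun i _ => ⟨midOp_nonneg (midOp_nonneg hf0 _) _ x, midOp_nonneg (midOp_nonneg hg0 _) _ x⟩)
    rw [← Finset.smul_sum, ← Finset.smul_sum, smul_eq_mul] at this
    refine le_trans (le_of_eq ?_) this
    congr 1
    ext
    · simp [walkOp_apply, Prod.fst_sum]
    · simp [walkOp_apply, Prod.snd_sum]
  have hS := Finset.sum_le_sum fun (i : ι) (_ : i ∈ Finset.univ) => hstep i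
  rw [Finset.sum_add_distrib, ← Finset.mul_sum, Finset.sum_const, Finset.card_univ,
    nsmul_eq_mul] at hS
  have h5 := mul_le_mul_of_nonneg_left hS (by positivity : (0:ℝ) ≤ 1 / Fintype.card ι)
  rw [mul_add, ← mul_assoc, ← mul_assoc, one_div_mul_cancel hc.ne', one_mul] at h5
  have h6 : (1 / (Fintype.card ι : ℝ) * (1 / 4)) = 1 / (4 * Fintype.card ι) := by field_simp
  rw [h6] at h5
  linarith

lemma sum_walkOp_gain [Nonempty ι] {Φ : ℝ × ℝ → ℝ} (hΦ : Continuous Φ) (h0 : Φ 0 = 0)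
    (hΦ0 : ∀ a, 0 ≤ a → 0 ≤ Φ a)
    (hgain : ∀ a b : ℝ × ℝ, 0 ≤ a → 0 ≤ b → ∀ s ∈ Icc (0:ℝ) 1,
        Φ ((1 - s) • a + s • b) + s * (1 - s) * (|b.1 - a.1| * |b.2 - a.2|)
          ≤ (1 - s) * Φ a + s * Φ b)
    {f g : Euc n → ℝ} (hf : f ∈ ccFun (Euc n)) (hg : g ∈ ccFun (Euc n)) (hf0 : 0 ≤ f)
    (hg0 : 0 ≤ g) (e : ι → Euc n) (N : ℕ) :
    ∑ k ∈ Finset.range N, ∑ i, ∫ x,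
        |difOp (e i) ((walkOp e ^ k) f) x| * |difOp (e i) ((walkOp e ^ k) g) x|
      ≤ 4 * Fintype.card ι * ∫ x, Φ (f x, g x) := by
  have hc : (0 : ℝ) < Fintype.card ι := by positivity
  have key : (∫ x, Φ ((walkOp e ^ N) f x, (walkOp e ^ N) g x)) + (1 / (4 * Fintype.card ι)) *
      ∑ k ∈ Finset.range N, ∑ i, ∫ x,
        |difOp (e i) ((walkOp e ^ k) f) x| * |difOp (e i) ((walkOp e ^ k) g) x|
      ≤ ∫ x, Φ (f x, g x) := by
    induction N with
    | zero => simp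
    | succ N ih =>
      have := integral_walkOp_gain hΦ h0 hgain (walkOp_pow_mem hf e N) (walkOp_pow_mem hg e N)
        (walkOp_pow_nonneg hf0 e N) (walkOp_pow_nonneg hg0 e N) e
      rw [Finset.sum_range_succ, mul_add, pow_succ']
      simp only [Module.End.mul_apply]
      linarith
  have h1 : 0 ≤ ∫ x, Φ ((walkOp e ^ N) f x, (walkOp e ^ N) g x) := integral_nonneg fun x =>
    hΦ0 _ ⟨walkOp_pow_nonneg hf0 e N x, walkOp_pow_nonneg hg0 e N x⟩
  have h2 : (1 / (4 * Fintype.card ι : ℝ)) *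
      ∑ k ∈ Finset.range N, ∑ i, ∫ x,
        |difOp (e i) ((walkOp e ^ k) f) x| * |difOp (e i) ((walkOp e ^ k) g) x|
      ≤ ∫ x, Φ (f x, g x) := by linarith
  rwa [one_div, inv_mul_le_iff₀ (by positivity)] at h2

end Walk

section WalkLp

variable {n : ℕ} {ι : Type} [Fintype ι]

lemma abs_rpow_mem {f : Euc n → ℝ} (hf : f ∈ ccFun (Euc n)) {q : ℝ} (hq : 0 < q) :
    (fun x => |f x| ^ q) ∈ ccFun (Euc n) :=
  ccFun_comp hf (Φ := fun t => |t| ^ q) (continuous_abs.rpow_const fun _ => Or.inr hq.le)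
    (by simp [hq.ne'])

lemma abs_mul_abs_mem {f g : Euc n → ℝ} (hf : f ∈ ccFun (Euc n)) (hg : g ∈ ccFun (Euc n)) :
    (fun x => |f x| * |g x|) ∈ ccFun (Euc n) :=
  ccFun_mul (ccFun_comp hf continuous_abs abs_zero) (ccFun_comp hg continuous_abs abs_zero)

lemma integral_abs_midOp_rpow_le {f : Euc n → ℝ} (hf : f ∈ ccFun (Euc n)) {q : ℝ} (hq : 1 ≤ q)
    (a : Euc n) : ∫ x, |midOp a f x| ^ q ≤ ∫ x, |f x| ^ q := by
  have hq0 : 0 < q := by linarith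
  have i0 := abs_rpow_mem hf hq0
  have i3 := ccFun_integrable (shiftOp_mem i0 a)
  have i4 := ccFun_integrable (shiftOp_mem i0 (-a))
  have e : ∫ x, |f x| ^ q = ∫ x, ((1 / 2) * shiftOp a (fun x => |f x| ^ q) x
      + (1 / 2) * shiftOp (-a) (fun x => |f x| ^ q) x) := by
    rw [integral_add (i3.const_mul _) (i4.const_mul _), integral_const_mul, integral_const_mul]
    simp only [shiftOp_apply]
    rw [integral_shiftOp (fun x => |f x| ^ q), integral_shiftOp (fun x => |f x| ^ q)]
    ring
  rw [e]
  refine integral_mono (ccFun_integrable (abs_rpow_mem (midOp_mem hf a) hq0))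
    ((i3.const_mul _).add (i4.const_mul _)) fun x => ?_
  simp only [shiftOp_apply, midOp_apply, ← sub_eq_add_neg]
  have h1 : |1 / 2 * (f (x + a) + f (x - a))| ≤ 1 / 2 * |f (x + a)| + 1 / 2 * |f (x - a)| := by
    rw [abs_mul, abs_of_pos (by norm_num : (0:ℝ) < 1 / 2), ← mul_add]
    gcongr
    exact abs_add_le _ _
  have h2 := (convexOn_rpow hq).2 (mem_Ici.2 (abs_nonneg (f (x + a))))
    (mem_Ici.2 (abs_nonneg (f (x - a)))) (by norm_num : (0:ℝ) ≤ 1 / 2)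
    (by norm_num : (0:ℝ) ≤ 1 / 2) (by norm_num)
  exact (Real.rpow_le_rpow (abs_nonneg _) h1 hq0.le).trans h2

lemma integral_abs_walkOp_rpow_le [Nonempty ι] {f : Euc n → ℝ} (hf : f ∈ ccFun (Euc n)) {q : ℝ}
    (hq : 1 ≤ q) (e : ι → Euc n) : ∫ x, |walkOp e f x| ^ q ≤ ∫ x, |f x| ^ q := by
  have hq0 : 0 < q := by linarith
  have hc : (0 : ℝ) < Fintype.card ι := by positivity
  have hI : ∀ i, Integrable fun x => |midOp (e i) (midOp (e i) f) x| ^ q := fun i =>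
    ccFun_integrable (abs_rpow_mem (midOp_mem (midOp_mem hf _) _) hq0)
  have hJ : (∫ x, |walkOp e f x| ^ q) ≤ (1 / Fintype.card ι : ℝ) *
      ∑ i, ∫ x, |midOp (e i) (midOp (e i) f) x| ^ q := by
    rw [← integral_finsetSum _ fun i _ => hI i, ← integral_const_mul]
    refine integral_mono (ccFun_integrable (abs_rpow_mem (walkOp_mem hf e) hq0))
      ((integrable_finsetSum _ fun i _ => hI i).const_mul _) fun x => ?_
    have h1 := Real.rpow_arith_mean_le_arith_mean_rpow Finset.univ
      (fun _ : ι => (1 / Fintype.card ι : ℝ)) (fun i => |midOp (e i) (midOp (e i) f) x|)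
      (fun i _ => by positivity) (by simp [hc.ne']) (fun i _ => abs_nonneg _) hq
    rw [← Finset.mul_sum, ← Finset.mul_sum] at h1
    refine le_trans (Real.rpow_le_rpow (abs_nonneg _) ?_ hq0.le) h1
    rw [walkOp_apply, abs_mul, abs_of_pos (by positivity : (0:ℝ) < 1 / Fintype.card ι)]
    gcongr
    exact Finset.abs_sum_le_sum_abs _ _
  refine hJ.trans ?_
  have : ∑ i, ∫ x, |midOp (e i) (midOp (e i) f) x| ^ q ≤ ∑ _i : ι, ∫ x, |f x| ^ q :=
    Finset.sum_le_sum fun i _ => (integral_abs_midOp_rpow_le (midOp_mem hf _) hq _).trans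
      (integral_abs_midOp_rpow_le hf hq _)
  rw [Finset.sum_const, Finset.card_univ, nsmul_eq_mul] at this
  rw [one_div, inv_mul_le_iff₀ hc]
  exact this

lemma integral_abs_walkOp_pow_le [Nonempty ι] {f : Euc n → ℝ} (hf : f ∈ ccFun (Euc n))
    (e : ι → Euc n) (k : ℕ) : ∫ x, |(walkOp e ^ k) f x| ≤ ∫ x, |f x| := by
  induction k with
  | zero => simp
  | succ k ih =>
    rw [pow_succ', Module.End.mul_apply]
    have := integral_abs_walkOp_rpow_le (walkOp_pow_mem hf e k) le_rfl e
    simp only [Real.rpow_one] at this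
    exact this.trans ih

/-- Bilinear embedding for the random walk, for signed functions. -/
lemma exists_walkOp_embedding {p q : ℝ} (hpq : p.HolderConjugate q) :
    ∃ C : ℝ, 0 < C ∧ ∀ (n : ℕ) (ι : Type) [Fintype ι] [Nonempty ι] (e : ι → Euc n)
      (f g : Euc n → ℝ), f ∈ ccFun (Euc n) → g ∈ ccFun (Euc n) → ∀ N : ℕ,
      ∑ k ∈ Finset.range N, ∑ i, ∫ x,
        |difOp (e i) ((walkOp e ^ k) f) x| * |difOp (e i) ((walkOp e ^ k) g) x|
      ≤ 4 * Fintype.card ι * (C * ((∫ x, |f x| ^ p) + ∫ x, |g x| ^ q)) := by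
  obtain ⟨C, hC, Φ, hΦ, hΦ0, hΦC, hgain⟩ := exists_bellman hpq
  refine ⟨4 * C, by positivity, fun n ι _ _ e f g hf hg N => ?_⟩
  have hp0 : 0 < p := hpq.pos
  have hq0 : 0 < q := hpq.symm.pos
  have h0 : Φ 0 = 0 := by
    refine le_antisymm ?_ (hΦ0 0 le_rfl)
    have := hΦC 0 le_rfl
    simpa [Real.zero_rpow hp0.ne', Real.zero_rpow hq0.ne'] using this
  let P : (Euc n → ℝ) → Euc n → ℝ := fun f x => max (f x) 0
  let M : (Euc n → ℝ) → Euc n → ℝ := fun f x => max (-f x) 0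
  have hP : ∀ {f : Euc n → ℝ}, f ∈ ccFun (Euc n) → P f ∈ ccFun (Euc n) := fun hf =>
    ccFun_comp hf (Φ := fun t => max t 0) (by fun_prop) (by simp)
  have hM : ∀ {f : Euc n → ℝ}, f ∈ ccFun (Euc n) → M f ∈ ccFun (Euc n) := fun hf =>
    ccFun_comp hf (Φ := fun t => max (-t) 0) (by fun_prop) (by simp)
  have hdec : ∀ f : Euc n → ℝ, f = P f - M f := fun f => by
    ext x
    simp only [P, M, Pi.sub_apply]
    rcases le_total 0 (f x) with h | h
    · rw [max_eq_left h, max_eq_right (by linarith)]; ring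
    · rw [max_eq_right h, max_eq_left (by linarith)]; ring
  have hP0 : ∀ f, 0 ≤ P f := fun f x => le_max_right _ _
  have hM0 : ∀ f, 0 ≤ M f := fun f x => le_max_right _ _
  have hPa : ∀ f x, P f x ≤ |f x| := fun f x => max_le (le_abs_self _) (abs_nonneg _)
  have hMa : ∀ f x, M f x ≤ |f x| := fun f x => max_le (neg_le_abs _) (abs_nonneg _)
  have key : ∀ a b : Euc n → ℝ, a ∈ ccFun (Euc n) → b ∈ ccFun (Euc n) → 0 ≤ a → 0 ≤ b →
      (∀ x, a x ≤ |f x|) → (∀ x, b x ≤ |g x|) →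
      ∑ k ∈ Finset.range N, ∑ i, ∫ x,
        |difOp (e i) ((walkOp e ^ k) a) x| * |difOp (e i) ((walkOp e ^ k) b) x|
      ≤ 4 * Fintype.card ι * (C * ((∫ x, |f x| ^ p) + ∫ x, |g x| ^ q)) := by
    intro a b ha hb ha0 hb0 haf hbg
    refine (sum_walkOp_gain hΦ h0 hΦ0 hgain ha hb ha0 hb0 e N).trans ?_
    have i1 := ccFun_integrable (abs_rpow_mem hf hp0)
    have i2 := ccFun_integrable (abs_rpow_mem hg hq0)
    gcongr
    rw [← integral_add i1 i2, ← integral_const_mul]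
    refine integral_mono (ccFun_integrable (ccFun_comp₂ ha hb hΦ h0)) ((i1.add i2).const_mul _)
      fun x => (hΦC (a x, b x) ⟨ha0 x, hb0 x⟩).trans ?_
    have ha0' : 0 ≤ a x := ha0 x
    have hb0' : 0 ≤ b x := hb0 x
    have := haf x
    have := hbg x
    gcongr
  have k1 := key _ _ (hP hf) (hP hg) (hP0 f) (hP0 g) (hPa f) (hPa g)
  have k2 := key _ _ (hP hf) (hM hg) (hP0 f) (hM0 g) (hPa f) (hMa g)
  have k3 := key _ _ (hM hf) (hP hg) (hM0 f) (hP0 g) (hMa f) (hPa g)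
  have k4 := key _ _ (hM hf) (hM hg) (hM0 f) (hM0 g) (hMa f) (hMa g)
  have hsum : ∑ k ∈ Finset.range N, ∑ i, ∫ x,
        |difOp (e i) ((walkOp e ^ k) f) x| * |difOp (e i) ((walkOp e ^ k) g) x| ≤
      ∑ k ∈ Finset.range N, ∑ i,
      ((∫ x, |difOp (e i) ((walkOp e ^ k) (P f)) x| * |difOp (e i) ((walkOp e ^ k) (P g)) x|) +
      (∫ x, |difOp (e i) ((walkOp e ^ k) (P f)) x| * |difOp (e i) ((walkOp e ^ k) (M g)) x|) +
      (∫ x, |difOp (e i) ((walkOp e ^ k) (M f)) x| * |difOp (e i) ((walkOp e ^ k) (P g)) x|) +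
      (∫ x, |difOp (e i) ((walkOp e ^ k) (M f)) x| * |difOp (e i) ((walkOp e ^ k) (M g)) x|)) := by
    refine Finset.sum_le_sum fun k _ => Finset.sum_le_sum fun i _ => ?_
    have m : ∀ {a : Euc n → ℝ}, a ∈ ccFun (Euc n) →
        difOp (e i) ((walkOp e ^ k) a) ∈ ccFun (Euc n) := fun ha =>
      difOp_mem (walkOp_pow_mem ha e k) _
    have j : ∀ {a b : Euc n → ℝ}, a ∈ ccFun (Euc n) → b ∈ ccFun (Euc n) → Integrable fun x =>
        |difOp (e i) ((walkOp e ^ k) a) x| * |difOp (e i) ((walkOp e ^ k) b) x| := fun ha hb =>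
      ccFun_integrable (abs_mul_abs_mem (m ha) (m hb))
    have j1 := j (hP hf) (hP hg)
    have j2 := j (hP hf) (hM hg)
    have j3 := j (hM hf) (hP hg)
    have j4 := j (hM hf) (hM hg)
    refine (integral_mono (j hf hg) (((j1.add j2).add j3).add j4) fun x => ?_).trans (le_of_eq ?_)
    swap
    · rw [integral_add' ((j1.add j2).add j3) j4, integral_add' (j1.add j2) j3, integral_add' j1 j2]
    have s1 : ∀ f, difOp (e i) ((walkOp e ^ k) f) x = difOp (e i) ((walkOp e ^ k) (P f)) x
        - difOp (e i) ((walkOp e ^ k) (M f)) x := fun f => by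
      conv_lhs => rw [hdec f, map_sub, map_sub]
      rfl
    simp only [Pi.add_apply]
    rw [s1 f, s1 g]
    refine (mul_le_mul (abs_sub _ _) (abs_sub _ _) (abs_nonneg _) (by positivity)).trans
      (le_of_eq (by ring))
  simp only [Finset.sum_add_distrib] at hsum
  refine hsum.trans ?_
  linarith

end WalkLp

section WalkConsistency

variable {n : ℕ} {ι : Type} [Fintype ι]

/-- The odd power `t |t| ^ (p - 2)`. -/
def oddPow (p t : ℝ) : ℝ := max t 0 ^ (p - 1) - max (-t) 0 ^ (p - 1)

lemma oddPow_continuous {p : ℝ} (hp : 1 < p) : Continuous (oddPow p) := by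
  unfold oddPow
  have h : 0 ≤ p - 1 := by linarith
  exact ((continuous_id.max continuous_const).rpow_const fun _ => Or.inr h).sub
    ((continuous_id.neg.max continuous_const).rpow_const fun _ => Or.inr h)

lemma oddPow_of_nonneg {p t : ℝ} (hp : 1 < p) (ht : 0 ≤ t) : oddPow p t = t ^ (p - 1) := by
  have h : p - 1 ≠ 0 := by linarith
  rw [oddPow, max_eq_left ht, max_eq_right (by linarith), Real.zero_rpow h, sub_zero]

lemma oddPow_of_nonpos {p t : ℝ} (hp : 1 < p) (ht : t ≤ 0) : oddPow p t = -(-t) ^ (p - 1) := by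
  have h : p - 1 ≠ 0 := by linarith
  rw [oddPow, max_eq_right ht, max_eq_left (by linarith), Real.zero_rpow h, zero_sub]

lemma oddPow_zero {p : ℝ} (hp : 1 < p) : oddPow p 0 = 0 := by
  have h : p - 1 ≠ 0 := by linarith
  rw [oddPow_of_nonneg hp le_rfl, Real.zero_rpow h]

lemma mul_oddPow {p : ℝ} (hp : 1 < p) (t : ℝ) : t * oddPow p t = |t| ^ p := by
  rcases le_total 0 t with h | h
  · rw [oddPow_of_nonneg hp h, abs_of_nonneg h]
    rw [mul_comm, ← Real.rpow_add_one' h (by linarith)]; ring_nf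
  · have h' : 0 ≤ -t := by linarith
    rw [oddPow_of_nonpos hp h, abs_of_nonpos h, mul_neg, ← neg_mul]
    rw [mul_comm, ← Real.rpow_add_one' h' (by linarith)]; ring_nf

lemma abs_oddPow_rpow {p q : ℝ} (hpq : p.HolderConjugate q) (t : ℝ) :
    |oddPow p t| ^ q = |t| ^ p := by
  have hp : 1 < p := hpq.lt
  have e : (p - 1) * q = p := hpq.sub_one_mul_conj
  have h : |oddPow p t| = |t| ^ (p - 1) := by
    rcases le_total 0 t with h | h
    · rw [oddPow_of_nonneg hp h, abs_of_nonneg h, abs_of_nonneg (by positivity)]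
    · have h' : 0 ≤ -t := by linarith
      rw [oddPow_of_nonpos hp h, abs_of_nonpos h, abs_neg, abs_of_nonneg (by positivity)]
  rw [h, ← Real.rpow_mul (abs_nonneg _), e]

lemma integral_mul_le_of_abs_le {f g : Euc n → ℝ} (hf : f ∈ ccFun (Euc n))
    (hg : g ∈ ccFun (Euc n)) {c : ℝ} (hc : ∀ x, |f x| ≤ c) :
    |∫ x, f x * g x| ≤ c * ∫ x, |g x| := by
  rw [← integral_const_mul]
  refine (abs_integral_le_integral_abs).trans ?_
  refine integral_mono (ccFun_integrable (ccFun_comp (ccFun_mul hf hg) continuous_abs abs_zero))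
    ((ccFun_integrable (ccFun_comp hg continuous_abs abs_zero)).const_mul _) fun x => ?_
  simp only [abs_mul]
  gcongr
  exact hc x

lemma abs_integral_mul_le {f g : Euc n → ℝ} (hf : f ∈ ccFun (Euc n))
    (hg : g ∈ ccFun (Euc n)) {c : ℝ} (hc : 0 < c) :
    |∫ x, f x * g x| ≤ c * (∫ x, |f x| ^ (2:ℝ)) + (1 / c) * ∫ x, |g x| ^ (2:ℝ) := by
  have i1 := ccFun_integrable (abs_rpow_mem hf two_pos)
  have i2 := ccFun_integrable (abs_rpow_mem hg two_pos)
  rw [← integral_const_mul, ← integral_const_mul,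
    ← integral_add (i1.const_mul _) (i2.const_mul _)]
  refine (abs_integral_le_integral_abs).trans ?_
  refine integral_mono (ccFun_integrable (ccFun_comp (ccFun_mul hf hg) continuous_abs abs_zero))
    ((i1.const_mul _).add (i2.const_mul _)) fun x => ?_
  simp only [abs_mul, Real.rpow_two, sq_abs]
  have h := sq_nonneg (c * |f x| - |g x|)
  rw [sub_sq, mul_pow, sq_abs, sq_abs] at h
  have h2 : 2 * (|f x| * |g x|) ≤ c * f x ^ 2 + 1 / c * g x ^ 2 := by
    have h3 : 0 ≤ (1 / c) * (c ^ 2 * f x ^ 2 - 2 * (c * |f x|) * |g x| + g x ^ 2) := by positivity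
    have h4 : (1 / c) * (c ^ 2 * f x ^ 2 - 2 * (c * |f x|) * |g x| + g x ^ 2)
      = c * f x ^ 2 - 2 * (|f x| * |g x|) + 1 / c * g x ^ 2 := by field_simp
    linarith
  have h5 : 0 ≤ |f x| * |g x| := by positivity
  linarith

/-- Decay of the energy of the iterates of the random walk. -/
lemma exists_energy_decay : ∃ C : ℝ, 0 < C ∧ ∀ (n : ℕ) (ι : Type) [Fintype ι] [Nonempty ι]
      (e : ι → Euc n) (f : Euc n → ℝ), f ∈ ccFun (Euc n) → ∀ (N : ℕ) (i : ι),
      N * ∫ x, |difOp (e i) ((walkOp e ^ N) f) x| ^ (2:ℝ)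
        ≤ C * Fintype.card ι * ∫ x, |f x| ^ (2:ℝ) := by
  obtain ⟨C, hC, H⟩ := exists_walkOp_embedding Real.HolderConjugate.two_two
  refine ⟨8 * C, by positivity, fun n ι _ _ e f hf N i => ?_⟩
  have h1 := H n ι e f f hf hf N
  have hanti : Antitone fun k => ∫ x, |difOp (e i) ((walkOp e ^ k) f) x| ^ (2:ℝ) := by
    refine antitone_nat_of_succ_le fun k => ?_
    have hc : difOp (e i) ((walkOp e ^ (k + 1)) f) = walkOp e (difOp (e i) ((walkOp e ^ k) f)) := by
      rw [pow_succ', Module.End.mul_apply, ← Module.End.mul_apply, (commute_difOp_walkOp _ _).eq,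
        Module.End.mul_apply]
    rw [hc]
    exact integral_abs_walkOp_rpow_le (difOp_mem (walkOp_pow_mem hf e k) _) one_le_two e
  have h2 : N * ∫ x, |difOp (e i) ((walkOp e ^ N) f) x| ^ (2:ℝ) ≤
      ∑ k ∈ Finset.range N, ∫ x, |difOp (e i) ((walkOp e ^ k) f) x| ^ (2:ℝ) := by
    have := Finset.card_nsmul_le_sum (Finset.range N)
      (fun k => ∫ x, |difOp (e i) ((walkOp e ^ k) f) x| ^ (2:ℝ))
      (∫ x, |difOp (e i) ((walkOp e ^ N) f) x| ^ (2:ℝ))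
      (fun k hk => hanti (Finset.mem_range.1 hk).le)
    simpa using this
  refine h2.trans (le_trans ?_ (h1.trans (le_of_eq (by ring))))
  refine Finset.sum_le_sum fun k _ => ?_
  have e1 : (fun x => |difOp (e i) ((walkOp e ^ k) f) x| ^ (2:ℝ)) = fun x =>
      |difOp (e i) ((walkOp e ^ k) f) x| * |difOp (e i) ((walkOp e ^ k) f) x| := by
    ext x; rw [Real.rpow_two, pow_two]
  rw [e1]
  exact Finset.single_le_sum (f := fun i => ∫ x,
    |difOp (e i) ((walkOp e ^ k) f) x| * |difOp (e i) ((walkOp e ^ k) f) x|)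
    (fun i _ => integral_nonneg fun x => by positivity) (Finset.mem_univ i)

/-- Decomposition of a pairing along the random walk. -/
lemma integral_mul_eq_walk {f g : Euc n → ℝ} (hf : f ∈ ccFun (Euc n)) (hg : g ∈ ccFun (Euc n))
    (e : ι → Euc n) (N : ℕ) :
    ∫ x, f x * g x = (∫ x, (walkOp e ^ N) f x * (walkOp e ^ N) g x) +
      ∑ k ∈ Finset.range N, ∫ x, (walkOp e ^ k) ((1 - walkOp e) f) x *
        (walkOp e ^ k) (g + walkOp e g) x := by
  induction N with
  | zero => simp
  | succ N ih =>
    rw [Finset.sum_range_succ, ih]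
    have m1 := walkOp_pow_mem hf e N
    have m2 := walkOp_pow_mem hg e N
    have m3 := walkOp_mem m1 e
    have m4 := walkOp_mem m2 e
    have i1 := ccFun_integrable (ccFun_mul m1 m2)
    have i2 := ccFun_integrable (ccFun_mul m1 m4)
    have i3 := ccFun_integrable (ccFun_mul m3 m2)
    have i4 := ccFun_integrable (ccFun_mul m3 m4)
    have e1 : ∀ f, (walkOp e ^ N) (walkOp e f) = walkOp e ((walkOp e ^ N) f) := fun f => by
      rw [← Module.End.mul_apply, ← pow_succ, pow_succ', Module.End.mul_apply]
    have e2 : ∀ x, (walkOp e ^ N) ((1 - walkOp e) f) x * (walkOp e ^ N) (g + walkOp e g) x =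
        (((walkOp e ^ N) f x * (walkOp e ^ N) g x
          + (walkOp e ^ N) f x * walkOp e ((walkOp e ^ N) g) x)
        - walkOp e ((walkOp e ^ N) f) x * (walkOp e ^ N) g x)
        - walkOp e ((walkOp e ^ N) f) x * walkOp e ((walkOp e ^ N) g) x := by
      intro x
      simp only [LinearMap.sub_apply, Module.End.one_apply, map_sub, map_add, e1, Pi.sub_apply,
        Pi.add_apply]
      ring
    have e3 : ∫ x, (walkOp e ^ N) f x * walkOp e ((walkOp e ^ N) g) x =
        ∫ x, walkOp e ((walkOp e ^ N) f) x * (walkOp e ^ N) g x :=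
      (integral_mul_walkOp m1 m2 e).symm
    have e4 : ∫ x, (walkOp e ^ N) ((1 - walkOp e) f) x * (walkOp e ^ N) (g + walkOp e g) x =
        (∫ x, (walkOp e ^ N) f x * (walkOp e ^ N) g x) -
          ∫ x, walkOp e ((walkOp e ^ N) f) x * walkOp e ((walkOp e ^ N) g) x := by
      have s1 := integral_sub' ((i1.add i2).sub i3) i4
      rw [integral_sub' (i1.add i2) i3, integral_add' i1 i2, e3, add_sub_cancel_right] at s1
      rw [← s1]
      exact integral_congr_ae (Filter.Eventually.of_forall e2)
    rw [e4, pow_succ']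
    simp only [Module.End.mul_apply]
    ring

/-- `L^p` bound for functions whose discrete Laplacian is a sum of discrete second differences,
up to consistency errors. -/
lemma exists_lp_bound_of_consistency {p q : ℝ} (hpq : p.HolderConjugate q) (ι : Type) [Fintype ι]
    [Nonempty ι] : ∃ C : ℝ, 0 < C ∧ ∀ (n : ℕ) (e : ι → Euc n) (f : Euc n → ℝ)
      (F u : ι → Euc n → ℝ), f ∈ ccFun (Euc n) → (∀ i, F i ∈ ccFun (Euc n)) →
      (∀ i, u i ∈ ccFun (Euc n)) → ∀ K : ℝ,
      (∀ h ∈ Ioc (0:ℝ) 1, ∀ x, |∑ i, difOp (h • e i) (difOp (h • e i) (f - F i)) x| ≤ K * h ^ 3) →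
      (∀ h ∈ Ioc (0:ℝ) 1, ∀ x, |f x - (1 / (2 * h)) * ∑ i, difOp (h • e i) (u i) x| ≤ K * h) →
      ∫ x, |f x| ^ p ≤ C * ∑ i, ∫ x, |F i x| ^ p := by
  have hp := hpq.lt
  have hq := hpq.symm.lt
  have hp0 : 0 < p := by linarith
  have hq0 : 0 < q := by linarith
  obtain ⟨C, hC, HC⟩ := exists_walkOp_embedding hpq
  obtain ⟨D, hD, HD⟩ := exists_energy_decay
  set m : ℝ := ((Fintype.card ι : ℕ) : ℝ) with hm
  have hm0 : 0 < m := by rw [hm]; positivity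
  obtain ⟨lam, hlam, hlamq⟩ : ∃ lam : ℝ, 0 < lam ∧ lam ^ q = 8 * C * m * 2 ^ q := by
    refine ⟨(8 * C * m * 2 ^ q) ^ (1 / q), by positivity, ?_⟩
    rw [← Real.rpow_mul (by positivity), one_div_mul_cancel hq0.ne', Real.rpow_one]
  refine ⟨2 * (4 * C * lam ^ p), by positivity, ?_⟩
  intro n e f F u hf hF hu K hK1 hK2
  set g : Euc n → ℝ := fun x => oddPow p (f x) with hgdef
  have hg : g ∈ ccFun (Euc n) := ccFun_comp hf (oddPow_continuous hp) (oddPow_zero hp)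
  have hfg : ∫ x, f x * g x = ∫ x, |f x| ^ p := by
    simp only [hgdef, mul_oddPow hp]
  have hgq : ∫ x, |g x| ^ q = ∫ x, |f x| ^ p := by
    simp only [hgdef, abs_oddPow_rpow hpq]
  set X := ∫ x, |f x| ^ p with hX
  set Y := ∑ i, ∫ x, |F i x| ^ p with hY
  set G := ∫ x, |g x| with hG
  set G2 := ∫ x, |g x| ^ (2:ℝ) with hG2
  set U2 := ∑ i, ∫ x, |u i x| ^ (2:ℝ) with hU2
  have hG0 : 0 ≤ G := integral_nonneg fun x => abs_nonneg _
  have hK : 0 ≤ K := by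
    have := hK2 1 ⟨one_pos, le_rfl⟩ 0
    have h2 := abs_nonneg (f 0 - (1 / (2 * 1)) * ∑ i, difOp ((1:ℝ) • e i) (u i) 0)
    linarith
  -- main estimate at a fixed scale
  have main : ∀ j : ℕ, 0 < j → X ≤ 4 * C * lam ^ p * Y + X / 2 +
      (K / (2 * m) * G + K * G + D * m * U2 + m * G2) * (1 / (j:ℝ)) := by
    intro j hj
    have hj0 : (0:ℝ) < j := by exact_mod_cast hj
    have hj1 : (1:ℝ) ≤ j := by exact_mod_cast hj
    obtain ⟨h, hh⟩ : ∃ h : ℝ, h = 1 / (j:ℝ) ^ 4 := ⟨_, rfl⟩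
    have hh0 : 0 < h := by rw [hh]; positivity
    have hh1 : h ≤ 1 := by
      rw [hh, div_le_one (by positivity)]; exact one_le_pow₀ hj1
    have hhI : h ∈ Ioc (0:ℝ) 1 := ⟨hh0, hh1⟩
    set N := j ^ 10 with hN
    set e' : ι → Euc n := fun i => h • e i with he'
    set A := walkOp e' with hA
    set g' := g + A g with hg'
    have hAg : A g ∈ ccFun (Euc n) := walkOp_mem hg e'
    have hg'm : g' ∈ ccFun (Euc n) := (ccFun _).add_mem hg hAg
    have hAk : ∀ {f}, f ∈ ccFun (Euc n) → ∀ k, (A ^ k) f ∈ ccFun (Euc n) := fun hf k =>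
      walkOp_pow_mem hf e' k
    -- bounds on the derivative of `g`
    have hg'1 : ∫ x, |g' x| ≤ 2 * G := by
      have i1 := ccFun_integrable (ccFun_comp hg continuous_abs abs_zero)
      have i2 := ccFun_integrable (ccFun_comp hAg continuous_abs abs_zero)
      have h1 : ∫ x, |A g x| ≤ G := by simpa using integral_abs_walkOp_pow_le hg e' 1
      calc ∫ x, |g' x| ≤ ∫ x, (|g x| + |A g x|) :=
            integral_mono (ccFun_integrable (ccFun_comp hg'm continuous_abs abs_zero))
              (i1.add i2) fun x => abs_add_le _ _
        _ = G + ∫ x, |A g x| := integral_add i1 i2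
        _ ≤ 2 * G := by linarith
    have hg'q : ∫ x, |g' x| ^ q ≤ 2 ^ q * X := by
      have i1 := ccFun_integrable (abs_rpow_mem hg hq0)
      have i2 := ccFun_integrable (abs_rpow_mem hAg hq0)
      have h1 := integral_abs_walkOp_rpow_le hg hq.le e'
      have h2 : ∫ x, |g' x| ^ q ≤ ∫ x, 2 ^ (q - 1) * (|g x| ^ q + |A g x| ^ q) := by
        refine integral_mono (ccFun_integrable (abs_rpow_mem hg'm hq0))
          ((i1.add i2).const_mul _) fun x => ?_
        refine (Real.rpow_le_rpow (abs_nonneg _) (abs_add_le (g x) (A g x)) hq0.le).trans ?_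
        exact_mod_cast NNReal.rpow_add_le_mul_rpow_add_rpow ⟨_, abs_nonneg (g x)⟩
          ⟨_, abs_nonneg (A g x)⟩ hq.le
      rw [integral_const_mul, integral_add i1 i2] at h2
      have h3 : (2:ℝ) ^ q = 2 ^ (q - 1) * 2 := by
        rw [← Real.rpow_add_one two_ne_zero]; ring_nf
      calc _ ≤ _ := h2
        _ ≤ 2 ^ (q - 1) * (X + X) := by
            gcongr
            · exact hgq.le
            · exact h1.trans hgq.le
        _ = 2 ^ q * X := by rw [h3]; ring
    -- the error term of the Laplacian
    set err : Euc n → ℝ := ∑ i, difOp (e' i) (difOp (e' i) (f - F i)) with herr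
    have herrm : err ∈ ccFun (Euc n) := (ccFun _).sum_mem fun i _ =>
      difOp_mem (difOp_mem ((ccFun _).sub_mem hf (hF i)) _) _
    have herrb : ∀ x, |err x| ≤ K * h ^ 3 := fun x => by
      have := hK1 h hhI x
      simpa only [herr, Finset.sum_apply] using this
    have hlap : (1 - A) f = -((1 / (4 * m)) • (err + ∑ i, difOp (e' i) (difOp (e' i) (F i)))) := by
      rw [hA, one_sub_walkOp, herr, ← Finset.sum_add_distrib]
      simp only [LinearMap.neg_apply, LinearMap.smul_apply, LinearMap.sum_apply,
        Module.End.mul_apply, map_sub, sub_add_cancel, hm]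
    have hcomm : ∀ (i : ι) (k : ℕ) (a : Euc n → ℝ),
        (A ^ k) (difOp (e' i) a) = difOp (e' i) ((A ^ k) a) := fun i k a => by
      rw [← Module.End.mul_apply, ← Module.End.mul_apply,
        ((commute_difOp_walkOp (e' i) e').pow_right k).eq]
    -- each term of the sum
    have hterm : ∀ k, ∫ x, (A ^ k) ((1 - A) f) x * (A ^ k) g' x ≤
        (1 / (4 * m)) * (K * h ^ 3 * (2 * G) + ∑ i, ∫ x,
          |difOp (e' i) ((A ^ k) (F i)) x| * |difOp (e' i) ((A ^ k) g') x|) := by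
      intro k
      have e1 : ∀ x, (A ^ k) ((1 - A) f) x * (A ^ k) g' x = -(1 / (4 * m)) *
          ((A ^ k) err x * (A ^ k) g' x +
            ∑ i, difOp (e' i) (difOp (e' i) ((A ^ k) (F i))) x * (A ^ k) g' x) := by
        intro x
        rw [hlap]
        simp only [map_neg, map_smul, map_add, map_sum, hcomm, Pi.neg_apply, Pi.smul_apply,
          Pi.add_apply, Finset.sum_apply, smul_eq_mul, ← Finset.sum_mul]
        ring
      have i1 := ccFun_integrable (ccFun_mul (hAk herrm k) (hAk hg'm k))
      have i2 : ∀ i ∈ Finset.univ, Integrable fun x =>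
          difOp (e' i) (difOp (e' i) ((A ^ k) (F i))) x * (A ^ k) g' x := fun i _ =>
        ccFun_integrable (ccFun_mul (difOp_mem (difOp_mem (hAk (hF i) k) _) _) (hAk hg'm k))
      simp_rw [e1]
      rw [integral_const_mul, integral_add i1 (integrable_finsetSum _ i2), integral_finsetSum _ i2]
      have b1 : |∫ x, (A ^ k) err x * (A ^ k) g' x| ≤ K * h ^ 3 * (2 * G) := by
        rw [integral_mul_walkOp_pow herrm (hAk hg'm k)]
        refine (integral_mul_le_of_abs_le herrm (hAk (hAk hg'm k) k) herrb).trans ?_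
        gcongr
        exact (integral_abs_walkOp_pow_le (hAk hg'm k) e' k).trans
          ((integral_abs_walkOp_pow_le hg'm e' k).trans hg'1)
      have b2 : |∑ i, ∫ x, difOp (e' i) (difOp (e' i) ((A ^ k) (F i))) x * (A ^ k) g' x| ≤
          ∑ i, ∫ x, |difOp (e' i) ((A ^ k) (F i)) x| * |difOp (e' i) ((A ^ k) g') x| := by
        refine (Finset.abs_sum_le_sum_abs _ _).trans (Finset.sum_le_sum fun i _ => ?_)
        rw [integral_mul_difOp (difOp_mem (hAk (hF i) k) _) (hAk hg'm k), abs_neg]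
        refine (abs_integral_le_integral_abs).trans (le_of_eq ?_)
        simp only [abs_mul]
      have b3 := (abs_le.1 b1).1
      have b4 := (abs_le.1 b2).1
      rw [neg_mul, ← mul_neg]
      gcongr
      linarith
    -- the main sum
    have hmain : ∑ k ∈ Finset.range N, ∑ i, ∫ x,
          |difOp (e' i) ((A ^ k) (F i)) x| * |difOp (e' i) ((A ^ k) g') x|
        ≤ 4 * m * (C * lam ^ p * Y + X / 8) := by
      have b1 : ∀ i, ∑ k ∈ Finset.range N, ∫ x,
          |difOp (e' i) ((A ^ k) (F i)) x| * |difOp (e' i) ((A ^ k) g') x| ≤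
          4 * m * (C * (lam ^ p * (∫ x, |F i x| ^ p) + (lam ^ q)⁻¹ * (2 ^ q * X))) := by
        intro i
        have c1 := HC n ι e' (lam • F i) (lam⁻¹ • g') ((ccFun _).smul_mem _ (hF i))
          ((ccFun _).smul_mem _ hg'm) N
        have c2 : ∫ x, |(lam • F i) x| ^ p = lam ^ p * ∫ x, |F i x| ^ p := by
          rw [← integral_const_mul]
          refine integral_congr_ae (Filter.Eventually.of_forall fun x => ?_)
          simp only [Pi.smul_apply, smul_eq_mul, abs_mul, abs_of_pos hlam]
          rw [Real.mul_rpow hlam.le (abs_nonneg _)]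
        have c3 : ∫ x, |(lam⁻¹ • g') x| ^ q = (lam ^ q)⁻¹ * ∫ x, |g' x| ^ q := by
          rw [← integral_const_mul]
          refine integral_congr_ae (Filter.Eventually.of_forall fun x => ?_)
          simp only [Pi.smul_apply, smul_eq_mul, abs_mul, abs_of_pos (inv_pos.2 hlam)]
          rw [Real.mul_rpow (inv_pos.2 hlam).le (abs_nonneg _), Real.inv_rpow hlam.le]
        rw [c2, c3] at c1
        refine le_trans ?_ (c1.trans ?_)
        · refine Finset.sum_le_sum fun k _ => ?_
          have c4 : ∀ i x, |difOp (e' i) ((walkOp e' ^ k) (lam • F i)) x| *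
              |difOp (e' i) ((walkOp e' ^ k) (lam⁻¹ • g')) x| =
              |difOp (e' i) ((A ^ k) (F i)) x| * |difOp (e' i) ((A ^ k) g') x| := by
            intro i x
            simp only [map_smul, Pi.smul_apply, smul_eq_mul, abs_mul, abs_inv]
            rw [mul_mul_mul_comm, mul_inv_cancel₀ (abs_pos.2 hlam.ne').ne', one_mul]
          refine le_trans (le_of_eq ?_) (Finset.single_le_sum (f := fun i' => ∫ x,
            |difOp (e' i') ((walkOp e' ^ k) (lam • F i)) x| *
              |difOp (e' i') ((walkOp e' ^ k) (lam⁻¹ • g')) x|)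
            (fun i' _ => integral_nonneg fun x => by positivity) (Finset.mem_univ i))
          simp only [c4]
        · rw [← hm]
          gcongr
      rw [Finset.sum_comm]
      refine (Finset.sum_le_sum fun i _ => b1 i).trans (le_of_eq ?_)
      simp only [mul_add, Finset.sum_add_distrib, Finset.sum_const, Finset.card_univ,
        nsmul_eq_mul, ← hm, ← mul_assoc, ← Finset.mul_sum, hlamq]
      rw [← hY]
      field_simp
    -- the remaining term
    have hrem : ∫ x, (A ^ N) f x * (A ^ N) g x ≤ K * h * G + (1 / (2 * h)) *
        ((1 / (j:ℝ) ^ 5) * (D * m * U2) + m * ((1 / (j:ℝ) ^ 5) * G2)) := by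
      set r : Euc n → ℝ := f - (1 / (2 * h)) • ∑ i, difOp (e' i) (u i) with hr
      have hrm : r ∈ ccFun (Euc n) := (ccFun _).sub_mem hf ((ccFun _).smul_mem _
        ((ccFun _).sum_mem fun i _ => difOp_mem (hu i) _))
      have hrb : ∀ x, |r x| ≤ K * h := fun x => by
        have := hK2 h hhI x
        simpa only [hr, Pi.sub_apply, Pi.smul_apply, smul_eq_mul, Finset.sum_apply] using this
      have hf' : f = r + (1 / (2 * h)) • ∑ i, difOp (e' i) (u i) := by rw [hr, sub_add_cancel]
      have e1 : ∀ x, (A ^ N) f x * (A ^ N) g x = (A ^ N) r x * (A ^ N) g x +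
          (1 / (2 * h)) * ∑ i, difOp (e' i) ((A ^ N) (u i)) x * (A ^ N) g x := by
        intro x
        conv_lhs => rw [hf']
        simp only [map_smul, map_add, map_sum, hcomm, Pi.smul_apply,
          Pi.add_apply, Finset.sum_apply, smul_eq_mul, ← Finset.sum_mul]
        ring
      have i1 := ccFun_integrable (ccFun_mul (hAk hrm N) (hAk hg N))
      have i2 : ∀ i ∈ Finset.univ, Integrable fun x =>
          difOp (e' i) ((A ^ N) (u i)) x * (A ^ N) g x := fun i _ =>
        ccFun_integrable (ccFun_mul (difOp_mem (hAk (hu i) N) _) (hAk hg N))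
      simp_rw [e1]
      rw [integral_add i1 ((integrable_finsetSum _ i2).const_mul _), integral_const_mul,
        integral_finsetSum _ i2]
      have b1 : ∫ x, (A ^ N) r x * (A ^ N) g x ≤ K * h * G := by
        rw [integral_mul_walkOp_pow hrm (hAk hg N)]
        refine (le_abs_self _).trans
          ((integral_mul_le_of_abs_le hrm (hAk (hAk hg N) N) hrb).trans ?_)
        gcongr
        exact (integral_abs_walkOp_pow_le (hAk hg N) e' N).trans
          (integral_abs_walkOp_pow_le hg e' N)
      have hGN : ∫ x, |(A ^ N) g x| ^ (2:ℝ) ≤ G2 := by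
        have : ∀ k, ∫ x, |(A ^ k) g x| ^ (2:ℝ) ≤ G2 := by
          intro k
          induction k with
          | zero => simp [hG2]
          | succ k ih =>
            rw [pow_succ', Module.End.mul_apply]
            exact (integral_abs_walkOp_rpow_le (hAk hg k) one_le_two e').trans ih
        exact this N
      have b2 : ∀ i, ∫ x, difOp (e' i) ((A ^ N) (u i)) x * (A ^ N) g x ≤
          (1 / (j:ℝ) ^ 5) * (D * m * ∫ x, |u i x| ^ (2:ℝ)) + (1 / (j:ℝ) ^ 5) * G2 := by
        intro i
        refine (le_abs_self _).trans ((abs_integral_mul_le (difOp_mem (hAk (hu i) N) _)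
          (hAk hg N) (c := (j:ℝ) ^ 5) (by positivity)).trans ?_)
        have c1 := HD n ι e' (u i) (hu i) N i
        have c2 : ((N : ℕ) : ℝ) = (j:ℝ) ^ 5 * (j:ℝ) ^ 5 := by rw [hN]; push_cast; ring
        rw [c2, mul_assoc] at c1
        refine add_le_add ?_ (mul_le_mul_of_nonneg_left hGN (by positivity))
        have c3 : ∀ J a b : ℝ, 0 < J → J * (J * a) ≤ b → J * a ≤ 1 / J * b := fun J a b hJ h => by
          rw [one_div, le_inv_mul_iff₀ hJ]; exact h
        exact c3 _ _ _ (by positivity) c1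
      have b3 : ∑ i, ∫ x, difOp (e' i) ((A ^ N) (u i)) x * (A ^ N) g x ≤
          (1 / (j:ℝ) ^ 5) * (D * m * U2) + m * ((1 / (j:ℝ) ^ 5) * G2) := by
        refine (Finset.sum_le_sum fun i _ => b2 i).trans (le_of_eq ?_)
        rw [Finset.sum_add_distrib, ← Finset.mul_sum, ← Finset.mul_sum, Finset.sum_const,
          Finset.card_univ, nsmul_eq_mul]
      gcongr
    have hall : X ≤ _ := hfg.symm.le.trans ((integral_mul_eq_walk hf hg e' N).le.trans
      (add_le_add hrem (Finset.sum_le_sum fun k _ => hterm k)))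
    rw [← Finset.mul_sum, Finset.sum_add_distrib, Finset.sum_const, Finset.card_range,
      nsmul_eq_mul] at hall
    have hX0 : 0 ≤ X := integral_nonneg fun x => by positivity
    have hY0 : 0 ≤ Y := Finset.sum_nonneg fun i _ => integral_nonneg fun x => by positivity
    have hall2 : (1 / (4 * m)) * (∑ k ∈ Finset.range N, ∑ i, ∫ x,
          |difOp (e' i) ((A ^ k) (F i)) x| * |difOp (e' i) ((A ^ k) g') x|) ≤
          4 * C * lam ^ p * Y + X / 2 := by
      calc _ ≤ (1 / (4 * m)) * (4 * m * (C * lam ^ p * Y + X / 8)) := by gcongr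
        _ = C * lam ^ p * Y + X / 8 := by field_simp
        _ ≤ _ := by
          have : 0 ≤ C * lam ^ p * Y := by positivity
          linarith
    have hNh : (N : ℝ) * (K * h ^ 3 * (2 * G)) = K * (2 * G) * (1 / (j:ℝ) ^ 2) := by
      rw [hN, hh]; push_cast; field_simp
    have hj2 : 1 / (j:ℝ) ^ 2 ≤ 1 / j := by
      rw [div_le_div_iff_of_pos_left one_pos (by positivity) hj0]
      exact le_self_pow₀ hj1 (by norm_num)
    have hj4 : h ≤ 1 / j := by
      rw [hh, div_le_div_iff_of_pos_left one_pos (by positivity) hj0]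
      exact le_self_pow₀ hj1 (by norm_num)
    have hj5 : (1 / (2 * h)) * (1 / (j:ℝ) ^ 5) ≤ 1 / j := by
      have : (1 / (2 * h)) * (1 / (j:ℝ) ^ 5) = 1 / 2 * (1 / j) := by
        rw [hh]; field_simp
      rw [this]
      have : 0 < 1 / (j:ℝ) := by positivity
      linarith
    have hU0 : 0 ≤ U2 := Finset.sum_nonneg fun i _ => integral_nonneg fun x => by positivity
    have hG20 : 0 ≤ G2 := integral_nonneg fun x => by positivity
    rw [mul_add, hNh] at hall
    have f1 : 1 / (4 * m) * (K * (2 * G) * (1 / (j:ℝ) ^ 2)) ≤ K / (2 * m) * G * (1 / j) := by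
      have : 1 / (4 * m) * (K * (2 * G) * (1 / (j:ℝ) ^ 2)) = K / (2 * m) * G * (1 / (j:ℝ) ^ 2) := by
        field_simp
        ring
      rw [this]
      gcongr
    have f2 : K * h * G ≤ K * G * (1 / j) := by
      rw [mul_right_comm]; gcongr
    have f3 : (1 / (2 * h)) * ((1 / (j:ℝ) ^ 5) * (D * m * U2) + m * ((1 / (j:ℝ) ^ 5) * G2)) ≤
        (D * m * U2 + m * G2) * (1 / j) := by
      have : (1 / (2 * h)) * ((1 / (j:ℝ) ^ 5) * (D * m * U2) + m * ((1 / (j:ℝ) ^ 5) * G2)) =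
        (D * m * U2 + m * G2) * ((1 / (2 * h)) * (1 / (j:ℝ) ^ 5)) := by ring
      rw [this]
      gcongr
    linarith
  -- let the scale go to zero
  have hlim : Filter.Tendsto (fun j : ℕ => 4 * C * lam ^ p * Y + X / 2 +
      (K / (2 * m) * G + K * G + D * m * U2 + m * G2) * (1 / (j:ℝ))) Filter.atTop
      (nhds (4 * C * lam ^ p * Y + X / 2 +
        (K / (2 * m) * G + K * G + D * m * U2 + m * G2) * 0)) :=
    tendsto_const_nhds.add (tendsto_const_nhds.mul tendsto_one_div_atTop_nhds_zero_nat)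
  have hfin := ge_of_tendsto hlim (Filter.eventually_atTop.2 ⟨1, fun j hj => main j hj⟩)
  linarith

end WalkConsistency

section SmoothCompact

variable {n : ℕ}

/-- Smooth compactly supported functions. -/
def ccSmooth (n : ℕ) : Submodule ℝ (Euc n → ℝ) where
  carrier := {f | ContDiff ℝ (⊤ : ℕ∞) f ∧ HasCompactSupport f}
  add_mem' := fun ha hb => ⟨ha.1.add hb.1, ha.2.add hb.2⟩
  zero_mem' := ⟨contDiff_const, HasCompactSupport.zero⟩
  smul_mem' := fun c _ hf => ⟨contDiff_const.smul hf.1, hf.2.smul_left (f := fun _ => c)⟩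

lemma ccSmooth_contDiff (f : ccSmooth n) : ContDiff ℝ (⊤ : ℕ∞) (f : Euc n → ℝ) := f.2.1

lemma ccSmooth_differentiable (f : ccSmooth n) : Differentiable ℝ (f : Euc n → ℝ) :=
  f.2.1.differentiable (by simp)

lemma ccSmooth_continuous (f : ccSmooth n) : Continuous (f : Euc n → ℝ) := f.2.1.continuous

lemma ccSmooth_mem_ccFun (f : ccSmooth n) : (f : Euc n → ℝ) ∈ ccFun (Euc n) :=
  ⟨f.2.1.continuous, f.2.2⟩

lemma ccSmooth_bounded (f : ccSmooth n) : ∃ K : ℝ, 0 ≤ K ∧ ∀ x, |(f : Euc n → ℝ) x| ≤ K := by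
  obtain ⟨K, hK⟩ := f.2.2.exists_bound_of_continuous f.2.1.continuous
  exact ⟨K, (norm_nonneg _).trans (hK 0), hK⟩

/-- Directional derivatives as commuting operators on smooth compactly supported functions. -/
def pd (n : ℕ) : Euc n →ₗ[ℝ] Module.End ℝ (ccSmooth n) where
  toFun e :=
    { toFun := fun f => ⟨fun x => fderiv ℝ (f : Euc n → ℝ) x e,
        (f.2.1.fderiv_right (m := (⊤ : ℕ∞)) (by simp)).clm_apply contDiff_const,
        f.2.2.fderiv_apply ℝ e⟩
      map_add' := fun f g => by
        ext x
        simp only [Submodule.coe_add, Pi.add_apply]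
        rw [fderiv_add (ccSmooth_differentiable f x) (ccSmooth_differentiable g x)]
        rfl
      map_smul' := fun c f => by
        ext x
        simp only [SetLike.val_smul, Pi.smul_apply, RingHom.id_apply]
        rw [fderiv_const_smul (ccSmooth_differentiable f x)]
        rfl }
  map_add' e e' := by
    ext f x
    exact map_add (fderiv ℝ (f : Euc n → ℝ) x) e e'
  map_smul' c e := by
    ext f x
    exact map_smul (fderiv ℝ (f : Euc n → ℝ) x) c e

lemma pd_apply (e : Euc n) (f : ccSmooth n) (x : Euc n) :
    (pd n e f : Euc n → ℝ) x = fderiv ℝ (f : Euc n → ℝ) x e := rfl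

lemma pd_comm (e d : Euc n) (f : ccSmooth n) : pd n e (pd n d f) = pd n d (pd n e f) := by
  ext x
  have hd : DifferentiableAt ℝ (fderiv ℝ (f : Euc n → ℝ)) x :=
    ((f.2.1.fderiv_right (m := (⊤ : ℕ∞)) (by simp)).differentiable (by simp)) x
  have h : ∀ a b : Euc n, (pd n a (pd n b f) : Euc n → ℝ) x =
      fderiv ℝ (fderiv ℝ (f : Euc n → ℝ)) x a b := fun a b => by
    rw [pd_apply]
    have : (pd n b f : Euc n → ℝ) = fun y => fderiv ℝ (f : Euc n → ℝ) y b := rfl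
    rw [this, fderiv_clm_apply hd (differentiableAt_const _)]
    simp
  rw [h, h]
  have := (f.2.1.contDiffAt (x := x)).isSymmSndFDerivAt
    (by simp only [minSmoothness_of_isRCLikeNormedField]; exact WithTop.coe_le_coe.2 (le_top (a := (2 : ℕ∞))))
  exact this e d

/-- The partial derivative along the `i`-th axis. -/
def pdi (i : Fin n) : Module.End ℝ (ccSmooth n) := pd n (EuclideanSpace.single i 1)

lemma pdi_comm (i j : Fin n) (f : ccSmooth n) : pdi i (pdi j f) = pdi j (pdi i f) := pd_comm _ _ f

lemma ccSmooth_hasDerivAt (f : ccSmooth n) (x e : Euc n) (t : ℝ) :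
    HasDerivAt (fun t : ℝ => (f : Euc n → ℝ) (x + t • e)) ((pd n e f : Euc n → ℝ) (x + t • e)) t := by
  have h1 : HasDerivAt (fun t : ℝ => x + t • e) e t := by
    simpa using ((hasDerivAt_id t).smul_const e).const_add x
  exact ((ccSmooth_differentiable f (x + t • e)).hasFDerivAt).comp_hasDerivAt t h1

lemma abs_le_of_hasDerivAt {g g' : ℝ → ℝ} {c T : ℝ} (hg : ∀ t, HasDerivAt g (g' t) t)
    (h0 : g 0 = 0) (hT : 0 ≤ T) (hb : ∀ t ∈ Icc 0 T, |g' t| ≤ c) : ∀ t ∈ Icc 0 T, |g t| ≤ c * T := by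
  intro t ht
  have h := (convex_Icc (0:ℝ) T).norm_image_sub_le_of_norm_hasDerivWithin_le
    (fun x _ => (hg x).hasDerivWithinAt) (fun x hx => by simpa using hb x hx)
    (⟨le_rfl, hT⟩ : (0:ℝ) ∈ Icc 0 T) ht
  rw [h0, sub_zero, sub_zero, Real.norm_eq_abs, Real.norm_eq_abs, abs_of_nonneg ht.1] at h
  have hc : 0 ≤ c := (abs_nonneg _).trans (hb t ht)
  exact h.trans (mul_le_mul_of_nonneg_left ht.2 hc)

lemma ccSmooth_taylor (f : ccSmooth n) (e : Euc n) : ∃ K : ℝ, 0 ≤ K ∧ ∀ (x : Euc n) (t : ℝ), 0 ≤ t →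
    |(f : Euc n → ℝ) (x + t • e) - (f : Euc n → ℝ) x - t * (pd n e f : Euc n → ℝ) x| ≤ K * t ^ 2 ∧
    |(f : Euc n → ℝ) (x + t • e) - (f : Euc n → ℝ) x - t * (pd n e f : Euc n → ℝ) x
      - t ^ 2 / 2 * (pd n e (pd n e f) : Euc n → ℝ) x| ≤ K * t ^ 3 := by
  obtain ⟨K2, hK2, h2⟩ := ccSmooth_bounded (pd n e (pd n e f))
  obtain ⟨K3, hK3, h3⟩ := ccSmooth_bounded (pd n e (pd n e (pd n e f)))
  refine ⟨K2 + K3, by positivity, fun x t ht => ?_⟩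
  have d0 := ccSmooth_hasDerivAt f x e
  have d1 := ccSmooth_hasDerivAt (pd n e f) x e
  have d2 := ccSmooth_hasDerivAt (pd n e (pd n e f)) x e
  set f1 := pd n e f
  set f2 := pd n e f1
  have mem : t ∈ Icc 0 t := ⟨ht, le_rfl⟩
  constructor
  · have a1 := abs_le_of_hasDerivAt (T := t) (c := K2)
      (g := fun t => (f1 : Euc n → ℝ) (x + t • e) - (f1 : Euc n → ℝ) x)
      (fun s => (d1 s).sub_const _) (by simp) ht (fun s _ => h2 _)
    have a2 := abs_le_of_hasDerivAt (T := t) (c := K2 * t)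
      (g := fun t => (f : Euc n → ℝ) (x + t • e) - (f : Euc n → ℝ) x - t * (f1 : Euc n → ℝ) x)
      (fun s => ((d0 s).sub_const _).sub ((hasDerivAt_id s).mul_const _)) (by simp) ht
      (fun s hs => by simpa using a1 s hs) t mem
    refine a2.trans ?_
    nlinarith [mul_nonneg hK3 (sq_nonneg t)]
  · have a1 := abs_le_of_hasDerivAt (T := t) (c := K3)
      (g := fun t => (f2 : Euc n → ℝ) (x + t • e) - (f2 : Euc n → ℝ) x)
      (fun s => (d2 s).sub_const _) (by simp) ht (fun s _ => h3 _)
    have a2 := abs_le_of_hasDerivAt (T := t) (c := K3 * t)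
      (g := fun t => (f1 : Euc n → ℝ) (x + t • e) - (f1 : Euc n → ℝ) x - t * (f2 : Euc n → ℝ) x)
      (fun s => ((d1 s).sub_const _).sub ((hasDerivAt_id s).mul_const _)) (by simp) ht
      (fun s hs => by simpa using a1 s hs)
    have a3 := abs_le_of_hasDerivAt (T := t) (c := K3 * t * t)
      (g := fun t => (f : Euc n → ℝ) (x + t • e) - (f : Euc n → ℝ) x - t * (f1 : Euc n → ℝ) x
        - t ^ 2 / 2 * (f2 : Euc n → ℝ) x)
      (fun s => (((d0 s).sub_const _).sub ((hasDerivAt_id s).mul_const _)).sub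
        ((((hasDerivAt_id s).pow 2).div_const 2).mul_const _)) (by simp) ht
      (fun s hs => by simpa using a2 s hs) t mem
    refine a3.trans ?_
    have : 0 ≤ K2 * t ^ 3 := by positivity
    linarith [this, show K3 * t * t * t = K3 * t ^ 3 by ring]

lemma ccSmooth_difOp_taylor (f : ccSmooth n) (e : Euc n) : ∃ K : ℝ, 0 ≤ K ∧
    ∀ (x : Euc n) (t : ℝ), 0 ≤ t →
    |difOp (t • e) f x - 2 * t * (pd n e f : Euc n → ℝ) x| ≤ K * t ^ 2 ∧
    |difOp (t • e) (difOp (t • e) f) x - 4 * t ^ 2 * (pd n e (pd n e f) : Euc n → ℝ) x|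
      ≤ K * t ^ 3 := by
  obtain ⟨K1, hK1, h1⟩ := ccSmooth_taylor f e
  obtain ⟨K2, hK2, h2⟩ := ccSmooth_taylor f (-e)
  refine ⟨8 * (K1 + K2), by positivity, fun x t ht => ?_⟩
  have e1 : (pd n (-e) f : Euc n → ℝ) x = - (pd n e f : Euc n → ℝ) x := by
    rw [map_neg]; rfl
  have e2 : (pd n (-e) (pd n (-e) f) : Euc n → ℝ) x = (pd n e (pd n e f) : Euc n → ℝ) x := by
    rw [map_neg]; simp
  have p2 := sq_nonneg t
  have p3 : 0 ≤ t ^ 3 := by positivity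
  constructor
  · have a1 := abs_le.1 (h1 x t ht).1
    have a2 := abs_le.1 (h2 x t ht).1
    rw [e1, smul_neg, ← sub_eq_add_neg] at a2
    rw [difOp_apply]
    have q1 := mul_nonneg hK1 p2
    have q2 := mul_nonneg hK2 p2
    rw [abs_le]
    constructor <;> linarith [a1.1, a1.2, a2.1, a2.2]
  · have a1 := abs_le.1 (h1 x (2 * t) (by positivity)).2
    have a2 := abs_le.1 (h2 x (2 * t) (by positivity)).2
    rw [e2, e1, smul_neg, ← sub_eq_add_neg] at a2
    have e3 : difOp (t • e) (difOp (t • e) f) x = (f : Euc n → ℝ) (x + (2 * t) • e)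
        - 2 * (f : Euc n → ℝ) x + (f : Euc n → ℝ) (x - (2 * t) • e) := by
      simp only [difOp_apply]
      rw [show x + t • e + t • e = x + (2 * t) • e by rw [mul_smul, two_smul]; abel,
        show x + t • e - t • e = x by abel, show x - t • e + t • e = x by abel,
        show x - t • e - t • e = x - (2 * t) • e by rw [mul_smul, two_smul]; abel]
      ring
    rw [e3]
    have q1 := mul_nonneg hK1 p3
    have q2 := mul_nonneg hK2 p3
    rw [mul_pow, mul_pow] at a1 a2
    rw [abs_le]
    constructor <;> linarith [a1.1, a1.2, a2.1, a2.2]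

lemma exists_lp_bound_of_laplacian {p q : ℝ} (hpq : p.HolderConjugate q) (hn : 0 < n) :
    ∃ C : ℝ, 0 < C ∧ ∀ (f : ccSmooth n) (F : Fin n → Fin n → ccSmooth n) (u : Fin n → ccSmooth n),
      ∑ i, pdi i (pdi i f) = ∑ i, ∑ j, pdi i (pdi j (F i j)) → f = ∑ i, pdi i (u i) →
      ∫ x, |(f : Euc n → ℝ) x| ^ p ≤ C * ∑ i, ∑ j, ∫ x, |(F i j : Euc n → ℝ) x| ^ p := by
  have : Nonempty (Fin n) := ⟨⟨0, hn⟩⟩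
  have hn0 : (0:ℝ) < n := by exact_mod_cast hn
  have hp0 : 0 < p := hpq.pos
  obtain ⟨C, hC, H⟩ := exists_lp_bound_of_consistency hpq (Fin n × Fin n × Bool)
  refine ⟨C * (2 * (n:ℝ) ^ p), by positivity, fun f F u hf hu => ?_⟩
  let σ : Bool → ℝ := fun b => if b then 1 else -1
  let e : Fin n × Fin n × Bool → Euc n := fun k =>
    EuclideanSpace.single k.1 1 + σ k.2.2 • EuclideanSpace.single k.2.1 1
  let F' : Fin n × Fin n × Bool → ccSmooth n := fun k => (σ k.2.2 * n) • F k.1 k.2.1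
  let u' : Fin n × Fin n × Bool → ccSmooth n := fun k => (1 / (2 * (n:ℝ))) • u k.1
  have hpd : ∀ k, pd n (e k) = pdi k.1 + σ k.2.2 • pdi k.2.1 := fun k => by
    simp only [e, map_add, map_smul]; rfl
  have hL : ∑ k, pd n (e k) (pd n (e k) (f - F' k)) = 0 := by
    have h1 : ∀ k, pd n (e k) (pd n (e k) (f - F' k)) =
        (pdi k.1 (pdi k.1 f) + pdi k.2.1 (pdi k.2.1 f)) + σ k.2.2 • (2:ℝ) • pdi k.1 (pdi k.2.1 f)
        - ((n : ℝ) * σ k.2.2) • (pdi k.1 (pdi k.1 (F k.1 k.2.1)) + pdi k.2.1 (pdi k.2.1 (F k.1 k.2.1)))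
        - (2 * (n:ℝ)) • pdi k.1 (pdi k.2.1 (F k.1 k.2.1)) := by
      rintro ⟨i, j, b⟩
      rw [hpd]
      simp only [F', LinearMap.add_apply, LinearMap.smul_apply, map_sub, map_smul, map_add]
      rw [pdi_comm j i f, pdi_comm j i (F i j)]
      have hs : σ b * σ b = 1 := by cases b <;> simp [σ]
      have hs3 : σ b * σ b * σ b = σ b := by rw [hs, one_mul]
      match_scalars <;> first | ring1 | linear_combination hs | linear_combination (n:ℝ) * hs | linear_combination (-(n:ℝ)) * hs | linear_combination (2*(n:ℝ)) * hs | linear_combination (-2*(n:ℝ)) * hs | linear_combination (-(n:ℝ)) * hs3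
    simp only [h1, Fintype.sum_prod_type, Fintype.sum_bool]
    have h2 : ∀ i j : Fin n, (pdi i (pdi i f) + pdi j (pdi j f) + σ true • (2:ℝ) • pdi i (pdi j f)
        - ((n : ℝ) * σ true) • (pdi i (pdi i (F i j)) + pdi j (pdi j (F i j)))
        - (2 * (n:ℝ)) • pdi i (pdi j (F i j))) +
        (pdi i (pdi i f) + pdi j (pdi j f) + σ false • (2:ℝ) • pdi i (pdi j f)
        - ((n : ℝ) * σ false) • (pdi i (pdi i (F i j)) + pdi j (pdi j (F i j)))
        - (2 * (n:ℝ)) • pdi i (pdi j (F i j))) =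
        (2:ℝ) • pdi i (pdi i f) + (2:ℝ) • pdi j (pdi j f)
          - (4 * (n:ℝ)) • pdi i (pdi j (F i j)) := by
      intro i j
      simp only [σ, if_true, Bool.false_eq_true, if_false]
      module
    simp only [h2, Finset.sum_sub_distrib, Finset.sum_add_distrib, Finset.sum_const,
      Finset.card_univ, Fintype.card_fin, ← Finset.smul_sum]
    rw [← hf]
    module
  have hU : ∑ k, pd n (e k) (u' k) = f := by
    have h1 : ∀ k, pd n (e k) (u' k) = (1 / (2 * (n:ℝ))) • pdi k.1 (u k.1) +
        (σ k.2.2 * (1 / (2 * (n:ℝ)))) • pdi k.2.1 (u k.1) := by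
      intro k
      rw [hpd]
      simp only [u', LinearMap.add_apply, LinearMap.smul_apply, map_smul]
      module
    simp only [h1, Fintype.sum_prod_type, Fintype.sum_bool]
    have h2 : ∀ i j : Fin n, ((1 / (2 * (n:ℝ))) • pdi i (u i) +
        (σ true * (1 / (2 * (n:ℝ)))) • pdi j (u i)) + ((1 / (2 * (n:ℝ))) • pdi i (u i) +
        (σ false * (1 / (2 * (n:ℝ)))) • pdi j (u i)) = (1 / (n:ℝ)) • pdi i (u i) := by
      intro i j
      simp only [σ, if_true, Bool.false_eq_true, if_false]
      match_scalars <;> field_simp <;> norm_num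
    simp only [h2, Finset.sum_const, Finset.card_univ, Fintype.card_fin]
    rw [hu]
    refine Finset.sum_congr rfl fun i _ => ?_
    rw [← Nat.cast_smul_eq_nsmul ℝ, smul_smul, mul_one_div_cancel hn0.ne', one_smul]
  choose K hK0 hK using fun k => ccSmooth_difOp_taylor (f - F' k) (e k)
  choose K' hK0' hK' using fun k => ccSmooth_difOp_taylor (u' k) (e k)
  have hS0 : 0 ≤ ∑ k, K k := Finset.sum_nonneg fun k _ => hK0 k
  have hS0' : 0 ≤ ∑ k, K' k := Finset.sum_nonneg fun k _ => hK0' k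
  have key := H n e f (fun k => F' k) (fun k => u' k) (ccSmooth_mem_ccFun f)
    (fun k => ccSmooth_mem_ccFun _) (fun k => ccSmooth_mem_ccFun _) (∑ k, K k + ∑ k, K' k) ?_ ?_
  · refine key.trans (le_of_eq ?_)
    have h1 : ∀ k, ∫ x, |(F' k : Euc n → ℝ) x| ^ p =
        (n:ℝ) ^ p * ∫ x, |(F k.1 k.2.1 : Euc n → ℝ) x| ^ p := fun k => by
      rw [← integral_const_mul]
      refine integral_congr_ae (Filter.Eventually.of_forall fun x => ?_)
      simp only [F', SetLike.val_smul, Pi.smul_apply, smul_eq_mul, abs_mul]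
      have : |σ k.2.2| = 1 := by
        simp only [σ]; split_ifs <;> simp
      rw [this, one_mul, abs_of_pos hn0, Real.mul_rpow hn0.le (abs_nonneg _)]
    simp only [h1, Fintype.sum_prod_type, Fintype.sum_bool, ← two_mul, ← Finset.mul_sum]
    ring
  · intro h hh x
    have h1 : ∑ k, difOp (h • e k) (difOp (h • e k) ((f : Euc n → ℝ) - (F' k : Euc n → ℝ))) x =
        ∑ k, (difOp (h • e k) (difOp (h • e k) ((f - F' k : ccSmooth n) : Euc n → ℝ)) x
          - 4 * h ^ 2 * (pd n (e k) (pd n (e k) (f - F' k)) : Euc n → ℝ) x) := by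
      rw [Finset.sum_sub_distrib, ← Finset.mul_sum]
      have : ∑ k, (pd n (e k) (pd n (e k) (f - F' k)) : Euc n → ℝ) x = 0 := by
        have := congrArg (fun g : ccSmooth n => (g : Euc n → ℝ) x) hL
        simpa using this
      rw [this, mul_zero, sub_zero]
      rfl
    rw [h1]
    refine (Finset.abs_sum_le_sum_abs _ _).trans ((Finset.sum_le_sum fun k _ =>
      (hK k x h hh.1.le).2).trans ?_)
    rw [← Finset.sum_mul]
    have := hh.1.le
    gcongr
    linarith
  · intro h hh x
    have hpos := hh.1
    have h1 : (f : Euc n → ℝ) x - (1 / (2 * h)) * ∑ k, difOp (h • e k) (u' k) x =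
        - ((1 / (2 * h)) * ∑ k, (difOp (h • e k) (u' k) x - 2 * h * (pd n (e k) (u' k) : Euc n → ℝ) x))
        := by
      rw [Finset.sum_sub_distrib, ← Finset.mul_sum]
      have : ∑ k, (pd n (e k) (u' k) : Euc n → ℝ) x = (f : Euc n → ℝ) x := by
        have := congrArg (fun g : ccSmooth n => (g : Euc n → ℝ) x) hU
        simpa using this
      rw [this]
      field_simp
      ring
    rw [h1, abs_neg, abs_mul, abs_of_pos (by positivity)]
    have h2 : |∑ k, (difOp (h • e k) (u' k) x - 2 * h * (pd n (e k) (u' k) : Euc n → ℝ) x)| ≤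
        (∑ k, K' k) * h ^ 2 := by
      refine (Finset.abs_sum_le_sum_abs _ _).trans ((Finset.sum_le_sum fun k _ =>
        (hK' k x h hpos.le).1).trans ?_)
      rw [← Finset.sum_mul]
    calc _ ≤ 1 / (2 * h) * ((∑ k, K' k) * h ^ 2) := by gcongr
      _ = (∑ k, K' k) * h / 2 := by field_simp
      _ ≤ _ := by
        have := mul_nonneg hS0' hpos.le
        have := mul_nonneg hS0 hpos.le
        rw [add_mul]
        linarith

end SmoothCompact

section SmoothKorn

variable {n : ℕ}

/-- The divergence of a smooth compactly supported vector field. -/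
def divc (z : Fin n → ccSmooth n) : ccSmooth n := ∑ i, pdi i (z i)

/-- The trace-free symmetric gradient of a smooth compactly supported vector field. -/
def lc (z : Fin n → ccSmooth n) (i j : Fin n) : ccSmooth n :=
  (1 / 2 : ℝ) • (pdi j (z i) + pdi i (z j)) - (if i = j then (1 / (n:ℝ)) else 0) • divc z

lemma sum_pdi_lc (z : Fin n → ccSmooth n) (i : Fin n) :
    ∑ j, pdi j (lc z i j) =
      (1 / 2 : ℝ) • ∑ j, pdi j (pdi j (z i)) + (1 / 2 - 1 / (n:ℝ)) • pdi i (divc z) := by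
  have h : ∀ j, pdi j (lc z i j) = (1 / 2 : ℝ) • pdi j (pdi j (z i)) +
      (1 / 2 : ℝ) • pdi i (pdi j (z j)) - if i = j then (1 / (n:ℝ)) • pdi j (divc z) else 0 := by
    intro j
    rw [lc, pdi_comm i j]
    simp only [map_sub, map_smul, map_add, smul_add]
    split_ifs <;> simp
  simp only [h, Finset.sum_sub_distrib, Finset.sum_add_distrib, ← Finset.smul_sum,
    Finset.sum_ite_eq, Finset.mem_univ, if_true, ← map_sum]
  rw [show ∑ j, pdi j (z j) = divc z from rfl]
  module

lemma sum_sum_pdi_lc (z : Fin n → ccSmooth n) :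
    ∑ i, ∑ j, pdi i (pdi j (lc z i j)) = (1 - 1 / (n:ℝ)) • ∑ i, pdi i (pdi i (divc z)) := by
  have h : ∀ i, ∑ j, pdi i (pdi j (lc z i j)) = (1 / 2 : ℝ) • ∑ j, pdi j (pdi j (pdi i (z i)))
      + (1 / 2 - 1 / (n:ℝ)) • pdi i (pdi i (divc z)) := by
    intro i
    rw [← map_sum, sum_pdi_lc, map_add, map_smul, map_smul, map_sum]
    simp only [pdi_comm i]
  simp only [h, Finset.sum_add_distrib, ← Finset.smul_sum]
  rw [Finset.sum_comm]
  simp only [← map_sum]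
  rw [show ∑ j, pdi j (z j) = divc z from rfl]
  module

lemma laplacian_pdi (z : Fin n → ccSmooth n) (i k : Fin n) :
    ∑ j, pdi j (pdi j (pdi k (z i))) =
      (2:ℝ) • ∑ j, pdi k (pdi j (lc z i j)) + (2 / (n:ℝ) - 1) • pdi k (pdi i (divc z)) := by
  have h := congrArg (pdi k) (sum_pdi_lc z i)
  rw [map_add, map_smul, map_smul, map_sum, map_sum] at h
  rw [h]
  simp only [pdi_comm k]
  match_scalars <;> ring

lemma add_rpow_le_two_rpow {a b p : ℝ} (ha : 0 ≤ a) (hb : 0 ≤ b) (hp : 0 < p) :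
    (a + b) ^ p ≤ 2 ^ p * (a ^ p + b ^ p) := by
  have ha' := Real.rpow_nonneg ha p
  have hb' := Real.rpow_nonneg hb p
  rcases le_total a b with h | h
  · calc (a + b) ^ p ≤ (2 * b) ^ p := by gcongr; linarith
      _ = 2 ^ p * b ^ p := Real.mul_rpow zero_le_two hb
      _ ≤ _ := by gcongr; linarith
  · calc (a + b) ^ p ≤ (2 * a) ^ p := by gcongr; linarith
      _ = 2 ^ p * a ^ p := Real.mul_rpow zero_le_two ha
      _ ≤ _ := by gcongr; linarith

lemma ccSmooth_rpow_integrable (f : ccSmooth n) {p : ℝ} (hp : 0 < p) :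
    Integrable fun x => |(f : Euc n → ℝ) x| ^ p :=
  ccFun_integrable (abs_rpow_mem (ccSmooth_mem_ccFun f) hp)

lemma integral_smul_rpow (c : ℝ) (f : ccSmooth n) {p : ℝ} :
    ∫ x, |((c • f : ccSmooth n) : Euc n → ℝ) x| ^ p =
      |c| ^ p * ∫ x, |(f : Euc n → ℝ) x| ^ p := by
  rw [← integral_const_mul]
  refine integral_congr_ae (Filter.Eventually.of_forall fun x => ?_)
  simp only [SetLike.val_smul, Pi.smul_apply, smul_eq_mul, abs_mul]
  rw [Real.mul_rpow (abs_nonneg _) (abs_nonneg _)]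

lemma integral_add_rpow_le (f g : ccSmooth n) {p : ℝ} (hp : 0 < p) :
    ∫ x, |((f + g : ccSmooth n) : Euc n → ℝ) x| ^ p ≤
      2 ^ p * ((∫ x, |(f : Euc n → ℝ) x| ^ p) + ∫ x, |(g : Euc n → ℝ) x| ^ p) := by
  rw [← integral_add (ccSmooth_rpow_integrable f hp) (ccSmooth_rpow_integrable g hp),
    ← integral_const_mul]
  refine integral_mono (ccSmooth_rpow_integrable _ hp) (((ccSmooth_rpow_integrable f hp).add
    (ccSmooth_rpow_integrable g hp)).const_mul _) fun x => ?_
  refine le_trans ?_ (add_rpow_le_two_rpow (abs_nonneg _) (abs_nonneg _) hp)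
  exact Real.rpow_le_rpow (abs_nonneg _) (abs_add_le _ _) hp.le

/-- The conformal Korn inequality for smooth compactly supported fields. -/
lemma exists_smooth_korn {p q : ℝ} (hpq : p.HolderConjugate q) (hn : 2 ≤ n) :
    ∃ C : ℝ, 0 < C ∧ ∀ (z : Fin n → ccSmooth n) (i k : Fin n),
      ∫ x, |(pdi k (z i) : Euc n → ℝ) x| ^ p ≤
        C * ∑ a, ∑ b, ∫ x, |(lc z a b : Euc n → ℝ) x| ^ p := by
  have hp0 : 0 < p := hpq.pos
  obtain ⟨C, hC, H⟩ := exists_lp_bound_of_laplacian hpq (n := n) (by lia)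
  have hn0 : (2:ℝ) ≤ n := by exact_mod_cast hn
  have hn1 : (1 - 1 / (n:ℝ)) ≠ 0 := by
    have : 1 / (n:ℝ) ≤ 1 / 2 := by gcongr
    linarith
  set κ : ℝ := |(1 - 1 / (n:ℝ))⁻¹| ^ p with hκ
  set μ : ℝ := |2 / (n:ℝ) - 1| ^ p with hμ
  have hκ0 : 0 ≤ κ := by positivity
  have hμ0 : 0 ≤ μ := by positivity
  refine ⟨C * 2 ^ p * (2 ^ p * 1 + μ * (C * κ) + 1), by positivity, fun z i k => ?_⟩
  set S := ∑ a, ∑ b, ∫ x, |(lc z a b : Euc n → ℝ) x| ^ p with hS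
  have hI0 : ∀ f : ccSmooth n, 0 ≤ ∫ x, |(f : Euc n → ℝ) x| ^ p := fun f =>
    integral_nonneg fun x => by positivity
  have hS0 : 0 ≤ S := Finset.sum_nonneg fun a _ => Finset.sum_nonneg fun b _ => hI0 _
  have hdiv : ∫ x, |(divc z : Euc n → ℝ) x| ^ p ≤ C * κ * S := by
    have := H (divc z) (fun i j => (1 - 1 / (n:ℝ))⁻¹ • lc z i j) z ?_ rfl
    · refine this.trans (le_of_eq ?_)
      simp only [integral_smul_rpow, ← Finset.mul_sum]
      ring
    · simp only [map_smul, ← Finset.smul_sum]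
      rw [sum_sum_pdi_lc, smul_smul, inv_mul_cancel₀ hn1, one_smul]
  have key := H (pdi k (z i))
    (fun a b => if a = k then (2:ℝ) • lc z i b + (if b = i then (2 / (n:ℝ) - 1) • divc z else 0)
      else 0) (fun a => if a = k then z i else 0) ?_ ?_
  · refine key.trans ?_
    rw [mul_assoc C, mul_assoc C]
    gcongr
    have h0 : ∫ x, |((0 : ccSmooth n) : Euc n → ℝ) x| ^ p = 0 := by
      simp [Real.zero_rpow hp0.ne']
    have h1 : ∀ a, ∑ b, ∫ x, |((if a = k then (2:ℝ) • lc z i b +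
        (if b = i then (2 / (n:ℝ) - 1) • divc z else 0) else 0 : ccSmooth n) : Euc n → ℝ) x| ^ p =
        if a = k then ∑ b, ∫ x, |(((2:ℝ) • lc z i b +
        (if b = i then (2 / (n:ℝ) - 1) • divc z else 0) : ccSmooth n) : Euc n → ℝ) x| ^ p else 0 := by
      intro a
      split_ifs
      · rfl
      · simp only [h0, Finset.sum_const_zero]
    simp only [h1, Finset.sum_ite_eq', Finset.mem_univ, if_true]
    have h2 : ∀ b, ∫ x, |(((2:ℝ) • lc z i b +
        (if b = i then (2 / (n:ℝ) - 1) • divc z else 0) : ccSmooth n) : Euc n → ℝ) x| ^ p ≤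
        2 ^ p * (2 ^ p * (∫ x, |(lc z i b : Euc n → ℝ) x| ^ p) +
          if b = i then μ * ∫ x, |(divc z : Euc n → ℝ) x| ^ p else 0) := by
      intro b
      refine (integral_add_rpow_le _ _ hp0).trans (le_of_eq ?_)
      rw [integral_smul_rpow, abs_two]
      split_ifs
      · rw [integral_smul_rpow]
      · rw [h0]
    refine (Finset.sum_le_sum fun b _ => h2 b).trans ?_
    rw [← Finset.mul_sum, Finset.sum_add_distrib, Finset.sum_ite_eq', if_pos (Finset.mem_univ _),
      ← Finset.mul_sum, mul_assoc]
    gcongr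
    have h3 : ∑ b, ∫ x, |(lc z i b : Euc n → ℝ) x| ^ p ≤ S :=
      Finset.single_le_sum (f := fun a => ∑ b, ∫ x, |(lc z a b : Euc n → ℝ) x| ^ p)
        (fun a _ => Finset.sum_nonneg fun b _ => hI0 _) (Finset.mem_univ i)
    calc _ ≤ 2 ^ p * S + μ * (C * κ * S) := by gcongr
      _ ≤ _ := by linarith
  · rw [laplacian_pdi]
    have h1 : ∀ a, ∑ b, pdi a (pdi b (if a = k then (2:ℝ) • lc z i b +
        (if b = i then (2 / (n:ℝ) - 1) • divc z else 0) else 0)) =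
        if a = k then ∑ b, pdi a (pdi b ((2:ℝ) • lc z i b +
        (if b = i then (2 / (n:ℝ) - 1) • divc z else 0))) else 0 := by
      intro a
      split_ifs
      · rfl
      · simp
    simp only [h1, Finset.sum_ite_eq', Finset.mem_univ, if_true]
    have h2 : ∀ b, pdi k (pdi b ((2:ℝ) • lc z i b +
        (if b = i then (2 / (n:ℝ) - 1) • divc z else 0))) = (2:ℝ) • pdi k (pdi b (lc z i b)) +
        if b = i then (2 / (n:ℝ) - 1) • pdi k (pdi b (divc z)) else 0 := by
      intro b
      rw [map_add, map_add, map_smul, map_smul]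
      split_ifs <;> simp
    simp only [h2, Finset.sum_add_distrib, Finset.sum_ite_eq', Finset.mem_univ, if_true,
      Finset.smul_sum]
  · have h1 : ∀ a, pdi a (if a = k then z i else 0) = if a = k then pdi a (z i) else 0 := by
      intro a
      split_ifs <;> simp
    simp only [h1, Finset.sum_ite_eq', Finset.mem_univ, if_true]

end SmoothKorn

section ThirdDerivatives

variable {n : ℕ}

lemma pdi_add_pdi (v : Fin n → ccSmooth n) (i j : Fin n) :
    pdi j (v i) + pdi i (v j) =
      (2:ℝ) • lc v i j + if i = j then (2 / (n:ℝ)) • divc v else 0 := by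
  rw [lc]
  split_ifs <;> match_scalars <;> ring

lemma pdi_pdi_eq (v : Fin n → ccSmooth n) (i j k : Fin n) :
    pdi k (pdi j (v i)) = pdi k (lc v i j) + pdi j (lc v i k) - pdi i (lc v j k)
      + ((if i = j then (1 / (n:ℝ)) • pdi k (divc v) else 0)
      + (if i = k then (1 / (n:ℝ)) • pdi j (divc v) else 0)
      - (if j = k then (1 / (n:ℝ)) • pdi i (divc v) else 0)) := by
  have h1 := congrArg (pdi k) (pdi_add_pdi v i j)
  have h2 := congrArg (pdi j) (pdi_add_pdi v i k)
  have h3 := congrArg (pdi i) (pdi_add_pdi v j k)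
  simp only [map_add, map_smul, apply_ite (pdi _), map_zero] at h1 h2 h3
  rw [pdi_comm j k, pdi_comm j i] at h2
  rw [pdi_comm i k (v j)] at h3
  have e : (2:ℝ) • pdi k (pdi j (v i)) = (pdi k (pdi j (v i)) + pdi k (pdi i (v j))) +
    (pdi k (pdi j (v i)) + pdi i (pdi j (v k))) - (pdi k (pdi i (v j)) + pdi i (pdi j (v k))) := by
    module
  rw [h1, h2, h3] at e
  have e2 := congrArg (fun z => (1 / 2 : ℝ) • z) e
  simp only [smul_smul] at e2
  rw [show (1 / 2 : ℝ) * 2 = 1 by norm_num, one_smul] at e2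
  rw [e2]
  split_ifs <;> match_scalars <;> ring

lemma pdi_pdi_divc (hn : 3 ≤ n) (v : Fin n → ccSmooth n) (a b : Fin n) :
    pdi a (pdi b (divc v)) = ((n:ℝ) / (n - 2)) • (∑ c, pdi b (pdi c (lc v a c))
      + ∑ c, pdi a (pdi c (lc v b c)) - ∑ c, pdi c (pdi c (lc v a b))
      - if a = b then (1 / ((n:ℝ) - 1)) • ∑ c, ∑ d, pdi c (pdi d (lc v c d)) else 0) := by
  have hn0 : (3:ℝ) ≤ n := by exact_mod_cast hn
  have h2 : (n:ℝ) - 2 ≠ 0 := by linarith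
  have h1 : (n:ℝ) - 1 ≠ 0 := by linarith
  have h0 : (n:ℝ) ≠ 0 := by linarith
  rw [sum_sum_pdi_lc]
  simp only [← map_sum, sum_pdi_lc, map_add, map_smul]
  have e : ∑ c, pdi c (pdi c (lc v a b)) = (1 / 2 : ℝ) • (pdi b (∑ c, pdi c (pdi c (v a))) +
      pdi a (∑ c, pdi c (pdi c (v b)))) - (if a = b then (1 / (n:ℝ)) else 0) •
        ∑ c, pdi c (pdi c (divc v)) := by
    simp only [lc, map_sub, map_smul, map_add, Finset.sum_sub_distrib, Finset.sum_add_distrib,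
      ← Finset.smul_sum, map_sum, pdi_comm a, pdi_comm b]
  rw [e, pdi_comm b a]
  have h3 : -1 + (n:ℝ) ≠ 0 := by linarith
  have h4 : -2 + (n:ℝ) ≠ 0 := by linarith
  split_ifs <;> match_scalars <;> field_simp <;> ring

/-- Third derivatives of a field are combinations of second derivatives of its trace-free
symmetric gradient. -/
lemma third_mem (hn : 3 ≤ n) (𝒢 : Submodule ℝ ((Fin n → ccSmooth n) → ccSmooth n))
    (h : ∀ a b c d, (fun v => pdi a (pdi b (lc v c d))) ∈ 𝒢) (m k j i : Fin n) :
    (fun v => pdi m (pdi k (pdi j (v i)))) ∈ 𝒢 := by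
  have hs : ∀ a b, (fun v => pdi a (pdi b (divc v))) ∈ 𝒢 := by
    intro a b
    have e : (fun v => pdi a (pdi b (divc v))) = ((n:ℝ) / (n - 2)) •
        (∑ c, (fun v => pdi b (pdi c (lc v a c))) + ∑ c, (fun v => pdi a (pdi c (lc v b c)))
        - ∑ c, (fun v => pdi c (pdi c (lc v a b))) - (if a = b then (1 / ((n:ℝ) - 1)) else 0) •
          ∑ c, ∑ d, (fun v => pdi c (pdi d (lc v c d)))) := by
      funext v
      rw [pdi_pdi_divc hn]
      simp only [Pi.smul_apply, Pi.sub_apply, Pi.add_apply, Finset.sum_apply]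
      simp only [ite_smul, zero_smul]
    rw [e]
    exact 𝒢.smul_mem _ (𝒢.sub_mem (𝒢.sub_mem (𝒢.add_mem (𝒢.sum_mem fun c _ => h _ _ _ _)
      (𝒢.sum_mem fun c _ => h _ _ _ _)) (𝒢.sum_mem fun c _ => h _ _ _ _))
      (𝒢.smul_mem _ (𝒢.sum_mem fun c _ => 𝒢.sum_mem fun d _ => h _ _ _ _)))
  have e : (fun v => pdi m (pdi k (pdi j (v i)))) = (fun v => pdi m (pdi k (lc v i j)))
      + (fun v => pdi m (pdi j (lc v i k))) - (fun v => pdi m (pdi i (lc v j k)))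
      + ((if i = j then (1 / (n:ℝ)) else 0) • (fun v => pdi m (pdi k (divc v)))
      + (if i = k then (1 / (n:ℝ)) else 0) • (fun v => pdi m (pdi j (divc v)))
      - (if j = k then (1 / (n:ℝ)) else 0) • (fun v => pdi m (pdi i (divc v)))) := by
    funext v
    rw [pdi_pdi_eq]
    simp only [map_sub, map_add, apply_ite (pdi _), map_zero, map_smul]
    simp only [Pi.smul_apply, Pi.sub_apply, Pi.add_apply]
    simp only [ite_smul, zero_smul]
  rw [e]
  exact 𝒢.add_mem (𝒢.sub_mem (𝒢.add_mem (h _ _ _ _) (h _ _ _ _)) (h _ _ _ _))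
    (𝒢.sub_mem (𝒢.add_mem (𝒢.smul_mem _ (hs _ _)) (𝒢.smul_mem _ (hs _ _)))
      (𝒢.smul_mem _ (hs _ _)))

/-- Integration by parts along segments. -/
lemma integral_mul_pd_segment (ψ g : ccSmooth n) (e x : Euc n) (t : ℝ) :
    ∫ y, (ψ : Euc n → ℝ) y * ((1 - t) * (pd n e g : Euc n → ℝ) (y + t • (x - y))) =
      - ∫ y, (pd n e ψ : Euc n → ℝ) y * (g : Euc n → ℝ) (y + t • (x - y)) := by
  have hc : Continuous fun y : Euc n => y + t • (x - y) := by fun_prop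
  have hd : ∀ y, HasFDerivAt (fun y : Euc n => (g : Euc n → ℝ) (y + t • (x - y)))
      ((fderiv ℝ (g : Euc n → ℝ) (y + t • (x - y))).comp
        (ContinuousLinearMap.id ℝ (Euc n) + t • (-ContinuousLinearMap.id ℝ (Euc n)))) y := fun y =>
    (ccSmooth_differentiable g _).hasFDerivAt.comp y ((hasFDerivAt_id y).add
      (((hasFDerivAt_id y).const_sub x).const_smul t))
  have e1 : ∀ y, fderiv ℝ (fun y : Euc n => (g : Euc n → ℝ) (y + t • (x - y))) y e =
      (1 - t) * (pd n e g : Euc n → ℝ) (y + t • (x - y)) := fun y => by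
    rw [(hd y).fderiv, pd_apply]
    simp only [ContinuousLinearMap.comp_apply, _root_.add_apply,
      _root_.smul_apply, _root_.neg_apply,
      ContinuousLinearMap.id_apply, map_add, map_smul, map_neg, smul_eq_mul]
    ring
  have hInt : ∀ (a : ccSmooth n) (b : Euc n → ℝ), Continuous b →
      Integrable fun y => (a : Euc n → ℝ) y * b y := fun a b hb =>
    ((ccSmooth_continuous a).mul hb).integrable_of_hasCompactSupport a.2.2.mul_right
  have h := integral_mul_fderiv_eq_neg_fderiv_mul_of_integrable (μ := volume)
    (f := (ψ : Euc n → ℝ)) (g := fun y => (g : Euc n → ℝ) (y + t • (x - y))) (v := e)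
    (hInt (pd n e ψ) _ ((ccSmooth_continuous g).comp hc)) ?_
    (hInt ψ _ ((ccSmooth_continuous g).comp hc)) (fun y _ => ccSmooth_differentiable ψ y)
    (fun y _ => (hd y).differentiableAt)
  · simp_rw [e1] at h
    exact h
  · simp_rw [e1]
    exact hInt ψ _ (continuous_const.mul ((ccSmooth_continuous _).comp hc))

/-- Operators on fields which, tested along segments against a bump, are controlled by the
trace-free symmetric gradient. -/
def segmentControlled (n : ℕ) : Submodule ℝ ((Fin n → ccSmooth n) → ccSmooth n) where
  carrier := {F | ∃ C : ℝ, 0 ≤ C ∧ ∀ (v : Fin n → ccSmooth n) (ψ : ccSmooth n) (x : Euc n) (t K : ℝ),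
    (∀ a b y, |(pdi a (pdi b ψ) : Euc n → ℝ) y| ≤ (closedBall 0 1).indicator (fun _ => K) y) →
    |∫ y, (ψ : Euc n → ℝ) y * ((1 - t) ^ 2 * (F v : Euc n → ℝ) (y + t • (x - y)))| ≤
      C * (K * ∫ y in closedBall 0 1, ∑ c, ∑ d, |(lc v c d : Euc n → ℝ) (y + t • (x - y))|)}
  add_mem' := by
    rintro F G ⟨C, hC, h⟩ ⟨D, hD, h'⟩
    refine ⟨C + D, by positivity, fun v ψ x t K hK => ?_⟩
    have hc : Continuous fun y : Euc n => y + t • (x - y) := by fun_prop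
    have hInt : ∀ g : ccSmooth n, Integrable fun y =>
        (ψ : Euc n → ℝ) y * ((1 - t) ^ 2 * (g : Euc n → ℝ) (y + t • (x - y))) := fun g =>
      ((ccSmooth_continuous ψ).mul (continuous_const.mul
        ((ccSmooth_continuous g).comp hc))).integrable_of_hasCompactSupport ψ.2.2.mul_right
    have e : ∫ y, (ψ : Euc n → ℝ) y * ((1 - t) ^ 2 * ((F + G) v : Euc n → ℝ) (y + t • (x - y))) =
        (∫ y, (ψ : Euc n → ℝ) y * ((1 - t) ^ 2 * (F v : Euc n → ℝ) (y + t • (x - y)))) +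
        ∫ y, (ψ : Euc n → ℝ) y * ((1 - t) ^ 2 * (G v : Euc n → ℝ) (y + t • (x - y))) := by
      rw [← integral_add (hInt _) (hInt _)]
      refine integral_congr_ae (Filter.Eventually.of_forall fun y => ?_)
      simp only [Pi.add_apply, Submodule.coe_add]
      ring
    rw [e, add_mul]
    exact (abs_add_le _ _).trans (add_le_add (h v ψ x t K hK) (h' v ψ x t K hK))
  zero_mem' := ⟨0, le_rfl, fun v ψ x t K hK => by simp⟩
  smul_mem' := by
    rintro c F ⟨C, hC, h⟩
    refine ⟨|c| * C, by positivity, fun v ψ x t K hK => ?_⟩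
    have e : ∫ y, (ψ : Euc n → ℝ) y * ((1 - t) ^ 2 * ((c • F) v : Euc n → ℝ) (y + t • (x - y))) =
        c * (∫ y, (ψ : Euc n → ℝ) y * ((1 - t) ^ 2 * (F v : Euc n → ℝ) (y + t • (x - y)))) := by
      rw [← integral_const_mul]
      refine integral_congr_ae (Filter.Eventually.of_forall fun y => ?_)
      simp only [Pi.smul_apply, SetLike.val_smul, smul_eq_mul]
      ring
    rw [e, abs_mul, mul_assoc]
    exact mul_le_mul_of_nonneg_left (h v ψ x t K hK) (abs_nonneg _)

lemma pdi_pdi_lc_mem_segmentControlled (a b c d : Fin n) :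
    (fun v => pdi a (pdi b (lc v c d))) ∈ segmentControlled n := by
  refine ⟨1, zero_le_one, fun v ψ x t K hK => ?_⟩
  have hc : Continuous fun y : Euc n => y + t • (x - y) := by fun_prop
  have e1 := integral_mul_pd_segment ((1 - t) • ψ) (pdi b (lc v c d)) (EuclideanSpace.single a 1) x t
  have e2 := integral_mul_pd_segment (pdi a ψ) (lc v c d) (EuclideanSpace.single b 1) x t
  have e3 : ∫ y, (ψ : Euc n → ℝ) y *
      ((1 - t) ^ 2 * (pdi a (pdi b (lc v c d)) : Euc n → ℝ) (y + t • (x - y))) =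
      ∫ y, (pdi b (pdi a ψ) : Euc n → ℝ) y * (lc v c d : Euc n → ℝ) (y + t • (x - y)) := by
    rw [← neg_neg (∫ y, (pdi b (pdi a ψ) : Euc n → ℝ) y * _)]
    refine Eq.trans ?_ (e1.trans (congrArg Neg.neg (Eq.trans ?_ e2)))
    · refine integral_congr_ae (Filter.Eventually.of_forall fun y => ?_)
      simp only [SetLike.val_smul, Pi.smul_apply, smul_eq_mul, pdi]
      ring
    · refine integral_congr_ae (Filter.Eventually.of_forall fun y => ?_)
      simp only [map_smul, SetLike.val_smul, Pi.smul_apply, smul_eq_mul, pdi]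
      ring
  have hSc : Continuous fun y : Euc n => ∑ c, ∑ d, |(lc v c d : Euc n → ℝ) (y + t • (x - y))| :=
    continuous_finsetSum _ fun c _ => continuous_finsetSum _ fun d _ =>
      ((ccSmooth_continuous (lc v c d)).comp hc).abs
  have hSi : IntegrableOn (fun y : Euc n => ∑ c, ∑ d, |(lc v c d : Euc n → ℝ) (y + t • (x - y))|)
      (closedBall 0 1) := hSc.continuousOn.integrableOn_compact (isCompact_closedBall _ _)
  rw [one_mul, e3, ← integral_const_mul, ← integral_indicator measurableSet_closedBall]
  refine (abs_integral_le_integral_abs).trans (integral_mono ?_ ?_ fun y => ?_)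
  · exact (((ccSmooth_continuous _).mul ((ccSmooth_continuous (lc v c d)).comp
      hc)).integrable_of_hasCompactSupport (pdi b (pdi a ψ)).2.2.mul_right).abs
  · exact (integrable_indicator_iff measurableSet_closedBall).2 (hSi.const_mul K)
  · have h1 := hK b a y
    have h2 : |(lc v c d : Euc n → ℝ) (y + t • (x - y))| ≤
        ∑ c, ∑ d, |(lc v c d : Euc n → ℝ) (y + t • (x - y))| :=
      (Finset.single_le_sum (f := fun d => |(lc v c d : Euc n → ℝ) (y + t • (x - y))|)
        (fun _ _ => abs_nonneg _) (Finset.mem_univ d)).trans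
      (Finset.single_le_sum (f := fun c => ∑ d, |(lc v c d : Euc n → ℝ) (y + t • (x - y))|)
        (fun _ _ => Finset.sum_nonneg fun _ _ => abs_nonneg _) (Finset.mem_univ c))
    simp only [abs_mul]
    by_cases hy : y ∈ closedBall (0 : Euc n) 1
    · rw [indicator_of_mem hy] at h1 ⊢
      exact mul_le_mul h1 h2 (abs_nonneg _) ((abs_nonneg _).trans h1)
    · rw [indicator_of_notMem hy] at h1 ⊢
      rw [le_antisymm h1 (abs_nonneg _), zero_mul]

end ThirdDerivatives

section AveragedTaylor

variable {n : ℕ}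

lemma pd_eq_sum (e : Euc n) (f : ccSmooth n) : pd n e f = ∑ j, e j • pdi j f := by
  have h : e = ∑ j, e j • (EuclideanSpace.single j (1:ℝ) : Euc n) := by
    ext i
    simp [Finset.sum_apply, Pi.single_apply]
  conv_lhs => rw [h]
  rw [map_sum, LinearMap.sum_apply]
  simp only [map_smul, LinearMap.smul_apply, pdi]

/-- Product of a compactly supported smooth function with a smooth function. -/
def ccMul (f : Euc n → ℝ) (hf : ContDiff ℝ (⊤ : ℕ∞) f) (g : ccSmooth n) : ccSmooth n :=
  ⟨fun y => f y * (g : Euc n → ℝ) y, hf.mul g.2.1, g.2.2.mul_left⟩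

lemma contDiff_coord (j : Fin n) : ContDiff ℝ (⊤ : ℕ∞) (fun y : Euc n => y j) :=
  (EuclideanSpace.proj (𝕜 := ℝ) j : Euc n →L[ℝ] ℝ).contDiff

/-- Multiplication by the `j`-th coordinate of `x - y`. -/
def relCoord (j : Fin n) (x : Euc n) (f : ccSmooth n) : ccSmooth n :=
  x j • f - ccMul (fun y => y j) (contDiff_coord j) f

lemma relCoord_apply (j : Fin n) (x y : Euc n) (f : ccSmooth n) :
    (relCoord j x f : Euc n → ℝ) y = (x j - y j) * (f : Euc n → ℝ) y := by
  simp only [relCoord, ccMul, Submodule.coe_sub, SetLike.val_smul, Pi.sub_apply, Pi.smul_apply,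
    smul_eq_mul]
  ring

lemma pd_eq_zero_of_eq_zero {f : ccSmooth n}
    (hf : ∀ y ∉ closedBall (0 : Euc n) 1, (f : Euc n → ℝ) y = 0) (e : Euc n) :
    ∀ y ∉ closedBall (0 : Euc n) 1, (pd n e f : Euc n → ℝ) y = 0 := by
  intro y hy
  have h : (f : Euc n → ℝ) =ᶠ[nhds y] fun _ => 0 := by
    filter_upwards [isClosed_closedBall.isOpen_compl.mem_nhds hy] with z hz using hf z hz
  rw [pd_apply, h.fderiv_eq]
  simp

/-- Families of test functions with uniformly bounded second derivatives. -/
def BoundedFamily (Ψ : Euc n → ccSmooth n) : Prop :=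
  ∃ K : ℝ, 0 ≤ K ∧ ∀ x ∈ closedBall (0 : Euc n) 2, ∀ a b y,
    |(pdi a (pdi b (Ψ x)) : Euc n → ℝ) y| ≤ (closedBall 0 1).indicator (fun _ => K) y

lemma boundedFamily_const {f : ccSmooth n}
    (hf : ∀ y ∉ closedBall (0 : Euc n) 1, (f : Euc n → ℝ) y = 0) :
    BoundedFamily fun _ => f := by
  choose K hK0 hK using fun a b => ccSmooth_bounded (pdi a (pdi b f))
  refine ⟨∑ a, ∑ b, K a b, Finset.sum_nonneg fun a _ => Finset.sum_nonneg fun b _ => hK0 a b,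
    fun x _ a b y => ?_⟩
  by_cases hy : y ∈ closedBall (0 : Euc n) 1
  · rw [indicator_of_mem hy]
    exact (hK a b y).trans ((Finset.single_le_sum (f := fun b => K a b) (fun b _ => hK0 a b)
      (Finset.mem_univ b)).trans (Finset.single_le_sum (f := fun a => ∑ b, K a b)
        (fun a _ => Finset.sum_nonneg fun b _ => hK0 a b) (Finset.mem_univ a)))
  · rw [indicator_of_notMem hy]
    have := pd_eq_zero_of_eq_zero (pd_eq_zero_of_eq_zero hf (EuclideanSpace.single b 1))
      (EuclideanSpace.single a 1) y hy
    exact (abs_eq_zero.2 this).le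

lemma BoundedFamily.sub_mul {Ψ Φ : Euc n → ccSmooth n} (h : BoundedFamily Ψ)
    (h' : BoundedFamily Φ) (j : Fin n) : BoundedFamily fun x => x j • Ψ x - Φ x := by
  obtain ⟨K, hK0, hK⟩ := h
  obtain ⟨K', hK0', hK'⟩ := h'
  refine ⟨2 * K + K', by positivity, fun x hx a b y => ?_⟩
  have h1 := hK x hx a b y
  have h2 := hK' x hx a b y
  have h3 : |x j| ≤ 2 := by
    have := PiLp.norm_apply_le x j
    rw [mem_closedBall_zero_iff] at hx
    exact (Real.norm_eq_abs _ ▸ this).trans hx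
  have e : (pdi a (pdi b (x j • Ψ x - Φ x)) : Euc n → ℝ) y =
      x j * (pdi a (pdi b (Ψ x)) : Euc n → ℝ) y - (pdi a (pdi b (Φ x)) : Euc n → ℝ) y := by
    simp only [map_sub, map_smul, Submodule.coe_sub, SetLike.val_smul, Pi.sub_apply,
      Pi.smul_apply, smul_eq_mul]
  rw [e]
  refine (abs_sub _ _).trans ?_
  rw [abs_mul]
  by_cases hy : y ∈ closedBall (0 : Euc n) 1
  · rw [indicator_of_mem hy] at *
    have := mul_le_mul h3 h1 (abs_nonneg _) (by norm_num)
    linarith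
  · rw [indicator_of_notMem hy] at *
    rw [le_antisymm h1 (abs_nonneg _)]
    linarith

lemma boundedFamily_relCoord (D : Euc n → Module.End ℝ (ccSmooth n))
    (h : ∀ f : ccSmooth n, (∀ y ∉ closedBall (0 : Euc n) 1, (f : Euc n → ℝ) y = 0) →
      BoundedFamily fun x => D x f) (j : Fin n) (f : ccSmooth n)
    (hf : ∀ y ∉ closedBall (0 : Euc n) 1, (f : Euc n → ℝ) y = 0) :
    BoundedFamily fun x => D x (relCoord j x f) := by
  have := (h f hf).sub_mul (h (ccMul (fun y => y j) (contDiff_coord j) f) fun y hy => by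
    simp [ccMul, hf y hy]) j
  simpa only [relCoord, map_sub, map_smul] using this

/-- `relCoord` as a linear map. -/
def relCoordL (j : Fin n) (x : Euc n) : Module.End ℝ (ccSmooth n) where
  toFun := relCoord j x
  map_add' f g := by
    ext y; simp only [relCoord_apply, Submodule.coe_add, Pi.add_apply]; ring
  map_smul' c f := by
    ext y
    simp only [relCoord_apply, SetLike.val_smul, Pi.smul_apply, smul_eq_mul, RingHom.id_apply]; ring

lemma boundedFamily_relCoord_three {f : ccSmooth n}
    (hf : ∀ y ∉ closedBall (0 : Euc n) 1, (f : Euc n → ℝ) y = 0) (j k m : Fin n) :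
    BoundedFamily fun x => relCoord j x (relCoord k x (relCoord m x f)) := by
  refine boundedFamily_relCoord (fun x => relCoordL j x * relCoordL k x) ?_ m f hf
  refine boundedFamily_relCoord (fun x => relCoordL j x) ?_ k
  refine boundedFamily_relCoord (fun x => 1) ?_ j
  exact fun f hf => boundedFamily_const hf

lemma ccSmooth_taylor_integral (f : ccSmooth n) (x y : Euc n) :
    (f : Euc n → ℝ) x - ((f : Euc n → ℝ) y + (pd n (x - y) f : Euc n → ℝ) y +
      1 / 2 * (pd n (x - y) (pd n (x - y) f) : Euc n → ℝ) y) =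
    ∫ t in (0:ℝ)..1, 1 / 2 * (1 - t) ^ 2 *
      (pd n (x - y) (pd n (x - y) (pd n (x - y) f)) : Euc n → ℝ) (y + t • (x - y)) := by
  set ξ := x - y with hξ
  have hd : ∀ t : ℝ, HasDerivAt (fun t => (f : Euc n → ℝ) (y + t • ξ) +
      (1 - t) * (pd n ξ f : Euc n → ℝ) (y + t • ξ) +
      1 / 2 * (1 - t) ^ 2 * (pd n ξ (pd n ξ f) : Euc n → ℝ) (y + t • ξ))
      (1 / 2 * (1 - t) ^ 2 * (pd n ξ (pd n ξ (pd n ξ f)) : Euc n → ℝ) (y + t • ξ)) t := by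
    intro t
    have h1 : HasDerivAt (fun t : ℝ => 1 - t) (-1) t := by
      simpa using (hasDerivAt_id t).const_sub (1:ℝ)
    have h2 : HasDerivAt (fun t : ℝ => 1 / 2 * (1 - t) ^ 2) (-(1 - t)) t := by
      have := ((h1.pow 2).const_mul (1 / 2 : ℝ))
      refine this.congr_deriv ?_
      ring
    have := ((ccSmooth_hasDerivAt f y ξ t).add (h1.mul (ccSmooth_hasDerivAt (pd n ξ f) y ξ t))).add
      (h2.mul (ccSmooth_hasDerivAt (pd n ξ (pd n ξ f)) y ξ t))
    refine this.congr_deriv ?_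
    ring
  have hc : Continuous fun t : ℝ => y + t • ξ := by fun_prop
  rw [intervalIntegral.integral_eq_sub_of_hasDerivAt (fun t _ => hd t)
    ((((by fun_prop : Continuous fun t : ℝ => 1 / 2 * (1 - t) ^ 2)).mul
      ((ccSmooth_continuous _).comp hc)).intervalIntegrable _ _)]
  simp [hξ]

lemma integral_intervalIntegral_swap {F : Euc n → ℝ → ℝ} (hF : Continuous (Function.uncurry F))
    (h0 : ∀ y ∉ closedBall (0 : Euc n) 1, ∀ t, F y t = 0) :
    ∫ y, ∫ t in (0:ℝ)..1, F y t = ∫ t in (0:ℝ)..1, ∫ y, F y t := by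
  simp only [intervalIntegral.integral_of_le zero_le_one]
  refine integral_integral_swap ?_
  have h : IntegrableOn (Function.uncurry F) (univ ×ˢ Ioc (0:ℝ) 1)
      ((volume : Measure (Euc n)).prod (volume : Measure ℝ)) := by
    refine IntegrableOn.of_forall_sdiff_eq_zero (s := closedBall 0 1 ×ˢ Ioc 0 1) ?_
      (MeasurableSet.univ.prod measurableSet_Ioc) ?_
    · exact (hF.continuousOn.integrableOn_compact ((isCompact_closedBall _ _).prod
        isCompact_Icc)).mono_set (prod_mono_right Ioc_subset_Icc_self)
    · rintro ⟨y, t⟩ ⟨h1, h2⟩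
      exact h0 y (fun hy => h2 ⟨hy, h1.2⟩) t
  rw [IntegrableOn, ← Measure.prod_restrict, Measure.restrict_univ] at h
  exact h

lemma integrable_intervalIntegral {F : Euc n → ℝ → ℝ} (hF : Continuous (Function.uncurry F))
    (h0 : ∀ y ∉ closedBall (0 : Euc n) 1, ∀ t, F y t = 0) :
    Integrable fun y => ∫ t in (0:ℝ)..1, F y t := by
  have hc : Continuous fun y => ∫ t in (0:ℝ)..1, F y t :=
    intervalIntegral.continuous_parametric_intervalIntegral_of_continuous' hF _ _
  refine hc.integrable_of_hasCompactSupport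
    (HasCompactSupport.intro (isCompact_closedBall (0 : Euc n) 1) fun y hy => ?_)
  simp [h0 y hy]

lemma ccSmooth_mul_integrable (f : ccSmooth n) {g : Euc n → ℝ} (hg : Continuous g) :
    Integrable fun y => (f : Euc n → ℝ) y * g y :=
  ((ccSmooth_continuous f).mul hg).integrable_of_hasCompactSupport f.2.2.mul_right

/-- The `L²` pairing of smooth compactly supported functions. -/
def pairing (n : ℕ) : ccSmooth n →ₗ[ℝ] ccSmooth n →ₗ[ℝ] ℝ :=
  LinearMap.mk₂ ℝ (fun f g => ∫ y, (f : Euc n → ℝ) y * (g : Euc n → ℝ) y)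
    (fun f g h => by
      rw [← integral_add (ccSmooth_mul_integrable f (ccSmooth_continuous h))
        (ccSmooth_mul_integrable g (ccSmooth_continuous h))]
      exact integral_congr_ae (Filter.Eventually.of_forall fun y => add_mul _ _ _))
    (fun c f g => by
      rw [smul_eq_mul, ← integral_const_mul]
      exact integral_congr_ae (Filter.Eventually.of_forall fun y => mul_assoc _ _ _))
    (fun f g h => by
      rw [← integral_add (ccSmooth_mul_integrable f (ccSmooth_continuous g))
        (ccSmooth_mul_integrable f (ccSmooth_continuous h))]
      exact integral_congr_ae (Filter.Eventually.of_forall fun y => mul_add _ _ _))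
    (fun c f g => by
      rw [smul_eq_mul, ← integral_const_mul]
      exact integral_congr_ae (Filter.Eventually.of_forall fun y => mul_left_comm _ _ _))

lemma pairing_apply (f g : ccSmooth n) :
    pairing n f g = ∫ y, (f : Euc n → ℝ) y * (g : Euc n → ℝ) y := rfl

lemma pairing_pdi (f g : ccSmooth n) (k : Fin n) : pairing n f (pdi k g) = -pairing n (pdi k f) g := by
  have := integral_mul_pd_segment f g (EuclideanSpace.single k 1) 0 0
  simpa [pairing_apply, pdi] using this

lemma coe_sum_apply {ι : Type*} (s : Finset ι) (f : ι → ccSmooth n) (y : Euc n) :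
    ((∑ i ∈ s, f i : ccSmooth n) : Euc n → ℝ) y = ∑ i ∈ s, (f i : Euc n → ℝ) y := by
  rw [Submodule.coe_sum, Finset.sum_apply]

/-- The second order Taylor polynomial at `y`, evaluated at `x`. -/
def taylorAt (f : ccSmooth n) (x y : Euc n) : ℝ :=
  (f : Euc n → ℝ) y + (pd n (x - y) f : Euc n → ℝ) y +
      1 / 2 * (pd n (x - y) (pd n (x - y) f) : Euc n → ℝ) y

lemma pd_pd_apply (e : Euc n) (f : ccSmooth n) (y : Euc n) :
    (pd n e (pd n e f) : Euc n → ℝ) y =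
      ∑ j, ∑ k, e j * e k * (pdi k (pdi j f) : Euc n → ℝ) y := by
  have h : pd n e (pd n e f) = ∑ j, ∑ k, (e j * e k) • pdi k (pdi j f) := by
    rw [pd_eq_sum e f, map_sum]
    refine Finset.sum_congr rfl fun j _ => ?_
    rw [map_smul, pd_eq_sum, Finset.smul_sum]
    exact Finset.sum_congr rfl fun k _ => smul_smul _ _ _
  rw [h, coe_sum_apply]
  exact Finset.sum_congr rfl fun j _ => coe_sum_apply _ _ _

lemma pd_pd_pd_apply (e : Euc n) (f : ccSmooth n) (y : Euc n) :
    (pd n e (pd n e (pd n e f)) : Euc n → ℝ) y =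
      ∑ j, ∑ k, ∑ m, e j * (e k * e m) * (pdi m (pdi k (pdi j f)) : Euc n → ℝ) y := by
  have h : pd n e (pd n e (pd n e f)) = ∑ j, e j • pd n e (pd n e (pdi j f)) := by
    rw [pd_eq_sum e f, map_sum, map_sum]
    simp only [map_smul]
  rw [h, coe_sum_apply]
  refine Finset.sum_congr rfl fun j _ => ?_
  rw [SetLike.val_smul, Pi.smul_apply, pd_pd_apply, smul_eq_mul, Finset.mul_sum]
  refine Finset.sum_congr rfl fun k _ => ?_
  rw [Finset.mul_sum]
  refine Finset.sum_congr rfl fun m _ => ?_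
  ring

lemma mul_taylorAt (φ f : ccSmooth n) (x y : Euc n) : (φ : Euc n → ℝ) y * taylorAt f x y =
    (φ : Euc n → ℝ) y * (f : Euc n → ℝ) y +
      ∑ j, (relCoord j x φ : Euc n → ℝ) y * (pdi j f : Euc n → ℝ) y +
      ∑ j, ∑ k, 1 / 2 * ((relCoord j x (relCoord k x φ) : Euc n → ℝ) y *
        (pdi k (pdi j f) : Euc n → ℝ) y) := by
  rw [taylorAt, pd_pd_apply, pd_eq_sum, coe_sum_apply, mul_add, mul_add, Finset.mul_sum,
    Finset.mul_sum, Finset.mul_sum]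
  congr 1
  · congr 1
    refine Finset.sum_congr rfl fun j _ => ?_
    rw [relCoord_apply, SetLike.val_smul, Pi.smul_apply, smul_eq_mul, PiLp.sub_apply]
    ring
  · refine Finset.sum_congr rfl fun j _ => ?_
    rw [Finset.mul_sum, Finset.mul_sum]
    refine Finset.sum_congr rfl fun k _ => ?_
    rw [relCoord_apply, relCoord_apply, PiLp.sub_apply, PiLp.sub_apply]
    ring

lemma integrable_mul_taylorAt (φ f : ccSmooth n) (x : Euc n) :
    Integrable fun y => (φ : Euc n → ℝ) y * taylorAt f x y := by
  simp_rw [mul_taylorAt]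
  refine ((ccSmooth_mul_integrable _ (ccSmooth_continuous _)).add ?_).add ?_
  · exact integrable_finsetSum _ fun j _ => ccSmooth_mul_integrable _ (ccSmooth_continuous _)
  · exact integrable_finsetSum _ fun j _ => integrable_finsetSum _ fun k _ =>
      (ccSmooth_mul_integrable _ (ccSmooth_continuous _)).const_mul _

lemma integral_mul_taylorAt (φ f : ccSmooth n) (x : Euc n) :
    ∫ y, (φ : Euc n → ℝ) y * taylorAt f x y = pairing n φ f +
      ∑ j, pairing n (relCoord j x φ) (pdi j f) +
      ∑ j, ∑ k, 1 / 2 * pairing n (relCoord j x (relCoord k x φ)) (pdi k (pdi j f)) := by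
  simp_rw [mul_taylorAt]
  rw [integral_add, integral_add, integral_finsetSum, integral_finsetSum]
  · congr 1
    refine Finset.sum_congr rfl fun j _ => ?_
    rw [integral_finsetSum]
    · exact Finset.sum_congr rfl fun k _ => integral_const_mul _ _
    · exact fun k _ => (ccSmooth_mul_integrable _ (ccSmooth_continuous _)).const_mul _
  · exact fun j _ => integrable_finsetSum _ fun k _ =>
      (ccSmooth_mul_integrable _ (ccSmooth_continuous _)).const_mul _
  · exact fun j _ => ccSmooth_mul_integrable _ (ccSmooth_continuous _)
  · exact ccSmooth_mul_integrable _ (ccSmooth_continuous _)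
  · exact integrable_finsetSum _ fun j _ => ccSmooth_mul_integrable _ (ccSmooth_continuous _)
  · exact (ccSmooth_mul_integrable _ (ccSmooth_continuous _)).add
      (integrable_finsetSum _ fun j _ => ccSmooth_mul_integrable _ (ccSmooth_continuous _))
  · exact integrable_finsetSum _ fun j _ => integrable_finsetSum _ fun k _ =>
      (ccSmooth_mul_integrable _ (ccSmooth_continuous _)).const_mul _

/-- Multiplication by the `j`-th coordinate. -/
def coordMul (j : Fin n) (f : ccSmooth n) : ccSmooth n :=
  ccMul (fun y => y j) (contDiff_coord j) f

/-- The averaged Taylor polynomial is a quadratic polynomial whose coefficients are pairings with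
first derivatives. -/
lemma integral_mul_taylorAt_eq_quadratic (φ f : ccSmooth n) : ∃ a : ℝ, ∀ x : Euc n,
    ∫ y, (φ : Euc n → ℝ) y * taylorAt f x y = a +
      ∑ j, pairing n (φ + ∑ k, pdi k (coordMul k φ)) (pdi j f) * x j +
      1 / 2 * ∑ j, ∑ k, pairing n (-pdi k φ) (pdi j f) * (x j * x k) := by
  refine ⟨pairing n φ f - ∑ j, pairing n (coordMul j φ) (pdi j f) +
    ∑ j, ∑ k, 1 / 2 * pairing n (coordMul j (coordMul k φ)) (pdi k (pdi j f)), fun x => ?_⟩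
  rw [integral_mul_taylorAt]
  have h1 : ∀ j, pairing n (relCoord j x φ) (pdi j f) =
      x j * pairing n φ (pdi j f) - pairing n (coordMul j φ) (pdi j f) := fun j => by
    rw [relCoord, map_sub, map_smul, LinearMap.sub_apply, LinearMap.smul_apply, smul_eq_mul]
    rfl
  have h2 : ∀ j k, pairing n (relCoord j x (relCoord k x φ)) (pdi k (pdi j f)) =
      x j * x k * pairing n φ (pdi k (pdi j f)) - x j * pairing n (coordMul k φ) (pdi k (pdi j f))
      - x k * pairing n (coordMul j φ) (pdi k (pdi j f)) +
      pairing n (coordMul j (coordMul k φ)) (pdi k (pdi j f)) := fun j k => by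
    have e : relCoord j x (relCoord k x φ) = (x j * x k) • φ - x j • coordMul k φ -
        x k • coordMul j φ + coordMul j (coordMul k φ) := by
      ext y
      simp only [relCoord_apply, coordMul, ccMul, Submodule.coe_sub, Submodule.coe_add,
        SetLike.val_smul, Pi.sub_apply, Pi.add_apply, Pi.smul_apply, smul_eq_mul]
      ring
    rw [e]
    simp only [map_sub, map_smul, map_add, LinearMap.sub_apply, LinearMap.smul_apply,
      LinearMap.add_apply, smul_eq_mul]
  have h3 : ∀ j, pairing n (φ + ∑ k, pdi k (coordMul k φ)) (pdi j f) =
      pairing n φ (pdi j f) - ∑ k, pairing n (coordMul k φ) (pdi k (pdi j f)) := fun j => by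
    simp only [pairing_pdi, map_add, map_sum, LinearMap.add_apply, LinearMap.sum_apply,
      Finset.sum_neg_distrib, sub_neg_eq_add]
  have h4 : ∀ j k, pairing n (-pdi k φ) (pdi j f) = pairing n φ (pdi k (pdi j f)) := fun j k => by
    rw [pairing_pdi φ (pdi j f) k, map_neg, LinearMap.neg_apply]
  simp only [h1, h2, h3, h4]
  have h5 : ∑ j, ∑ k, x k * pairing n (coordMul j φ) (pdi k (pdi j f)) =
      ∑ j, ∑ k, x j * pairing n (coordMul k φ) (pdi k (pdi j f)) := by
    rw [Finset.sum_comm]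
    exact Finset.sum_congr rfl fun j _ => Finset.sum_congr rfl fun k _ => by rw [pdi_comm]
  have h6 : ∑ j, (∑ k, pairing n (coordMul k φ) (pdi k (pdi j f))) * x j =
      ∑ j, ∑ k, x j * pairing n (coordMul k φ) (pdi k (pdi j f)) := by
    refine Finset.sum_congr rfl fun j _ => ?_
    rw [Finset.sum_mul]
    exact Finset.sum_congr rfl fun k _ => mul_comm _ _
  have h7 : ∑ j, ∑ k, pairing n φ (pdi k (pdi j f)) * (x j * x k) =
      ∑ j, ∑ k, x j * x k * pairing n φ (pdi k (pdi j f)) :=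
    Finset.sum_congr rfl fun j _ => Finset.sum_congr rfl fun k _ => mul_comm _ _
  simp only [← Finset.mul_sum, Finset.sum_sub_distrib, Finset.sum_add_distrib, sub_mul, h6, h7,
    mul_sub, mul_add] at h5 ⊢
  rw [h5, Finset.sum_congr rfl fun j _ => mul_comm (x j) (pairing n φ (pdi j f))]
  ring

lemma sum_sum_sum_intervalIntegral {g : Fin n → Fin n → Fin n → ℝ → ℝ}
    (hg : ∀ j k m, Continuous (g j k m)) :
    ∫ t in (0:ℝ)..1, ∑ j, ∑ k, ∑ m, g j k m t =
      ∑ j, ∑ k, ∑ m, ∫ t in (0:ℝ)..1, g j k m t := by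
  rw [intervalIntegral.integral_finsetSum fun j _ => (continuous_finsetSum _ fun k _ =>
    continuous_finsetSum _ fun m _ => hg j k m).intervalIntegrable _ _]
  refine Finset.sum_congr rfl fun j _ => ?_
  rw [intervalIntegral.integral_finsetSum fun k _ => (continuous_finsetSum _ fun m _ =>
    hg j k m).intervalIntegrable _ _]
  refine Finset.sum_congr rfl fun k _ => ?_
  rw [intervalIntegral.integral_finsetSum fun m _ => (hg j k m).intervalIntegrable _ _]

lemma sub_integral_mul_taylorAt {φ : ccSmooth n} (hφ : ∫ y, (φ : Euc n → ℝ) y = 1)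
    (h0 : ∀ y ∉ closedBall (0 : Euc n) 1, (φ : Euc n → ℝ) y = 0) (f : ccSmooth n) (x : Euc n) :
    (f : Euc n → ℝ) x - ∫ y, (φ : Euc n → ℝ) y * taylorAt f x y =
      ∑ j, ∑ k, ∑ m, ∫ t in (0:ℝ)..1, 1 / 2 *
        ∫ y, (relCoord j x (relCoord k x (relCoord m x φ)) : Euc n → ℝ) y *
          ((1 - t) ^ 2 * (pdi m (pdi k (pdi j f)) : Euc n → ℝ) (y + t • (x - y))) := by
  have e1 : (f : Euc n → ℝ) x - ∫ y, (φ : Euc n → ℝ) y * taylorAt f x y =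
      ∫ y, (φ : Euc n → ℝ) y * ((f : Euc n → ℝ) x - taylorAt f x y) := by
    have : (f : Euc n → ℝ) x = ∫ y, (φ : Euc n → ℝ) y * (f : Euc n → ℝ) x := by
      rw [integral_mul_const, hφ, one_mul]
    conv_lhs => rw [this]
    rw [← integral_sub (ccSmooth_mul_integrable φ continuous_const) (integrable_mul_taylorAt φ f x)]
    exact integral_congr_ae (Filter.Eventually.of_forall fun y => (mul_sub _ _ _).symm)
  obtain ⟨G, hG⟩ : ∃ G : Fin n → Fin n → Fin n → Euc n → ℝ → ℝ, ∀ j k m y t, G j k m y t =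
      1 / 2 * ((relCoord j x (relCoord k x (relCoord m x φ)) : Euc n → ℝ) y *
          ((1 - t) ^ 2 * (pdi m (pdi k (pdi j f)) : Euc n → ℝ) (y + t • (x - y)))) :=
    ⟨_, fun _ _ _ _ _ => rfl⟩
  have hcont : ∀ j k m, Continuous (Function.uncurry (G j k m)) := by
    intro j k m
    have hc : Continuous fun p : Euc n × ℝ => p.1 + p.2 • (x - p.1) := by fun_prop
    have e : Function.uncurry (G j k m) = fun p => _ := funext fun p => hG j k m p.1 p.2
    rw [e]
    exact continuous_const.mul (((ccSmooth_continuous _).comp continuous_fst).mul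
      (((continuous_const.sub continuous_snd).pow 2).mul ((ccSmooth_continuous _).comp hc)))
  have hzero : ∀ j k m, ∀ y ∉ closedBall (0 : Euc n) 1, ∀ t : ℝ, G j k m y t = 0 := by
    intro j k m y hy t
    simp only [hG, relCoord_apply, h0 y hy]
    ring
  have e2 : ∀ y, (φ : Euc n → ℝ) y * ((f : Euc n → ℝ) x - taylorAt f x y) =
      ∑ j, ∑ k, ∑ m, ∫ t in (0:ℝ)..1, G j k m y t := by
    intro y
    rw [taylorAt, ccSmooth_taylor_integral, ← intervalIntegral.integral_const_mul,
      ← sum_sum_sum_intervalIntegral (g := fun j k m t => G j k m y t) fun j k m =>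
        (hcont j k m).comp (by fun_prop : Continuous fun t : ℝ => (y, t))]
    refine intervalIntegral.integral_congr fun t _ => ?_
    simp only [pd_pd_pd_apply, Finset.mul_sum]
    refine Finset.sum_congr rfl fun j _ => Finset.sum_congr rfl fun k _ =>
      Finset.sum_congr rfl fun m _ => ?_
    simp only [hG, relCoord_apply, PiLp.sub_apply]
    ring
  have hi := fun j k m => integrable_intervalIntegral (hcont j k m) (hzero j k m)
  simp_rw [e1, e2]
  rw [integral_finsetSum _ fun j _ => integrable_finsetSum _ fun k _ =>
    integrable_finsetSum _ fun m _ => hi j k m]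
  refine Finset.sum_congr rfl fun j _ => ?_
  rw [integral_finsetSum _ fun k _ => integrable_finsetSum _ fun m _ => hi j k m]
  refine Finset.sum_congr rfl fun k _ => ?_
  rw [integral_finsetSum _ fun m _ => hi j k m]
  refine Finset.sum_congr rfl fun m _ => ?_
  rw [integral_intervalIntegral_swap (hcont j k m) (hzero j k m)]
  simp only [hG, integral_const_mul]

/-- The sum of the absolute values of the entries of the trace-free symmetric gradient. -/
def lcSum (v : Fin n → ccSmooth n) (y : Euc n) : ℝ := ∑ c, ∑ d, |(lc v c d : Euc n → ℝ) y|

lemma lcSum_continuous (v : Fin n → ccSmooth n) : Continuous (lcSum v) :=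
  continuous_finsetSum _ fun c _ => continuous_finsetSum _ fun d _ =>
      (ccSmooth_continuous (lc v c d)).abs

lemma lcSum_nonneg (v : Fin n → ccSmooth n) (y : Euc n) : 0 ≤ lcSum v y :=
  Finset.sum_nonneg fun _ _ => Finset.sum_nonneg fun _ _ => abs_nonneg _

lemma abs_lc_le_lcSum (v : Fin n → ccSmooth n) (c d : Fin n) (y : Euc n) :
    |(lc v c d : Euc n → ℝ) y| ≤ lcSum v y :=
  (Finset.single_le_sum (f := fun d => |(lc v c d : Euc n → ℝ) y|)
    (fun _ _ => abs_nonneg _) (Finset.mem_univ d)).trans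
  (Finset.single_le_sum (f := fun c => ∑ d, |(lc v c d : Euc n → ℝ) y|)
    (fun _ _ => Finset.sum_nonneg fun _ _ => abs_nonneg _) (Finset.mem_univ c))

lemma exists_taylor_remainder_bound (hn : 3 ≤ n) {φ : ccSmooth n}
    (hφ : ∫ y, (φ : Euc n → ℝ) y = 1)
    (h0 : ∀ y ∉ closedBall (0 : Euc n) 1, (φ : Euc n → ℝ) y = 0) :
    ∃ C : ℝ, 0 ≤ C ∧ ∀ (v : Fin n → ccSmooth n) (i : Fin n), ∀ x ∈ closedBall (0 : Euc n) 2,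
      ENNReal.ofReal |(v i : Euc n → ℝ) x - ∫ y, (φ : Euc n → ℝ) y * taylorAt (v i) x y| ≤
        ENNReal.ofReal C * ∫⁻ t in Ioc (0:ℝ) 1, ∫⁻ y in closedBall (0 : Euc n) 1,
          ENNReal.ofReal (lcSum v (y + t • (x - y))) := by
  choose K hK0 hK using fun j k m => boundedFamily_relCoord_three h0 j k m
  choose D hD0 hD using fun m k j i => third_mem hn (segmentControlled n)
    pdi_pdi_lc_mem_segmentControlled m k j i
  have hnn : ∀ m k j i, 0 ≤ 1 / 2 * (D m k j i * K j k m) := fun m k j i =>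
    mul_nonneg (by norm_num) (mul_nonneg (hD0 _ _ _ _) (hK0 _ _ _))
  refine ⟨∑ i, ∑ j, ∑ k, ∑ m, 1 / 2 * (D m k j i * K j k m),
    Finset.sum_nonneg fun i _ => Finset.sum_nonneg fun j _ => Finset.sum_nonneg fun k _ =>
      Finset.sum_nonneg fun m _ => hnn _ _ _ _, fun v i x hx => ?_⟩
  rw [sub_integral_mul_taylorAt hφ h0]
  set Z := ∫⁻ t in Ioc (0:ℝ) 1, ∫⁻ y in closedBall (0 : Euc n) 1,
          ENNReal.ofReal (lcSum v (y + t • (x - y))) with hZ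
  have key : ∀ j k m, ‖∫ t in (0:ℝ)..1, 1 / 2 *
        ∫ y, (relCoord j x (relCoord k x (relCoord m x φ)) : Euc n → ℝ) y *
          ((1 - t) ^ 2 * (pdi m (pdi k (pdi j (v i))) : Euc n → ℝ) (y + t • (x - y)))‖ₑ ≤
      ENNReal.ofReal (1 / 2 * (D m k j i * K j k m)) * Z := by
    intro j k m
    rw [intervalIntegral.integral_of_le zero_le_one, hZ,
      ← lintegral_const_mul' _ _ ENNReal.ofReal_ne_top]
    refine (enorm_integral_le_lintegral_enorm _).trans (lintegral_mono fun t => ?_)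
    have hInt : IntegrableOn (fun y => lcSum v (y + t • (x - y))) (closedBall 0 1) :=
      ((lcSum_continuous v).comp (by fun_prop : Continuous fun y : Euc n =>
        y + t • (x - y))).continuousOn.integrableOn_compact (isCompact_closedBall _ _)
    rw [← ofReal_integral_eq_lintegral_ofReal hInt
      (Filter.Eventually.of_forall fun y => lcSum_nonneg v _), ← ENNReal.ofReal_mul (hnn _ _ _ _),
      ← ofReal_norm, Real.norm_eq_abs, abs_mul]
    refine ENNReal.ofReal_le_ofReal ?_
    have := hD m k j i v _ x t _ (hK j k m x hx)
    rw [abs_of_pos (by norm_num : (0:ℝ) < 1 / 2), mul_assoc, mul_assoc]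
    exact mul_le_mul_of_nonneg_left this (by norm_num)
  rw [← Real.norm_eq_abs, ofReal_norm]
  refine (enorm_sum_le _ _).trans ?_
  refine (Finset.sum_le_sum fun j _ => (enorm_sum_le _ _).trans (Finset.sum_le_sum fun k _ =>
    (enorm_sum_le _ _).trans (Finset.sum_le_sum fun m _ => key j k m))).trans ?_
  simp only [← Finset.sum_mul]
  refine mul_le_mul_left ?_ _
  simp only [← ENNReal.ofReal_sum_of_nonneg fun m _ => hnn m _ _ _]
  rw [Finset.sum_congr rfl fun j _ => (ENNReal.ofReal_sum_of_nonneg (fun k _ =>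
    Finset.sum_nonneg fun m _ => hnn m k j i)).symm, ← ENNReal.ofReal_sum_of_nonneg (fun j _ =>
    Finset.sum_nonneg fun k _ => Finset.sum_nonneg fun m _ => hnn m k j i)]
  refine ENNReal.ofReal_le_ofReal ?_
  exact Finset.single_le_sum (f := fun i => ∑ j, ∑ k, ∑ m, 1 / 2 * (D m k j i * K j k m))
    (fun i _ => Finset.sum_nonneg fun j _ => Finset.sum_nonneg fun k _ =>
      Finset.sum_nonneg fun m _ => hnn _ _ _ _) (Finset.mem_univ i)

end AveragedTaylor

section SegmentAverages

variable {n : ℕ}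

lemma rpow_lintegral_le {α : Type*} [MeasurableSpace α] (μ : Measure α) {p q : ℝ}
    (hpq : p.HolderConjugate q) {f : α → ℝ≥0∞} (hf : AEMeasurable f μ) :
    (∫⁻ a, f a ∂μ) ^ p ≤ μ univ ^ (p / q) * ∫⁻ a, f a ^ p ∂μ := by
  have h := ENNReal.lintegral_mul_le_Lp_mul_Lq μ hpq hf (aemeasurable_const (b := (1 : ℝ≥0∞)))
  simp only [Pi.mul_apply, mul_one, ENNReal.one_rpow, lintegral_const, one_mul] at h
  have h2 := ENNReal.rpow_le_rpow h hpq.pos.le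
  rw [ENNReal.mul_rpow_of_nonneg _ _ hpq.pos.le, ← ENNReal.rpow_mul, ← ENNReal.rpow_mul,
    one_div_mul_cancel hpq.pos.ne', ENNReal.rpow_one, mul_comm] at h2
  rwa [one_div_mul_eq_div] at h2

lemma lintegral_comp_add_smul (g : Euc n → ℝ≥0∞) (a : Euc n) {c : ℝ} (hc : c ≠ 0) :
    ∫⁻ y, g (a + c • y) = ENNReal.ofReal |(c ^ n)⁻¹| * ∫⁻ z, g z := by
  have h1 := Measure.map_addHaar_smul (volume : Measure (Euc n)) hc
  have h2 : ∫⁻ y, g (a + c • y) = ∫⁻ z, g (a + z) ∂(Measure.map (c • · ) volume) :=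
    (lintegral_map_equiv (μ := volume) (fun z => g (a + z))
      (Homeomorph.smulOfNeZero c hc).toMeasurableEquiv).symm
  rw [h2, h1, lintegral_smul_measure, finrank_euclideanSpace, Fintype.card_fin,
    lintegral_add_left_eq_self, smul_eq_mul]

lemma lintegral_comp_segment_le {g : Euc n → ℝ≥0∞} {c : ℝ} (hc : 1 / 2 ≤ c) (a : Euc n) :
    ∫⁻ y, g (a + c • y) ≤ 2 ^ n * ∫⁻ z, g z := by
  rw [lintegral_comp_add_smul g a (by linarith)]
  refine mul_le_mul_left ?_ _
  have h0 : 0 < c := by linarith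
  rw [abs_of_pos (by positivity), ← inv_pow]
  have h1 : c⁻¹ ≤ 2 := by
    rw [inv_le_comm₀ h0 (by norm_num)]
    linarith
  calc ENNReal.ofReal (c⁻¹ ^ n) ≤ ENNReal.ofReal (2 ^ n) :=
        ENNReal.ofReal_le_ofReal (pow_le_pow_left₀ (by positivity) h1 n)
    _ = 2 ^ n := by rw [ENNReal.ofReal_pow (by norm_num)]; simp

lemma lintegral_segment_le {g : Euc n → ℝ≥0∞} (hg : Measurable g) :
    ∫⁻ x in closedBall (0 : Euc n) 2, ∫⁻ t in Ioc (0:ℝ) 1, ∫⁻ y in closedBall (0 : Euc n) 1,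
      g (y + t • (x - y)) ≤
    (volume (closedBall (0 : Euc n) 2) + volume (closedBall (0 : Euc n) 1)) * 2 ^ n *
      ∫⁻ z in closedBall (0 : Euc n) 2, g z := by
  set g' := (closedBall (0 : Euc n) 2).indicator g with hg'
  have hm' : Measurable g' := hg.indicator measurableSet_closedBall
  have hZ : ∫⁻ z in closedBall (0 : Euc n) 2, g z = ∫⁻ z, g' z :=
    (lintegral_indicator measurableSet_closedBall _).symm
  rw [hZ]
  set Z := ∫⁻ z, g' z
  have hm3 : Measurable fun q : (Euc n × ℝ) × Euc n => g (q.2 + q.1.2 • (q.1.1 - q.2)) :=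
    hg.comp (by fun_prop)
  have hm2 : Measurable fun q : Euc n × ℝ => ∫⁻ y in closedBall (0 : Euc n) 1,
      g (y + q.2 • (q.1 - y)) := hm3.lintegral_prod_right'
  rw [lintegral_lintegral_swap hm2.aemeasurable]
  have key : ∀ t ∈ Ioc (0:ℝ) 1, ∫⁻ x in closedBall (0 : Euc n) 2,
      ∫⁻ y in closedBall (0 : Euc n) 1, g (y + t • (x - y)) ≤
      (volume (closedBall (0 : Euc n) 2) + volume (closedBall (0 : Euc n) 1)) * 2 ^ n * Z := by
    intro t ht
    have e : ∫⁻ x in closedBall (0 : Euc n) 2, ∫⁻ y in closedBall (0 : Euc n) 1,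
        g (y + t • (x - y)) = ∫⁻ x in closedBall (0 : Euc n) 2,
          ∫⁻ y in closedBall (0 : Euc n) 1, g' (y + t • (x - y)) := by
      refine setLIntegral_congr_fun measurableSet_closedBall fun x hx => ?_
      refine setLIntegral_congr_fun measurableSet_closedBall fun y hy => ?_
      have hmem : y + t • (x - y) ∈ closedBall (0 : Euc n) 2 :=
        (convex_closedBall (0 : Euc n) 2).add_smul_sub_mem
          (closedBall_subset_closedBall (by norm_num) hy) hx ⟨ht.1.le, ht.2⟩
      simp only [hg', indicator_of_mem hmem]
    rw [e]
    rcases le_total t (1 / 2) with h | h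
    · calc _ ≤ ∫⁻ x in closedBall (0 : Euc n) 2, 2 ^ n * Z := by
            refine lintegral_mono fun x => (setLIntegral_le_lintegral _ _).trans ?_
            have := lintegral_comp_segment_le (g := g') (c := 1 - t) (by linarith) (t • x)
            refine le_trans (le_of_eq (lintegral_congr fun y => ?_)) this
            congr 1
            module
        _ ≤ _ := by
            rw [setLIntegral_const, mul_comm, mul_assoc]
            exact mul_le_mul_left le_self_add _
    · rw [lintegral_lintegral_swap]
      · calc _ ≤ ∫⁻ y in closedBall (0 : Euc n) 1, 2 ^ n * Z := by
              refine lintegral_mono fun y => (setLIntegral_le_lintegral _ _).trans ?_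
              have := lintegral_comp_segment_le (g := g') (c := t) h ((1 - t) • y)
              refine le_trans (le_of_eq (lintegral_congr fun x => ?_)) this
              congr 1
              module
          _ ≤ _ := by
              rw [setLIntegral_const, mul_comm, mul_assoc]
              exact mul_le_mul_left le_add_self _
      · exact Measurable.aemeasurable (hm'.comp (by fun_prop :
          Measurable fun q : Euc n × Euc n => q.2 + t • (q.1 - q.2)))
  refine (setLIntegral_mono measurable_const key).trans ?_
  simp

end SegmentAverages

section Quadratic

variable {n : ℕ}

/-- Coefficients of affine matrix fields. -/
abbrev AffCoef (n : ℕ) := (Fin n → Fin n → ℝ) × (Fin n → Fin n → Fin n → ℝ)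

/-- The affine matrix field with given coefficients. -/
def affMat (Q : AffCoef n) (x : Euc n) (i j : Fin n) : ℝ := Q.1 i j + ∑ k, Q.2 i j k * x k

/-- The quadratic field whose differential is the affine matrix field with (symmetric)
coefficients `Q`. -/
def quadField (a : Fin n → ℝ) (Q : AffCoef n) (x : Euc n) (i : Fin n) : ℝ :=
  a i + ∑ j, Q.1 i j * x j + 1 / 2 * ∑ j, ∑ k, Q.2 i j k * (x j * x k)

/-- The trace-free symmetric part of a matrix. -/
def tfSym (M : Fin n → Fin n → ℝ) (i j : Fin n) : ℝ :=
  1 / 2 * (M i j + M j i) - (if i = j then (1 / (n:ℝ)) else 0) * ∑ a, M a a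

/-- The linear conditions characterising differentials of conformal Killing fields. -/
def killingDefect (n : ℕ) : AffCoef n →ₗ[ℝ]
    (Fin n → Fin n → ℝ) × (Fin n → Fin n → Fin n → ℝ) × (Fin n → Fin n → Fin n → ℝ) where
  toFun Q := (tfSym Q.1, fun k => tfSym fun a b => Q.2 a b k, fun i j k => Q.2 i j k - Q.2 i k j)
  map_add' P Q := by
    refine Prod.ext ?_ (Prod.ext ?_ ?_)
    · ext i j
      simp only [tfSym, Prod.fst_add, Pi.add_apply, Finset.sum_add_distrib]
      ring
    · ext k i j
      simp only [tfSym, Prod.snd_add, Prod.fst_add, Pi.add_apply, Finset.sum_add_distrib]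
      ring
    · ext i j k
      simp only [Prod.snd_add, Pi.add_apply]
      ring
  map_smul' c Q := by
    refine Prod.ext ?_ (Prod.ext ?_ ?_)
    · ext i j
      simp only [tfSym, Prod.smul_fst, Pi.smul_apply, smul_eq_mul, ← Finset.mul_sum,
        RingHom.id_apply]
      ring
    · ext k i j
      simp only [tfSym, Prod.smul_snd, Prod.smul_fst, Pi.smul_apply, smul_eq_mul, ← Finset.mul_sum,
        RingHom.id_apply]
      ring
    · ext i j k
      simp only [Prod.smul_snd, Pi.smul_apply, smul_eq_mul, RingHom.id_apply]
      ring

/-- Coefficients of differentials of conformal Killing fields. -/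
def killingCoef (n : ℕ) : Submodule ℝ (AffCoef n) := LinearMap.ker (killingDefect n)

lemma mem_killingCoef_iff {Q : AffCoef n} : Q ∈ killingCoef n ↔ (∀ i j, tfSym Q.1 i j = 0) ∧
    (∀ k i j, tfSym (fun a b => Q.2 a b k) i j = 0) ∧ ∀ i j k, Q.2 i j k = Q.2 i k j := by
  rw [killingCoef, LinearMap.mem_ker]
  constructor
  · intro h
    refine ⟨fun i j => congrFun (congrFun (congrArg Prod.fst h) i) j, fun k i j =>
      congrFun (congrFun (congrFun (congrArg (fun z => z.2.1) h) k) i) j, fun i j k => ?_⟩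
    have := congrFun (congrFun (congrFun (congrArg (fun z => z.2.2) h) i) j) k
    exact sub_eq_zero.1 this
  · rintro ⟨h1, h2, h3⟩
    refine Prod.ext ?_ (Prod.ext ?_ ?_)
    · ext i j; exact h1 i j
    · ext k i j; exact h2 k i j
    · ext i j k; exact sub_eq_zero.2 (h3 i j k)

lemma tfSym_affMat {Q : AffCoef n} (hQ : Q ∈ killingCoef n) (x : Euc n) (i j : Fin n) :
    tfSym (affMat Q x) i j = 0 := by
  rw [mem_killingCoef_iff] at hQ
  have e : tfSym (affMat Q x) i j = tfSym Q.1 i j + ∑ k, tfSym (fun a b => Q.2 a b k) i j * x k := by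
    simp only [tfSym, affMat, Finset.sum_add_distrib, sub_mul, Finset.sum_sub_distrib, mul_assoc,
      ← Finset.mul_sum, add_mul]
    rw [Finset.sum_comm]
    simp only [← Finset.sum_mul]
    ring
  rw [e, hQ.1 i j]
  simp [hQ.2.1]

lemma contDiff_quadField (a : Fin n → ℝ) (Q : AffCoef n) (i : Fin n) :
    ContDiff ℝ (⊤ : ℕ∞) fun x : Euc n => quadField a Q x i := by
  have hj := fun j : Fin n => contDiff_coord j
  refine (contDiff_const.add (ContDiff.sum fun j _ => contDiff_const.mul (hj j))).add
    (contDiff_const.mul (ContDiff.sum fun j _ => ContDiff.sum fun k _ =>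
      contDiff_const.mul ((hj j).mul (hj k))))

lemma fderiv_quadField (a : Fin n → ℝ) {Q : AffCoef n} (hQ : ∀ i j k, Q.2 i j k = Q.2 i k j)
    (x : Euc n) (i m : Fin n) :
    fderiv ℝ (fun x : Euc n => quadField a Q x i) x (EuclideanSpace.single m 1) =
      affMat Q x i m := by
  have hj : ∀ j : Fin n, HasFDerivAt (fun y : Euc n => y j)
      (EuclideanSpace.proj (𝕜 := ℝ) j : Euc n →L[ℝ] ℝ) x := fun j =>
    (EuclideanSpace.proj (𝕜 := ℝ) j : Euc n →L[ℝ] ℝ).hasFDerivAt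
  have h := ((hasFDerivAt_const (a i) x).add (HasFDerivAt.fun_sum fun j (_ : j ∈ Finset.univ) =>
    (hj j).const_mul (Q.1 i j))).add
    ((HasFDerivAt.fun_sum fun j (_ : j ∈ Finset.univ) => HasFDerivAt.fun_sum
      fun k (_ : k ∈ Finset.univ) => ((hj j).mul (hj k)).const_mul (Q.2 i j k)).const_mul (1 / 2 : ℝ))
  have e : fderiv ℝ (fun x : Euc n => quadField a Q x i) x = _ := HasFDerivAt.fderiv h
  rw [e]
  have hp : ∀ j : Fin n, (EuclideanSpace.proj (𝕜 := ℝ) j : Euc n →L[ℝ] ℝ)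
      (EuclideanSpace.single m 1) = if j = m then 1 else 0 := fun j => PiLp.single_apply 2 ℝ m 1 j
  simp only [_root_.add_apply, _root_.smul_apply, _root_.sum_apply,
    smul_eq_mul, hp, mul_ite, mul_one, mul_zero, mul_add, Finset.sum_add_distrib,
    Finset.sum_ite_eq', Finset.mem_univ, if_true, zero_add]
  have e1 : ∑ j, ∑ k, (if j = m then Q.2 i j k * x k else 0) = ∑ k, Q.2 i m k * x k := by
    rw [Finset.sum_comm]
    simp
  have e2 : ∑ j, Q.2 i j m * x j = ∑ k, Q.2 i m k * x k :=
    Finset.sum_congr rfl fun k _ => by rw [hQ]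
  rw [e1, e2, affMat]
  ring

lemma exists_linear_correction {E F : Type*} [NormedAddCommGroup E] [NormedSpace ℝ E]
    [NormedAddCommGroup F] [NormedSpace ℝ F] [FiniteDimensional ℝ F] [FiniteDimensional ℝ E]
    (L : E →ₗ[ℝ] F) : ∃ C : ℝ, 0 ≤ C ∧ ∀ x : E, ∃ y : E, L y = 0 ∧ ‖x - y‖ ≤ C * ‖L x‖ := by
  obtain ⟨S, hS⟩ := L.rangeRestrict.exists_rightInverse_of_surjective L.range_rangeRestrict
  refine ⟨‖LinearMap.toContinuousLinearMap S‖, ContinuousLinearMap.opNorm_nonneg _, fun x =>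
    ⟨x - S (L.rangeRestrict x), ?_, ?_⟩⟩
  · have h : L (S (L.rangeRestrict x)) = L x :=
      congrArg Subtype.val (LinearMap.congr_fun hS (L.rangeRestrict x))
    rw [map_sub, h, sub_self]
  · rw [sub_sub_cancel]
    exact (LinearMap.toContinuousLinearMap S).le_opNorm (L.rangeRestrict x)

lemma AffCoef.abs_fst_le (Q : AffCoef n) (i j : Fin n) : |Q.1 i j| ≤ ‖Q‖ :=
  (norm_le_pi_norm (Q.1 i) j).trans ((norm_le_pi_norm Q.1 i).trans (norm_fst_le Q))

lemma AffCoef.abs_snd_le (Q : AffCoef n) (i j k : Fin n) : |Q.2 i j k| ≤ ‖Q‖ :=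
  (norm_le_pi_norm (Q.2 i j) k).trans ((norm_le_pi_norm (Q.2 i) j).trans
    ((norm_le_pi_norm Q.2 i).trans (norm_snd_le Q)))

lemma abs_quadField_le (Q : AffCoef n) {x : Euc n} (hx : x ∈ closedBall (0 : Euc n) 2) (i : Fin n) :
    |quadField 0 Q x i| ≤ (2 * n + 2 * n ^ 2) * ‖Q‖ := by
  have h3 : ∀ j, |x j| ≤ 2 := fun j => by
    have := PiLp.norm_apply_le x j
    rw [mem_closedBall_zero_iff] at hx
    exact (Real.norm_eq_abs _ ▸ this).trans hx
  have h1 : |∑ j, Q.1 i j * x j| ≤ n * (‖Q‖ * 2) := by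
    refine (Finset.abs_sum_le_sum_abs _ _).trans ?_
    refine (Finset.sum_le_card_nsmul _ _ (‖Q‖ * 2) fun j _ => ?_).trans (by simp)
    rw [abs_mul]
    exact mul_le_mul (Q.abs_fst_le i j) (h3 j) (abs_nonneg _) (norm_nonneg _)
  have h2 : |∑ j, ∑ k, Q.2 i j k * (x j * x k)| ≤ n * (n * (‖Q‖ * (2 * 2))) := by
    refine (Finset.abs_sum_le_sum_abs _ _).trans ?_
    refine (Finset.sum_le_card_nsmul _ _ (n * (‖Q‖ * (2 * 2))) fun j _ => ?_).trans (by simp)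
    refine (Finset.abs_sum_le_sum_abs _ _).trans ?_
    refine (Finset.sum_le_card_nsmul _ _ (‖Q‖ * (2 * 2)) fun k _ => ?_).trans (by simp)
    rw [abs_mul, abs_mul]
    exact mul_le_mul (Q.abs_snd_le i j k) (mul_le_mul (h3 j) (h3 k) (abs_nonneg _) (by norm_num))
      (by positivity) (norm_nonneg _)
  rw [quadField, Pi.zero_apply, zero_add]
  refine (abs_add_le _ _).trans ?_
  rw [abs_mul, abs_of_pos (by norm_num : (0:ℝ) < 1 / 2)]
  linarith

lemma quadField_sub (a : Fin n → ℝ) (P Q : AffCoef n) (x : Euc n) (i : Fin n) :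
    quadField a P x i - quadField a Q x i = quadField 0 (P - Q) x i := by
  simp only [quadField, Prod.fst_sub, Prod.snd_sub, Pi.sub_apply, sub_mul, Finset.sum_sub_distrib,
    Pi.zero_apply]
  ring

lemma exists_abs_pairing_le {θ : ccSmooth n}
    (h0 : ∀ y ∉ closedBall (0 : Euc n) 1, (θ : Euc n → ℝ) y = 0) :
    ∃ K : ℝ, 0 ≤ K ∧ ∀ (v : Fin n → ccSmooth n) (i j : Fin n),
      |pairing n θ (lc v i j)| ≤ K * ∫ y in closedBall (0 : Euc n) 1, lcSum v y := by
  obtain ⟨K, hK0, hK⟩ := ccSmooth_bounded θ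
  refine ⟨K, hK0, fun v i j => ?_⟩
  rw [pairing_apply, ← integral_const_mul, ← integral_indicator measurableSet_closedBall]
  refine (abs_integral_le_integral_abs).trans (integral_mono ?_ ?_ fun y => ?_)
  · exact (ccSmooth_mul_integrable θ (ccSmooth_continuous _)).abs
  · exact (integrable_indicator_iff measurableSet_closedBall).2
      (((lcSum_continuous v).continuousOn.integrableOn_compact (isCompact_closedBall _ _)).const_mul K)
  · simp only [abs_mul]
    by_cases hy : y ∈ closedBall (0 : Euc n) 1
    · rw [indicator_of_mem hy]
      exact mul_le_mul (hK y) (abs_lc_le_lcSum v i j y) (abs_nonneg _) hK0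
    · rw [indicator_of_notMem hy, h0 y hy, abs_zero, zero_mul]

lemma tfSym_pairing (θ : ccSmooth n) (v : Fin n → ccSmooth n) (i j : Fin n) :
    tfSym (fun i j => pairing n θ (pdi j (v i))) i j = pairing n θ (lc v i j) := by
  simp only [tfSym, lc, divc, map_sub, map_smul, map_add, map_sum, smul_eq_mul]

lemma exists_killing_approx (hn : 3 ≤ n) : ∃ C : ℝ≥0∞, C ≠ ⊤ ∧ ∀ v : Fin n → ccSmooth n,
    ∃ Q ∈ killingCoef n, ∃ a : Fin n → ℝ, ∀ i, ∀ x ∈ closedBall (0 : Euc n) 2,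
      ‖(v i : Euc n → ℝ) x - quadField a Q x i‖ₑ ≤
        C * ((∫⁻ t in Ioc (0:ℝ) 1, ∫⁻ y in closedBall (0 : Euc n) 1,
          ENNReal.ofReal (lcSum v (y + t • (x - y)))) +
          ∫⁻ y in closedBall (0 : Euc n) 1, ENNReal.ofReal (lcSum v y)) := by
  obtain ⟨φ, hφ, h0⟩ : ∃ φ : ccSmooth n, ∫ y, (φ : Euc n → ℝ) y = 1 ∧
      ∀ y ∉ closedBall (0 : Euc n) 1, (φ : Euc n → ℝ) y = 0 := by
    let f : ContDiffBump (0 : Euc n) := ⟨1 / 2, 1, by norm_num, by norm_num⟩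
    refine ⟨⟨f.normed volume, f.contDiff_normed, f.hasCompactSupport_normed⟩,
      f.integral_normed, fun y hy => ?_⟩
    have : y ∉ tsupport (f.normed volume) := by rw [f.tsupport_normed_eq]; exact hy
    exact image_eq_zero_of_notMem_tsupport this
  obtain ⟨C₀, hC₀, hT⟩ := exists_taylor_remainder_bound hn hφ h0
  have hcm : ∀ k, ∀ y ∉ closedBall (0 : Euc n) 1, (coordMul k φ : Euc n → ℝ) y = 0 :=
    fun k y hy => by simp [coordMul, ccMul, h0 y hy]
  obtain ⟨K₁, hK₁, hb₁⟩ := exists_abs_pairing_le (θ := φ + ∑ k, pdi k (coordMul k φ)) fun y hy => by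
    rw [Submodule.coe_add, Pi.add_apply, coe_sum_apply, h0 y hy, Finset.sum_eq_zero, add_zero]
    exact fun k _ => pd_eq_zero_of_eq_zero (hcm k) _ y hy
  choose K₂ hK₂ hb₂ using fun k => exists_abs_pairing_le (θ := -pdi k φ) fun y hy => by
    rw [Submodule.coe_neg, Pi.neg_apply, neg_eq_zero]
    exact pd_eq_zero_of_eq_zero h0 _ y hy
  obtain ⟨R, hR0, hR⟩ := exists_linear_correction (killingDefect n)
  set K := K₁ + ∑ k, K₂ k with hK
  have hKs : 0 ≤ ∑ k, K₂ k := Finset.sum_nonneg fun k _ => hK₂ k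
  have hK0 : 0 ≤ K := add_nonneg hK₁ hKs
  refine ⟨ENNReal.ofReal C₀ + ENNReal.ofReal ((2 * n + 2 * n ^ 2) * (R * K)), by simp,
    fun v => ?_⟩
  set m := ∫ y in closedBall (0 : Euc n) 1, lcSum v y with hm
  have hm0 : 0 ≤ m := integral_nonneg fun y => lcSum_nonneg v y
  let Q : AffCoef n := (fun i j => pairing n (φ + ∑ k, pdi k (coordMul k φ)) (pdi j (v i)),
    fun i j k => pairing n (-pdi k φ) (pdi j (v i)))
  have hQ : ‖killingDefect n Q‖ ≤ K * m := by
    have hKm : 0 ≤ K * m := mul_nonneg hK0 hm0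
    refine max_le ?_ (max_le ?_ ?_)
    · refine (pi_norm_le_iff_of_nonneg hKm).2 fun i => (pi_norm_le_iff_of_nonneg hKm).2 fun j => ?_
      refine (le_of_eq ?_).trans ((hb₁ v i j).trans
        (mul_le_mul_of_nonneg_right (le_add_of_nonneg_right hKs) hm0))
      rw [← tfSym_pairing]
      rfl
    · refine (pi_norm_le_iff_of_nonneg hKm).2 fun k => (pi_norm_le_iff_of_nonneg hKm).2 fun i =>
        (pi_norm_le_iff_of_nonneg hKm).2 fun j => ?_
      refine (le_of_eq ?_).trans ((hb₂ k v i j).trans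
        (mul_le_mul_of_nonneg_right ?_ hm0))
      · rw [← tfSym_pairing]
        rfl
      · exact (Finset.single_le_sum (fun k _ => hK₂ k) (Finset.mem_univ k)).trans
          (le_add_of_nonneg_left hK₁)
    · refine (pi_norm_le_iff_of_nonneg hKm).2 fun i => (pi_norm_le_iff_of_nonneg hKm).2 fun j =>
        (pi_norm_le_iff_of_nonneg hKm).2 fun k => ?_
      have e : pairing n (-pdi k φ) (pdi j (v i)) - pairing n (-pdi j φ) (pdi k (v i)) = 0 := by
        rw [map_neg, map_neg, LinearMap.neg_apply, LinearMap.neg_apply, ← pairing_pdi,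
          ← pairing_pdi, pdi_comm, sub_self]
      refine le_trans (le_of_eq ?_) hKm
      rw [norm_eq_zero]
      exact e
  obtain ⟨Q', hQ'0, hQ'⟩ := hR Q
  choose a ha using fun i => integral_mul_taylorAt_eq_quadratic φ (v i)
  refine ⟨Q', hQ'0, a, fun i x hx => ?_⟩
  have h1 := hT v i x hx
  rw [ha i x] at h1
  have e1 : (v i : Euc n → ℝ) x - quadField a Q' x i =
      ((v i : Euc n → ℝ) x - quadField a Q x i) + quadField 0 (Q - Q') x i := by
    rw [← quadField_sub a]; ring
  have h2 : ENNReal.ofReal |quadField 0 (Q - Q') x i| ≤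
      ENNReal.ofReal ((2 * n + 2 * n ^ 2) * (R * K)) *
        ∫⁻ y in closedBall (0 : Euc n) 1, ENNReal.ofReal (lcSum v y) := by
    rw [← ofReal_integral_eq_lintegral_ofReal
      ((lcSum_continuous v).continuousOn.integrableOn_compact (isCompact_closedBall _ _))
      (Filter.Eventually.of_forall fun y => lcSum_nonneg v _), ← ENNReal.ofReal_mul (by positivity)]
    refine ENNReal.ofReal_le_ofReal ((abs_quadField_le _ hx i).trans ?_)
    rw [mul_assoc, mul_assoc]
    refine mul_le_mul_of_nonneg_left (hQ'.trans ?_) (by positivity)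
    exact mul_le_mul_of_nonneg_left hQ hR0
  rw [e1]
  refine (enorm_add_le _ _).trans ?_
  rw [Real.enorm_eq_ofReal_abs, Real.enorm_eq_ofReal_abs, mul_add]
  refine add_le_add (h1.trans ?_) (h2.trans ?_)
  · exact mul_le_mul_left le_self_add _
  · exact mul_le_mul_left le_add_self _

end Quadratic

section LocalSmoothKorn

variable {n : ℕ}

lemma ofReal_integral_abs_rpow (f : ccSmooth n) {p : ℝ} (hp : 0 < p) :
    ENNReal.ofReal (∫ x, |(f : Euc n → ℝ) x| ^ p) = ∫⁻ x, ‖(f : Euc n → ℝ) x‖ₑ ^ p := by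
  rw [ofReal_integral_eq_lintegral_ofReal (ccSmooth_rpow_integrable f hp)
    (Filter.Eventually.of_forall fun x => by positivity)]
  refine lintegral_congr fun x => ?_
  rw [Real.enorm_eq_ofReal_abs, ENNReal.ofReal_rpow_of_nonneg (abs_nonneg _) hp.le]

lemma lc_apply (v : Fin n → ccSmooth n) (a b : Fin n) (y : Euc n) :
    (lc v a b : Euc n → ℝ) y = tfSym (fun i j => (pdi j (v i) : Euc n → ℝ) y) a b := by
  simp only [lc, divc, tfSym, Submodule.coe_sub, Submodule.coe_add, SetLike.val_smul, Pi.sub_apply,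
    Pi.add_apply, Pi.smul_apply, smul_eq_mul, coe_sum_apply]

lemma abs_tfSym_mul_le {e d : Fin n → ℝ} {K : ℝ} (he : ∀ i, |e i| ≤ K) (hn : 0 < n) (a b : Fin n) :
    |tfSym (fun i j => e j * d i) a b| ≤ 2 * K * ∑ i, |d i| := by
  have hK : 0 ≤ K := (abs_nonneg _).trans (he a)
  have h1 : ∀ i j, |e j * d i| ≤ K * ∑ i, |d i| := fun i j => by
    rw [abs_mul]
    exact mul_le_mul (he j) (Finset.single_le_sum (f := fun i => |d i|) (fun _ _ => abs_nonneg _)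
      (Finset.mem_univ i)) (abs_nonneg _) hK
  have h2 : |∑ i, e i * d i| ≤ K * ∑ i, |d i| := by
    refine (Finset.abs_sum_le_sum_abs _ _).trans ?_
    rw [Finset.mul_sum]
    refine Finset.sum_le_sum fun i _ => ?_
    rw [abs_mul]
    exact mul_le_mul_of_nonneg_right (he i) (abs_nonneg _)
  have h3 : |(if a = b then (1 / (n:ℝ)) else 0)| ≤ 1 := by
    have hn1 : (1:ℝ) ≤ n := by exact_mod_cast hn
    split_ifs
    · rw [abs_of_nonneg (by positivity)]
      exact (div_le_one (by linarith)).2 hn1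
    · simp
  rw [tfSym]
  refine (abs_sub _ _).trans ?_
  rw [abs_mul, abs_mul, abs_of_pos (by norm_num : (0:ℝ) < 1 / 2)]
  have h4 := (abs_add_le (e b * d a) (e a * d b)).trans (add_le_add (h1 a b) (h1 b a))
  have h5 := mul_le_mul h3 h2 (abs_nonneg _) zero_le_one
  linarith

lemma exists_cutoff (n : ℕ) : ∃ η : ccSmooth n, (∀ y ∈ closedBall (0 : Euc n) 1,
    (η : Euc n → ℝ) =ᶠ[nhds y] fun _ => 1) ∧ ∀ y ∉ closedBall (0 : Euc n) 2,
    (η : Euc n → ℝ) =ᶠ[nhds y] fun _ => 0 := by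
  let f : ContDiffBump (0 : Euc n) := ⟨3 / 2, 2, by norm_num, by norm_num⟩
  refine ⟨⟨f, f.contDiff, f.hasCompactSupport⟩, fun y hy => ?_, fun y hy => ?_⟩
  · filter_upwards [isOpen_ball.mem_nhds (show y ∈ ball (0 : Euc n) (3 / 2) from
      closedBall_subset_ball (by norm_num) hy)] with z hz
    exact f.one_of_mem_closedBall (ball_subset_closedBall hz)
  · filter_upwards [isClosed_closedBall.isOpen_compl.mem_nhds hy] with z hz
    exact f.zero_of_le_dist (le_of_lt (not_le.1 hz))

/-- The cut-off difference between a field and a quadratic field. -/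
def cutDiff (η : ccSmooth n) (v : Fin n → ccSmooth n) (a : Fin n → ℝ) (Q : AffCoef n) (i : Fin n) :
    ccSmooth n :=
  ccMul (fun y => (v i : Euc n → ℝ) y - quadField a Q y i)
    ((ccSmooth_contDiff (v i)).sub (contDiff_quadField a Q i)) η

lemma pdi_cutDiff (η : ccSmooth n) (v : Fin n → ccSmooth n) (a : Fin n → ℝ) {Q : AffCoef n}
    (hQ : ∀ i j k, Q.2 i j k = Q.2 i k j) (i k : Fin n) (y : Euc n) :
    (pdi k (cutDiff η v a Q i) : Euc n → ℝ) y =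
      (pdi k η : Euc n → ℝ) y * ((v i : Euc n → ℝ) y - quadField a Q y i) +
      (η : Euc n → ℝ) y * ((pdi k (v i) : Euc n → ℝ) y - affMat Q y i k) := by
  have hd1 := ccSmooth_differentiable (v i) y
  have hd2 : DifferentiableAt ℝ (fun y : Euc n => quadField a Q y i) y :=
    (contDiff_quadField a Q i).differentiable (by simp) y
  have h := ((hd1.hasFDerivAt.sub hd2.hasFDerivAt).mul (ccSmooth_differentiable η y).hasFDerivAt)
  have e : (pdi k (cutDiff η v a Q i) : Euc n → ℝ) y = _ :=
    congrArg (fun L : Euc n →L[ℝ] ℝ => L (EuclideanSpace.single k 1)) h.fderiv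
  rw [e]
  simp only [_root_.add_apply, _root_.smul_apply, _root_.sub_apply, smul_eq_mul,
    fderiv_quadField a hQ, Pi.sub_apply]
  simp only [pdi, pd_apply]
  ring

lemma lc_cutDiff (η : ccSmooth n) (v : Fin n → ccSmooth n) (a : Fin n → ℝ) {Q : AffCoef n}
    (hQ : Q ∈ killingCoef n) (i j : Fin n) (y : Euc n) :
    (lc (cutDiff η v a Q) i j : Euc n → ℝ) y =
      tfSym (fun i j => (pdi j η : Euc n → ℝ) y * ((v i : Euc n → ℝ) y - quadField a Q y i)) i j +
      (η : Euc n → ℝ) y * (lc v i j : Euc n → ℝ) y := by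
  have h := tfSym_affMat hQ y i j
  rw [lc_apply, lc_apply]
  simp only [pdi_cutDiff η v a (mem_killingCoef_iff.1 hQ).2.2]
  have e : tfSym (fun i j => (pdi j η : Euc n → ℝ) y * ((v i : Euc n → ℝ) y - quadField a Q y i) +
      (η : Euc n → ℝ) y * ((pdi j (v i) : Euc n → ℝ) y - affMat Q y i j)) i j =
      tfSym (fun i j => (pdi j η : Euc n → ℝ) y * ((v i : Euc n → ℝ) y - quadField a Q y i)) i j +
      (η : Euc n → ℝ) y * (tfSym (fun i j => (pdi j (v i) : Euc n → ℝ) y) i j -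
        tfSym (affMat Q y) i j) := by
    simp only [tfSym, Finset.sum_add_distrib, ← Finset.mul_sum, Finset.sum_sub_distrib]
    ring
  rw [e, h, sub_zero]

lemma exists_cutDiff_bound (hn : 0 < n) {η : ccSmooth n} (h0 : ∀ y ∉ closedBall (0 : Euc n) 2,
    (η : Euc n → ℝ) =ᶠ[nhds y] fun _ => 0) : ∃ K : ℝ, 0 ≤ K ∧ ∀ (v : Fin n → ccSmooth n)
    (a : Fin n → ℝ), ∀ Q ∈ killingCoef n, ∀ i j y, ‖(lc (cutDiff η v a Q) i j : Euc n → ℝ) y‖ₑ ≤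
      (closedBall 0 2).indicator (fun y => ENNReal.ofReal K * (ENNReal.ofReal (lcSum v y) +
        ∑ i, ‖(v i : Euc n → ℝ) y - quadField a Q y i‖ₑ)) y := by
  obtain ⟨K, hK0, hK⟩ := ccSmooth_bounded η
  choose K' hK0' hK' using fun i => ccSmooth_bounded (pdi i η)
  have hs : 0 ≤ ∑ i, K' i := Finset.sum_nonneg fun i _ => hK0' i
  refine ⟨K + 2 * ∑ i, K' i, by positivity, fun v a Q hQ i j y => ?_⟩
  rw [lc_cutDiff η v a hQ]
  by_cases hy : y ∈ closedBall (0 : Euc n) 2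
  · rw [indicator_of_mem hy]
    simp only [Real.enorm_eq_ofReal_abs]
    rw [← ENNReal.ofReal_sum_of_nonneg fun _ _ => abs_nonneg _,
      ← ENNReal.ofReal_add (lcSum_nonneg v y) (Finset.sum_nonneg fun _ _ => abs_nonneg _),
      ← ENNReal.ofReal_mul (by positivity)]
    refine ENNReal.ofReal_le_ofReal ((abs_add_le _ _).trans ?_)
    have h1 := abs_tfSym_mul_le (K := ∑ i, K' i)
      (d := fun i => (v i : Euc n → ℝ) y - quadField a Q y i) (fun i => (hK' i y).trans
      (Finset.single_le_sum (fun i _ => hK0' i) (Finset.mem_univ i))) hn i j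
    have h2 : |(η : Euc n → ℝ) y * (lc v i j : Euc n → ℝ) y| ≤ K * lcSum v y := by
      rw [abs_mul]
      exact mul_le_mul (hK y) (abs_lc_le_lcSum v i j y) (abs_nonneg _) hK0
    have h3 : 0 ≤ (2 * ∑ i, K' i) * lcSum v y := mul_nonneg (by positivity) (lcSum_nonneg v y)
    have h4 : 0 ≤ K * ∑ i, |(v i : Euc n → ℝ) y - quadField a Q y i| :=
      mul_nonneg hK0 (Finset.sum_nonneg fun _ _ => abs_nonneg _)
    linarith
  · rw [indicator_of_notMem hy]
    have e1 : (η : Euc n → ℝ) y = 0 := (h0 y hy).eq_of_nhds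
    have e2 : ∀ j, (pdi j η : Euc n → ℝ) y = 0 := fun j => by
      rw [pdi, pd_apply, (h0 y hy).fderiv_eq]
      simp
    simp [e1, e2, tfSym]

lemma exists_killing_approx_lp (hn : 3 ≤ n) {p q : ℝ} (hpq : p.HolderConjugate q) :
    ∃ C : ℝ≥0∞, C ≠ ⊤ ∧ ∀ v : Fin n → ccSmooth n,
    ∃ Q ∈ killingCoef n, ∃ a : Fin n → ℝ, ∀ i,
      ∫⁻ x in closedBall (0 : Euc n) 2, ‖(v i : Euc n → ℝ) x - quadField a Q x i‖ₑ ^ p ≤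
        C * ∫⁻ x in closedBall (0 : Euc n) 2, ENNReal.ofReal (lcSum v x) ^ p := by
  obtain ⟨C, hC, h⟩ := exists_killing_approx hn
  have hp0 : 0 ≤ p := hpq.pos.le
  have hq0 : 0 ≤ p / q := div_nonneg hpq.pos.le hpq.symm.pos.le
  set V₁ := volume (closedBall (0 : Euc n) 1) with hV₁
  set V₂ := volume (closedBall (0 : Euc n) 2) with hV₂
  have hV₁f : V₁ ≠ ⊤ := measure_closedBall_lt_top.ne
  have hV₂f : V₂ ≠ ⊤ := measure_closedBall_lt_top.ne
  have hVp : V₁ ^ (p / q) ≠ ⊤ := ENNReal.rpow_ne_top_of_nonneg hq0 hV₁f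
  refine ⟨C ^ p * 2 ^ (p - 1) * (V₁ ^ (p / q) * ((V₂ + V₁) * 2 ^ n) + V₁ ^ (p / q) * V₂), ?_,
    fun v => ?_⟩
  · refine ENNReal.mul_ne_top (ENNReal.mul_ne_top (ENNReal.rpow_ne_top_of_nonneg hp0 hC)
      (ENNReal.rpow_ne_top_of_nonneg hpq.sub_one_pos.le (by simp))) ?_
    exact ENNReal.add_ne_top.2 ⟨ENNReal.mul_ne_top hVp (ENNReal.mul_ne_top
      (ENNReal.add_ne_top.2 ⟨hV₂f, hV₁f⟩) (by simp)), ENNReal.mul_ne_top hVp hV₂f⟩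
  obtain ⟨Q, hQ, a, ha⟩ := h v
  refine ⟨Q, hQ, a, fun i => ?_⟩
  set G : Euc n → ℝ≥0∞ := fun x => ENNReal.ofReal (lcSum v x) with hG
  have hGm : Measurable G := (lcSum_continuous v).measurable.ennreal_ofReal
  set Z := ∫⁻ x in closedBall (0 : Euc n) 2, G x ^ p with hZ
  have hball : ∀ f : Euc n → ℝ≥0∞, Measurable f →
      (∫⁻ y in closedBall (0 : Euc n) 1, f y) ^ p ≤
        V₁ ^ (p / q) * ∫⁻ y in closedBall (0 : Euc n) 1, f y ^ p := fun f hf => by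
    have := rpow_lintegral_le (volume.restrict (closedBall (0 : Euc n) 1)) hpq hf.aemeasurable
    rwa [Measure.restrict_apply_univ] at this
  have hseg : ∀ x : Euc n, (∫⁻ t in Ioc (0:ℝ) 1, ∫⁻ y in closedBall (0 : Euc n) 1,
      G (y + t • (x - y))) ^ p ≤ V₁ ^ (p / q) * ∫⁻ t in Ioc (0:ℝ) 1,
        ∫⁻ y in closedBall (0 : Euc n) 1, G (y + t • (x - y)) ^ p := by
    intro x
    have hm : Measurable fun t : ℝ => ∫⁻ y in closedBall (0 : Euc n) 1, G (y + t • (x - y)) :=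
      Measurable.lintegral_prod_right' (f := fun z : ℝ × Euc n => G (z.2 + z.1 • (x - z.2)))
        (hGm.comp (by fun_prop))
    have := rpow_lintegral_le (volume.restrict (Ioc (0:ℝ) 1)) hpq hm.aemeasurable
    rw [Measure.restrict_apply_univ, Real.volume_Ioc, sub_zero, ENNReal.ofReal_one,
      ENNReal.one_rpow, one_mul] at this
    refine this.trans ?_
    rw [← lintegral_const_mul' _ _ hVp]
    exact lintegral_mono fun t => hball _ (hGm.comp (by fun_prop))
  have hpt : ∀ x ∈ closedBall (0 : Euc n) 2, ‖(v i : Euc n → ℝ) x - quadField a Q x i‖ₑ ^ p ≤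
      C ^ p * 2 ^ (p - 1) * (V₁ ^ (p / q) * (∫⁻ t in Ioc (0:ℝ) 1,
        ∫⁻ y in closedBall (0 : Euc n) 1, G (y + t • (x - y)) ^ p) + V₁ ^ (p / q) * Z) := by
    intro x hx
    refine (ENNReal.rpow_le_rpow (ha i x hx) hp0).trans ?_
    rw [ENNReal.mul_rpow_of_nonneg _ _ hp0, mul_assoc]
    refine mul_le_mul_right ((ENNReal.rpow_add_le_mul_rpow_add_rpow _ _ hpq.lt.le).trans ?_) _
    refine mul_le_mul_right (add_le_add (hseg x) ((hball G hGm).trans ?_)) _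
    exact mul_le_mul_right (lintegral_mono_set (closedBall_subset_closedBall (by norm_num))) _
  refine (setLIntegral_mono' measurableSet_closedBall hpt).trans ?_
  have hm3 : Measurable fun q : (Euc n × ℝ) × Euc n => G (q.2 + q.1.2 • (q.1.1 - q.2)) ^ p :=
    (hGm.pow_const p).comp (by fun_prop)
  have hm2 : Measurable fun x : Euc n => ∫⁻ t in Ioc (0:ℝ) 1,
      ∫⁻ y in closedBall (0 : Euc n) 1, G (y + t • (x - y)) ^ p :=
    Measurable.lintegral_prod_right' (f := fun z : Euc n × ℝ =>
      ∫⁻ y in closedBall (0 : Euc n) 1, G (y + z.2 • (z.1 - y)) ^ p) hm3.lintegral_prod_right'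
  have hm2' := hm2.const_mul (V₁ ^ (p / q))
  rw [lintegral_const_mul _ (hm2'.add_const _), lintegral_add_left hm2',
    lintegral_const_mul _ hm2, setLIntegral_const, mul_assoc (C ^ p * 2 ^ (p - 1)), add_mul]
  refine mul_le_mul_right (add_le_add ?_ (le_of_eq ?_)) _
  · rw [mul_assoc]
    exact mul_le_mul_right (lintegral_segment_le (g := fun z => G z ^ p) (hGm.pow_const p)) _
  · ring

end LocalSmoothKorn

section LocalSmoothKorn

variable {n : ℕ}

lemma ENNReal.rpow_add_sum_le (n : ℕ) {p : ℝ} (hp : 1 ≤ p) : ∃ K : ℝ≥0∞, K ≠ ⊤ ∧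
    ∀ (a : ℝ≥0∞) (d : Fin n → ℝ≥0∞), (a + ∑ i, d i) ^ p ≤ K * (a ^ p + ∑ i, d i ^ p) := by
  refine ⟨2 ^ (p - 1) * (1 + (n:ℝ≥0∞) ^ (p - 1)), ENNReal.mul_ne_top
    (ENNReal.rpow_ne_top_of_nonneg (by linarith) (by simp)) (ENNReal.add_ne_top.2 ⟨by simp,
    ENNReal.rpow_ne_top_of_nonneg (by linarith) (by simp)⟩), fun a d => ?_⟩
  refine (ENNReal.rpow_add_le_mul_rpow_add_rpow _ _ hp).trans ?_
  rw [mul_assoc]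
  refine mul_le_mul_right ?_ _
  have h := ENNReal.rpow_sum_le_const_mul_sum_rpow (s := (Finset.univ : Finset (Fin n))) (f := d) hp
  rw [Finset.card_univ, Fintype.card_fin] at h
  rw [add_mul, one_mul, mul_add]
  refine add_le_add (le_self_add) (h.trans le_add_self)

theorem exists_local_smooth_korn (hn : 3 ≤ n) {p q : ℝ} (hpq : p.HolderConjugate q) :
    ∃ C : ℝ≥0∞, C ≠ ⊤ ∧ ∀ v : Fin n → ccSmooth n, ∃ Q ∈ killingCoef n, ∀ i k,
      ∫⁻ x in closedBall (0 : Euc n) 1, ‖(pdi k (v i) : Euc n → ℝ) x - affMat Q x i k‖ₑ ^ p ≤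
        C * ∫⁻ x in closedBall (0 : Euc n) 2, ENNReal.ofReal (lcSum v x) ^ p := by
  obtain ⟨η, h1, h0⟩ := exists_cutoff n
  obtain ⟨K, hK0, hK⟩ := exists_cutDiff_bound (by omega) h0
  obtain ⟨C₁, hC₁0, hC₁⟩ := exists_smooth_korn hpq (by omega : 2 ≤ n)
  obtain ⟨C₂, hC₂, h₂⟩ := exists_killing_approx_lp hn hpq
  obtain ⟨K₃, hK₃, h₃⟩ := ENNReal.rpow_add_sum_le n hpq.lt.le
  have hp0 : 0 ≤ p := hpq.pos.le
  refine ⟨ENNReal.ofReal C₁ * (∑ a : Fin n, ∑ b : Fin n,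
    ENNReal.ofReal K ^ p * (K₃ * (1 + ∑ i : Fin n, C₂))), ?_, fun v => ?_⟩
  · refine ENNReal.mul_ne_top (by simp) (ENNReal.sum_ne_top.2 fun a _ => ENNReal.sum_ne_top.2
      fun b _ => ENNReal.mul_ne_top (ENNReal.rpow_ne_top_of_nonneg hp0 (by simp))
      (ENNReal.mul_ne_top hK₃ (ENNReal.add_ne_top.2 ⟨by simp, ENNReal.sum_ne_top.2
      fun i _ => hC₂⟩)))
  obtain ⟨Q, hQ, a, ha⟩ := h₂ v
  refine ⟨Q, hQ, fun i k => ?_⟩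
  set Z := ∫⁻ x in closedBall (0 : Euc n) 2, ENNReal.ofReal (lcSum v x) ^ p with hZ
  have hs := (mem_killingCoef_iff.1 hQ).2.2
  have hL : ∫⁻ x in closedBall (0 : Euc n) 1, ‖(pdi k (v i) : Euc n → ℝ) x - affMat Q x i k‖ₑ ^ p ≤
      ∫⁻ x, ‖(pdi k (cutDiff η v a Q i) : Euc n → ℝ) x‖ₑ ^ p := by
    refine le_trans (le_of_eq (setLIntegral_congr_fun measurableSet_closedBall fun x hx => ?_))
      (setLIntegral_le_lintegral (closedBall (0 : Euc n) 1) _)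
    have e1 : (η : Euc n → ℝ) x = 1 := (h1 x hx).eq_of_nhds
    have e2 : (pdi k η : Euc n → ℝ) x = 0 := by
      rw [pdi, pd_apply, (h1 x hx).fderiv_eq]
      simp
    simp only [pdi_cutDiff η v a hs, e1, e2, zero_mul, zero_add, one_mul]
  refine hL.trans ?_
  rw [← ofReal_integral_abs_rpow _ hpq.pos]
  refine (ENNReal.ofReal_le_ofReal (hC₁ (cutDiff η v a Q) i k)).trans ?_
  rw [ENNReal.ofReal_mul hC₁0.le, mul_assoc]
  refine mul_le_mul_right ?_ _
  have hi : ∀ a' b', 0 ≤ ∫ x, |(lc (cutDiff η v a Q) a' b' : Euc n → ℝ) x| ^ p := fun _ _ =>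
    integral_nonneg fun x => by positivity
  rw [ENNReal.ofReal_sum_of_nonneg fun _ _ => Finset.sum_nonneg fun _ _ => hi _ _, Finset.sum_mul]
  refine Finset.sum_le_sum fun a' _ => ?_
  rw [ENNReal.ofReal_sum_of_nonneg fun _ _ => hi _ _, Finset.sum_mul]
  refine Finset.sum_le_sum fun b' _ => ?_
  rw [ofReal_integral_abs_rpow _ hpq.pos]
  have hm1 : Measurable fun y : Euc n => ENNReal.ofReal (lcSum v y) :=
    (lcSum_continuous v).measurable.ennreal_ofReal
  have hm2 : ∀ i, Measurable fun y : Euc n => ‖(v i : Euc n → ℝ) y - quadField a Q y i‖ₑ :=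
    fun i => ((ccSmooth_contDiff (v i)).continuous.sub
      (contDiff_quadField a Q i).continuous).measurable.enorm
  have hb : ∀ y : Euc n, ‖(lc (cutDiff η v a Q) a' b' : Euc n → ℝ) y‖ₑ ^ p ≤
      (closedBall (0 : Euc n) 2).indicator (fun y => ENNReal.ofReal K ^ p * (K₃ *
        (ENNReal.ofReal (lcSum v y) ^ p +
        ∑ i, ‖(v i : Euc n → ℝ) y - quadField a Q y i‖ₑ ^ p))) y := fun y => by
    refine (ENNReal.rpow_le_rpow (hK v a Q hQ a' b' y) hp0).trans ?_
    by_cases hy : y ∈ closedBall (0 : Euc n) 2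
    · rw [indicator_of_mem hy, indicator_of_mem hy, ENNReal.mul_rpow_of_nonneg _ _ hp0]
      exact mul_le_mul_right (h₃ _ _) _
    · rw [indicator_of_notMem hy, indicator_of_notMem hy, ENNReal.zero_rpow_of_pos hpq.pos]
  refine (lintegral_mono hb).trans ?_
  rw [lintegral_indicator measurableSet_closedBall]
  have hm3 : Measurable fun y : Euc n => ∑ i, ‖(v i : Euc n → ℝ) y - quadField a Q y i‖ₑ ^ p :=
    Finset.measurable_sum _ fun i _ => (hm2 i).pow_const p
  have hm4 : Measurable fun y : Euc n => ENNReal.ofReal (lcSum v y) ^ p +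
      ∑ i, ‖(v i : Euc n → ℝ) y - quadField a Q y i‖ₑ ^ p := (hm1.pow_const p).add hm3
  rw [lintegral_const_mul _ (hm4.const_mul _), lintegral_const_mul _ hm4, lintegral_add_left (hm1.pow_const p),
    lintegral_finsetSum _ fun i _ => (hm2 i).pow_const p, mul_assoc, mul_assoc]
  refine mul_le_mul_right (mul_le_mul_right ?_ _) _
  rw [add_mul, one_mul, Finset.sum_mul]
  exact add_le_add le_rfl (Finset.sum_le_sum fun i _ => ha i)

end LocalSmoothKorn

section AffineBound

variable {n : ℕ}

lemma enorm_rpow_mul_volume_le {f : Euc n → ℝ} {c : Euc n} (r : ℝ) {p : ℝ} (hp : 0 ≤ p)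
    (hf : Continuous f) (h : ∀ y, f y + f (c + c - y) = 2 * f c) :
    ‖f c‖ₑ ^ p * volume (ball c r) ≤ 2 * ∫⁻ y in ball c r, ‖f y‖ₑ ^ p := by
  have hm : Measurable fun y => ‖f y‖ₑ ^ p := hf.measurable.enorm.pow_const p
  have h1 : ∀ y, ‖f c‖ₑ ^ p ≤ ‖f y‖ₑ ^ p + ‖f (c + c - y)‖ₑ ^ p := fun y => by
    rcases le_total |f c| |f y| with hy | hy
    · refine le_trans (ENNReal.rpow_le_rpow ?_ hp) le_self_add
      simpa [Real.enorm_eq_ofReal_abs] using ENNReal.ofReal_le_ofReal hy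
    · refine le_trans (ENNReal.rpow_le_rpow ?_ hp) le_add_self
      rw [Real.enorm_eq_ofReal_abs, Real.enorm_eq_ofReal_abs]
      refine ENNReal.ofReal_le_ofReal ?_
      have e : f c - f y + f c = f (c + c - y) := by linarith [h y]
      have h2 : |f c + f c| ≤ |f c + f c - f y| + |f y| := by
        simpa using abs_add_le (f c + f c - f y) (f y)
      rw [show f c + f c - f y = f (c + c - y) by linarith] at h2
      rw [show f c + f c = 2 * f c by ring, abs_mul, abs_two] at h2
      linarith
  have h2 : ∫⁻ y in ball c r, ‖f (c + c - y)‖ₑ ^ p = ∫⁻ y in ball c r, ‖f y‖ₑ ^ p := by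
    have hmp := Measure.measurePreserving_sub_left (volume : Measure (Euc n)) (c + c)
    rw [← hmp.setLIntegral_comp_preimage measurableSet_ball hm]
    congr 2
    ext y
    simp only [mem_preimage, mem_ball, dist_eq_norm]
    rw [show c + c - y - c = -(y - c) by abel, norm_neg]
  rw [← setLIntegral_const]
  refine (lintegral_mono h1).trans ?_
  rw [lintegral_add_left hm, h2, two_mul]

lemma affMat_reflect (Q : AffCoef n) (c y : Euc n) (i j : Fin n) :
    affMat Q y i j + affMat Q (c + c - y) i j = 2 * affMat Q c i j := by
  simp only [affMat, PiLp.sub_apply, PiLp.add_apply]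
  have : ∑ k, Q.2 i j k * (c k + c k - y k) =
      2 * ∑ k, Q.2 i j k * c k - ∑ k, Q.2 i j k * y k := by
    rw [Finset.mul_sum, ← Finset.sum_sub_distrib]
    exact Finset.sum_congr rfl fun k _ => by ring
  rw [this]
  ring

lemma continuous_affMat (Q : AffCoef n) (i j : Fin n) : Continuous fun x : Euc n => affMat Q x i j := by
  unfold affMat
  fun_prop

lemma affMat_sub (Q : AffCoef n) (x z : Euc n) (i j : Fin n) :
    affMat Q z i j = affMat Q x i j + ∑ k, Q.2 i j k * (z k - x k) := by
  simp only [affMat, mul_sub, Finset.sum_sub_distrib]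
  ring

lemma abs_affMat_le (Q : AffCoef n) (x z : Euc n) {r : ℝ} (hr : 0 < r) (i j : Fin n) :
    |affMat Q z i j| ≤ (1 + 4 * n) * (1 + dist z x / r) * (|affMat Q x i j| +
      ∑ k, |affMat Q (x + EuclideanSpace.single k (r / 2)) i j|) := by
  set S := |affMat Q x i j| + ∑ k, |affMat Q (x + EuclideanSpace.single k (r / 2)) i j| with hS
  have hd : 0 ≤ dist z x / r := div_nonneg dist_nonneg hr.le
  have hS0 : |affMat Q x i j| ≤ S := le_add_of_nonneg_right (Finset.sum_nonneg fun _ _ => abs_nonneg _)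
  have hS1 : ∀ k, |affMat Q (x + EuclideanSpace.single k (r / 2)) i j| ≤ S := fun k =>
    (Finset.single_le_sum (f := fun k => |affMat Q (x + EuclideanSpace.single k (r / 2)) i j|)
      (fun _ _ => abs_nonneg _) (Finset.mem_univ k)).trans (le_add_of_nonneg_left (abs_nonneg _))
  have hS00 : 0 ≤ S := (abs_nonneg _).trans hS0
  have hb : ∀ k, |Q.2 i j k| ≤ 4 / r * S := fun k => by
    have e := affMat_sub Q x (x + EuclideanSpace.single k (r / 2)) i j
    have e2 : ∑ l, Q.2 i j l * ((x + EuclideanSpace.single k (r / 2) : Euc n) l - x l) =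
        Q.2 i j k * (r / 2) := by
      rw [Finset.sum_eq_single k]
      · simp
      · intro l _ hl
        simp [hl]
      · simp
    rw [e2] at e
    have e3 : Q.2 i j k = 2 / r * (affMat Q (x + EuclideanSpace.single k (r / 2)) i j - affMat Q x i j) := by
      rw [e]; field_simp; ring
    rw [e3, abs_mul, abs_of_pos (by positivity : 0 < 2 / r)]
    have h1 := (abs_sub (affMat Q (x + EuclideanSpace.single k (r / 2)) i j) (affMat Q x i j)).trans
      (add_le_add (hS1 k) hS0)
    calc _ ≤ 2 / r * (S + S) := mul_le_mul_of_nonneg_left h1 (by positivity)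
      _ = _ := by ring
  have h2 : |∑ k, Q.2 i j k * (z k - x k)| ≤ ∑ k : Fin n, 4 / r * S * dist z x := by
    refine (Finset.abs_sum_le_sum_abs _ _).trans (Finset.sum_le_sum fun k _ => ?_)
    rw [abs_mul]
    refine mul_le_mul (hb k) ?_ (abs_nonneg _) (by positivity)
    have := PiLp.norm_apply_le (z - x) k
    rwa [PiLp.sub_apply, Real.norm_eq_abs, ← dist_eq_norm] at this
  rw [Finset.sum_const, Finset.card_univ, Fintype.card_fin, nsmul_eq_mul] at h2
  rw [affMat_sub Q x z]
  refine (abs_add_le _ _).trans ((add_le_add hS0 h2).trans ?_)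
  have e : (n:ℝ) * (4 / r * S * dist z x) = (dist z x / r) * (4 * n) * S := by ring
  rw [e]
  have h3 : 0 ≤ (dist z x / r) * S := mul_nonneg hd hS00
  have h4 : 0 ≤ (n:ℝ) * S := by positivity
  linarith only [h3, h4, show (1 + 4 * (n:ℝ)) * (1 + dist z x / r) * S = S + 4 * (n * S) + dist z x / r * S + dist z x / r * (4 * n) * S by ring]

theorem exists_affMat_bound (n : ℕ) {p : ℝ} (hp : 1 ≤ p) : ∃ K : ℝ≥0∞, K ≠ ⊤ ∧
    ∀ (Q : AffCoef n) (i j : Fin n) (x z : Euc n) (r : ℝ), 0 < r →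
      ‖affMat Q z i j‖ₑ ^ p * ENNReal.ofReal (r ^ n) ≤
        K * ENNReal.ofReal (1 + dist z x / r) ^ p * ∫⁻ y in ball x r, ‖affMat Q y i j‖ₑ ^ p := by
  have hp0 : 0 ≤ p := by linarith
  obtain ⟨K, hK, h⟩ := ENNReal.rpow_add_sum_le n hp
  set V := volume (ball (0 : Euc n) 1) with hV
  have hV0 : V ≠ 0 := (measure_ball_pos _ _ one_pos).ne'
  have hVf : V ≠ ⊤ := measure_ball_lt_top.ne
  set c : ℝ≥0∞ := ENNReal.ofReal ((1 / 2) ^ n) * V with hc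
  have hc0 : c ≠ 0 := mul_ne_zero (by simp) hV0
  have hcf : c ≠ ⊤ := ENNReal.mul_ne_top (by simp) hVf
  refine ⟨ENNReal.ofReal (1 + 4 * n) ^ p * K * ((1 + n) * (2 * c⁻¹)), ?_, fun Q i j x z r hr => ?_⟩
  · refine ENNReal.mul_ne_top (ENNReal.mul_ne_top (ENNReal.rpow_ne_top_of_nonneg hp0 (by simp)) hK)
      (ENNReal.mul_ne_top (by simp) (ENNReal.mul_ne_top (by simp) (ENNReal.inv_ne_top.2 hc0)))
  set I := ∫⁻ y in ball x r, ‖affMat Q y i j‖ₑ ^ p with hI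
  have h1 : ∀ u : Euc n, dist u x ≤ r / 2 →
      ‖affMat Q u i j‖ₑ ^ p * ENNReal.ofReal (r ^ n) ≤ 2 * c⁻¹ * I := fun u hu => by
    have h2 := enorm_rpow_mul_volume_le (f := fun y => affMat Q y i j) (c := u) (r / 2) hp0
      (continuous_affMat Q i j) (fun y => affMat_reflect Q u y i j)
    rw [Measure.addHaar_ball_of_pos _ _ (by positivity), finrank_euclideanSpace, Fintype.card_fin] at h2
    have h3 : ∫⁻ y in ball u (r / 2), ‖affMat Q y i j‖ₑ ^ p ≤ I :=
      lintegral_mono_set (ball_subset_ball' (by linarith))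
    have e : ENNReal.ofReal ((r / 2) ^ n) * V = c * ENNReal.ofReal (r ^ n) := by
      rw [hc, mul_right_comm, ← ENNReal.ofReal_mul (by positivity), ← mul_pow]
      congr 3; ring
    rw [e] at h2
    have h4 := mul_le_mul_right (h2.trans (mul_le_mul_right h3 2)) c⁻¹
    calc ‖affMat Q u i j‖ₑ ^ p * ENNReal.ofReal (r ^ n) =
        (c⁻¹ * c) * (‖affMat Q u i j‖ₑ ^ p * ENNReal.ofReal (r ^ n)) := by
          rw [ENNReal.inv_mul_cancel hc0 hcf, one_mul]
      _ = c⁻¹ * (‖affMat Q u i j‖ₑ ^ p * (c * ENNReal.ofReal (r ^ n))) := by ring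
      _ ≤ c⁻¹ * (2 * I) := h4
      _ = _ := by ring
  have h5 := abs_affMat_le Q x z hr i j
  have h6 : ‖affMat Q z i j‖ₑ ≤ ENNReal.ofReal (1 + 4 * n) * ENNReal.ofReal (1 + dist z x / r) *
      (‖affMat Q x i j‖ₑ + ∑ k, ‖affMat Q (x + EuclideanSpace.single k (r / 2)) i j‖ₑ) := by
    simp only [Real.enorm_eq_ofReal_abs]
    rw [← ENNReal.ofReal_sum_of_nonneg fun _ _ => abs_nonneg _,
      ← ENNReal.ofReal_add (abs_nonneg _) (Finset.sum_nonneg fun _ _ => abs_nonneg _),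
      ← ENNReal.ofReal_mul (by positivity), ← ENNReal.ofReal_mul (by positivity)]
    exact ENNReal.ofReal_le_ofReal h5
  have h7 := (ENNReal.rpow_le_rpow h6 hp0)
  rw [ENNReal.mul_rpow_of_nonneg _ _ hp0, ENNReal.mul_rpow_of_nonneg _ _ hp0] at h7
  set A := ENNReal.ofReal (1 + 4 * n) ^ p
  set B := ENNReal.ofReal (1 + dist z x / r) ^ p
  have h8 : (‖affMat Q x i j‖ₑ + ∑ k, ‖affMat Q (x + EuclideanSpace.single k (r / 2)) i j‖ₑ) ^ p *
      ENNReal.ofReal (r ^ n) ≤ K * ((1 + n) * (2 * c⁻¹ * I)) := by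
    refine (mul_le_mul_left (h _ _) _).trans ?_
    rw [mul_assoc]
    refine mul_le_mul_right ?_ _
    rw [add_mul, Finset.sum_mul, add_mul, one_mul]
    refine add_le_add (h1 x (by simpa using (by positivity : 0 ≤ r / 2))) ?_
    refine (Finset.sum_le_sum fun k _ => h1 _ ?_).trans (le_of_eq ?_)
    · rw [dist_eq_norm, add_sub_cancel_left, PiLp.norm_single, Real.norm_eq_abs,
        abs_of_pos (by positivity)]
    · rw [Finset.sum_const, Finset.card_univ, Fintype.card_fin, nsmul_eq_mul]
  calc _ ≤ A * B * (_) ^ p * ENNReal.ofReal (r ^ n) := mul_le_mul_left h7 _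
    _ = A * B * ((_) ^ p * ENNReal.ofReal (r ^ n)) := mul_assoc _ _ _
    _ ≤ A * B * (K * ((1 + n) * (2 * c⁻¹ * I))) := mul_le_mul_right h8 _
    _ = _ := by ring

end AffineBound

section Mollification

variable {n : ℕ}

/-- Mollification of a continuous compactly supported function. -/
def mollify (φ : ContDiffBump (0 : Euc n)) (u : Euc n → ℝ) (hu : Continuous u)
    (hc : HasCompactSupport u) : ccSmooth n :=
  ⟨MeasureTheory.convolution u (φ.normed volume) (ContinuousLinearMap.mul ℝ ℝ) volume,
    φ.hasCompactSupport_normed.contDiff_convolution_right _ hu.locallyIntegrable φ.contDiff_normed,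
    hc.convolution _ φ.hasCompactSupport_normed⟩

lemma pdi_mollify (φ : ContDiffBump (0 : Euc n)) {u : Euc n → ℝ} (hd : Differentiable ℝ u)
    (hc : HasCompactSupport u) (k : Fin n)
    (hi : Integrable fun y => fderiv ℝ u y (EuclideanSpace.single k 1)) (x : Euc n) :
    (pdi k (mollify φ u hd.continuous hc) : Euc n → ℝ) x =
      ∫ t, φ.normed volume t * fderiv ℝ u (x - t) (EuclideanSpace.single k 1) := by
  set e : Euc n := EuclideanSpace.single k 1 with he
  have hN : ContDiff ℝ 1 (φ.normed (volume : Measure (Euc n))) := φ.contDiff_normed (n := 1)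
  have h := φ.hasCompactSupport_normed.hasFDerivAt_convolution_right
    (ContinuousLinearMap.mul ℝ ℝ) (f := u) (μ := volume) hd.continuous.locallyIntegrable hN x
  have h1 : (pdi k (mollify φ u hd.continuous hc) : Euc n → ℝ) x =
      ∫ t, u t * fderiv ℝ (φ.normed volume) (x - t) e := by
    have e1 : (pdi k (mollify φ u hd.continuous hc) : Euc n → ℝ) x = _ :=
      congrArg (fun L : Euc n →L[ℝ] ℝ => L e) h.fderiv
    rw [e1, convolution_precompR_apply _ hd.continuous.locallyIntegrable
      (φ.hasCompactSupport_normed.fderiv ℝ) (hN.continuous_fderiv one_ne_zero)]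
    rfl
  set g : Euc n → ℝ := fun t => φ.normed volume (x - t) with hg
  have hg1 : ∀ t, HasFDerivAt g (-(fderiv ℝ (φ.normed volume) (x - t))) t := fun t => by
    have h2 := ((hN.differentiable one_ne_zero) (x - t)).hasFDerivAt.comp t
      ((hasFDerivAt_id t).const_sub x)
    refine h2.congr_fderiv ?_
    ext y; simp
  have hgc : Continuous g := hN.continuous.comp (continuous_const.sub continuous_id)
  have hge : (fun t => fderiv ℝ g t e) = fun t => -(fderiv ℝ (φ.normed volume) (x - t) e) := by
    funext t; rw [(hg1 t).fderiv]; rfl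
  have hge' : Continuous fun t => fderiv ℝ g t e := by
    rw [hge]
    exact (((hN.continuous_fderiv one_ne_zero).comp
      (continuous_const.sub continuous_id)).clm_apply continuous_const).neg
  obtain ⟨K, hK⟩ := φ.hasCompactSupport_normed.exists_bound_of_continuous hN.continuous
  have hibp := integral_mul_fderiv_eq_neg_fderiv_mul_of_integrable (μ := volume) (f := u) (g := g) (v := e)
    (hi.mul_bdd (c := K) hgc.aestronglyMeasurable (Filter.Eventually.of_forall fun t => hK _))
    ((hd.continuous.mul hge').integrable_of_hasCompactSupport hc.mul_right)
    ((hd.continuous.mul hgc).integrable_of_hasCompactSupport hc.mul_right)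
    (fun t _ => hd t) (fun t _ => (hg1 t).differentiableAt)
  rw [h1, ← integral_sub_left_eq_self (fun t => φ.normed volume t * fderiv ℝ u (x - t) e) volume x]
  have h3 : ∀ t, u t * fderiv ℝ g t e = -(u t * fderiv ℝ (φ.normed volume) (x - t) e) := fun t => by
    rw [show fderiv ℝ g t e = _ from congrFun hge t]; ring
  simp only [h3, integral_neg, neg_inj] at hibp
  rw [hibp]
  exact integral_congr_ae (Filter.Eventually.of_forall fun t => by simp [hg, mul_comm])

lemma lintegral_ofReal_normed (φ : ContDiffBump (0 : Euc n)) :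
    ∫⁻ t, ENNReal.ofReal (φ.normed volume t) = 1 := by
  rw [← ofReal_integral_eq_lintegral_ofReal
    (φ.continuous_normed.integrable_of_hasCompactSupport φ.hasCompactSupport_normed)
    (Filter.Eventually.of_forall fun t => φ.nonneg_normed t), φ.integral_normed, ENNReal.ofReal_one]

lemma lintegral_rpow_average_le (φ : ContDiffBump (0 : Euc n)) (hφ : φ.rOut ≤ 1) {p q : ℝ}
    (hpq : p.HolderConjugate q) {F : Euc n → ℝ≥0∞} (hF : Measurable F) (r : ℝ) :
    ∫⁻ x in closedBall (0 : Euc n) r, (∫⁻ t, ENNReal.ofReal (φ.normed volume t) * F (x - t)) ^ p ≤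
      ∫⁻ x in closedBall (0 : Euc n) (r + 1), F x ^ p := by
  have hN : Measurable fun t : Euc n => ENNReal.ofReal (φ.normed volume t) :=
    φ.continuous_normed.measurable.ennreal_ofReal
  have h1 : ∀ x, (∫⁻ t, ENNReal.ofReal (φ.normed volume t) * F (x - t)) ^ p ≤
      ∫⁻ t, ENNReal.ofReal (φ.normed volume t) * F (x - t) ^ p := fun x => by
    have hm : Measurable fun t => F (x - t) := hF.comp (by fun_prop)
    have h := rpow_lintegral_le (volume.withDensity fun t : Euc n => ENNReal.ofReal (φ.normed volume t))
      hpq hm.aemeasurable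
    rw [withDensity_apply _ MeasurableSet.univ, Measure.restrict_univ, lintegral_ofReal_normed,
      ENNReal.one_rpow, one_mul, lintegral_withDensity_eq_lintegral_mul _ hN hm,
      lintegral_withDensity_eq_lintegral_mul _ hN (hm.pow_const p)] at h
    exact h
  refine (lintegral_mono h1).trans ?_
  have hj : Measurable fun z : Euc n × Euc n => ENNReal.ofReal (φ.normed volume z.2) * F (z.1 - z.2) ^ p :=
    (hN.comp measurable_snd).mul ((hF.comp (by fun_prop)).pow_const p)
  rw [lintegral_lintegral_swap hj.aemeasurable]
  have h2 : ∀ t, ∫⁻ x in closedBall (0 : Euc n) r, ENNReal.ofReal (φ.normed volume t) * F (x - t) ^ p ≤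
      ENNReal.ofReal (φ.normed volume t) * ∫⁻ x in closedBall (0 : Euc n) (r + 1), F x ^ p := fun t => by
    have hm : Measurable fun x => F (x - t) ^ p := (hF.comp (by fun_prop)).pow_const p
    rw [lintegral_const_mul _ hm]
    by_cases ht : t ∈ ball (0 : Euc n) φ.rOut
    · refine mul_le_mul_right ?_ _
      have hmp := measurePreserving_sub_right (volume : Measure (Euc n)) t
      rw [← hmp.setLIntegral_comp_preimage measurableSet_closedBall (hF.pow_const p)]
      refine lintegral_mono_set fun x hx => ?_
      simp only [mem_preimage, mem_closedBall_zero_iff] at hx ⊢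
      have ht' := mem_ball_zero_iff.1 ht
      linarith [norm_sub_le x t]
    · have : φ.normed volume t = 0 := by
        rw [← φ.support_normed_eq (μ := volume)] at ht
        exact Function.notMem_support.1 ht
      simp [this]
  refine (lintegral_mono h2).trans ?_
  rw [lintegral_mul_const _ hN, lintegral_ofReal_normed, one_mul]

lemma enorm_integral_normed_mul_le (φ : ContDiffBump (0 : Euc n)) (f : Euc n → ℝ) :
    ‖∫ t, φ.normed volume t * f t‖ₑ ≤ ∫⁻ t, ENNReal.ofReal (φ.normed volume t) * ‖f t‖ₑ := by
  refine (enorm_integral_le_lintegral_enorm _).trans (le_of_eq (lintegral_congr fun t => ?_))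
  rw [enorm_mul, Real.enorm_eq_ofReal_abs, abs_of_nonneg (φ.nonneg_normed t)]

lemma tfSym_integral {α : Type*} [MeasurableSpace α] {μ : Measure α} {M : α → Fin n → Fin n → ℝ}
    (hM : ∀ i j, Integrable (fun x => M x i j) μ) (a b : Fin n) :
    tfSym (fun i j => ∫ x, M x i j ∂μ) a b = ∫ x, tfSym (M x) a b ∂μ := by
  simp only [tfSym]
  rw [integral_sub, integral_const_mul, integral_const_mul, integral_add (hM _ _) (hM _ _),
    integral_finsetSum _ fun i _ => hM i i]
  · exact ((hM _ _).add (hM _ _)).const_mul _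
  · exact (integrable_finsetSum _ fun i _ => hM i i).const_mul _

lemma tfSym_const_mul (c : ℝ) (M : Fin n → Fin n → ℝ) (a b : Fin n) :
    tfSym (fun i j => c * M i j) a b = c * tfSym M a b := by
  simp only [tfSym, ← Finset.mul_sum]
  ring

end Mollification

section CompactlySupportedKorn

variable {n : ℕ}

lemma integrable_of_lintegral_rpow_lt_top {f : Euc n → ℝ} (hf : Measurable f) {R : ℝ}
    (hs : ∀ x ∉ closedBall (0 : Euc n) R, f x = 0) {p q : ℝ} (hpq : p.HolderConjugate q)
    (h : ∫⁻ x, ‖f x‖ₑ ^ p ≠ ⊤) : Integrable f := by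
  have h1 := rpow_lintegral_le (volume.restrict (closedBall (0 : Euc n) R)) hpq hf.enorm.aemeasurable
  rw [Measure.restrict_apply_univ] at h1
  have h2 : (volume (closedBall (0 : Euc n) R)) ^ (p / q) *
      ∫⁻ x in closedBall (0 : Euc n) R, ‖f x‖ₑ ^ p ≠ ⊤ :=
    ENNReal.mul_ne_top (ENNReal.rpow_ne_top_of_nonneg (div_nonneg hpq.pos.le hpq.symm.pos.le)
      measure_closedBall_lt_top.ne) (ne_top_of_le_ne_top h (setLIntegral_le_lintegral _ _))
  have h3 : ∫⁻ x in closedBall (0 : Euc n) R, ‖f x‖ₑ ≠ ⊤ := fun h4 => by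
    rw [h4, ENNReal.top_rpow_of_pos hpq.pos] at h1
    exact h2 (top_le_iff.1 h1)
  have h5 : IntegrableOn f (closedBall (0 : Euc n) R) :=
    ⟨hf.aestronglyMeasurable, lt_top_iff_ne_top.2 h3⟩
  refine (integrableOn_iff_integrable_of_support_subset fun x hx => ?_).1 h5
  by_contra hx'
  exact hx (hs x hx')

lemma AffCoef.norm_le {Q : AffCoef n} {R : ℝ} (hR : 0 ≤ R) (h1 : ∀ i j, |Q.1 i j| ≤ R)
    (h2 : ∀ i j k, |Q.2 i j k| ≤ R) : ‖Q‖ ≤ R := by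
  refine max_le ?_ ?_
  · exact (pi_norm_le_iff_of_nonneg hR).2 fun i => (pi_norm_le_iff_of_nonneg hR).2 fun j => h1 i j
  · exact (pi_norm_le_iff_of_nonneg hR).2 fun i => (pi_norm_le_iff_of_nonneg hR).2 fun j =>
      (pi_norm_le_iff_of_nonneg hR).2 fun k => h2 i j k

lemma exists_norm_le_of_affMat_bound (n : ℕ) {p : ℝ} (hp : 1 ≤ p) {M : ℝ≥0∞} (hM : M ≠ ⊤) :
    ∃ R : ℝ, ∀ Q : AffCoef n, (∀ i j, ∫⁻ y in ball (0 : Euc n) 1, ‖affMat Q y i j‖ₑ ^ p ≤ M) →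
      ‖Q‖ ≤ R := by
  obtain ⟨K, hK, h⟩ := exists_affMat_bound n hp
  have hp0 : 0 < p := by linarith
  set T : ℝ≥0∞ := K * ENNReal.ofReal 2 ^ p * M with hT
  have hTf : T ≠ ⊤ := ENNReal.mul_ne_top (ENNReal.mul_ne_top hK
    (ENNReal.rpow_ne_top_of_nonneg hp0.le (by simp))) hM
  set S := (T ^ p⁻¹).toReal with hS
  have hSf : T ^ p⁻¹ ≠ ⊤ := ENNReal.rpow_ne_top_of_nonneg (by positivity) hTf
  have hS0 : 0 ≤ S := ENNReal.toReal_nonneg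
  refine ⟨2 * S, fun Q hQ => ?_⟩
  have hb : ∀ z : Euc n, dist z 0 ≤ 1 → ∀ i j, |affMat Q z i j| ≤ S := fun z hz i j => by
    have h1 := h Q i j 0 z 1 one_pos
    rw [one_pow, ENNReal.ofReal_one, mul_one, div_one] at h1
    have h2 : ‖affMat Q z i j‖ₑ ^ p ≤ T := h1.trans (mul_le_mul' (mul_le_mul_right
      (ENNReal.rpow_le_rpow (ENNReal.ofReal_le_ofReal (by linarith)) hp0.le) _) (hQ i j))
    have h3 := (ENNReal.le_rpow_inv_iff hp0).2 h2
    have h4 := ENNReal.toReal_mono hSf h3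
    rwa [toReal_enorm] at h4
  have h0 : ∀ i j, affMat Q 0 i j = Q.1 i j := fun i j => by simp [affMat]
  refine AffCoef.norm_le (by positivity) (fun i j => ?_) fun i j k => ?_
  · have := hb 0 (by simp) i j
    rw [h0] at this; linarith
  · have e : Q.2 i j k = affMat Q (EuclideanSpace.single k 1) i j - affMat Q 0 i j := by
      rw [h0, affMat, Finset.sum_eq_single k]
      · simp
      · intro l _ hl; simp [hl]
      · simp
    rw [e]
    have h1 := hb (EuclideanSpace.single k 1) (by simp) i j
    have h2 := hb 0 (by simp) i j
    exact (abs_sub _ _).trans (by linarith)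

lemma continuous_affMat_coef (x : Euc n) (i j : Fin n) : Continuous fun Q : AffCoef n => affMat Q x i j := by
  unfold affMat
  fun_prop

lemma measurable_partial (u : Euc n → ℝ) (k : Fin n) :
    Measurable fun y => fderiv ℝ u y (EuclideanSpace.single k 1) :=
  measurable_fderiv_apply_const ℝ u _

lemma measurable_tfSym {α : Type*} [MeasurableSpace α] {M : α → Fin n → Fin n → ℝ}
    (hM : ∀ i j, Measurable fun x => M x i j) (a b : Fin n) : Measurable fun x => tfSym (M x) a b := by
  unfold tfSym
  exact (((hM _ _).add (hM _ _)).const_mul _).sub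
    ((Finset.measurable_sum _ fun i _ => hM i i).const_mul _)

lemma ofReal_lcSum_mollify_le (φ : ContDiffBump (0 : Euc n)) {u : Fin n → Euc n → ℝ}
    (hd : ∀ i, Differentiable ℝ (u i)) (hc : ∀ i, HasCompactSupport (u i))
    (hi : ∀ i k, Integrable fun y => fderiv ℝ (u i) y (EuclideanSpace.single k 1)) (x : Euc n) :
    ENNReal.ofReal (lcSum (fun i => mollify φ (u i) (hd i).continuous (hc i)) x) ≤
      ∫⁻ t, ENNReal.ofReal (φ.normed volume t) * ∑ a, ∑ b,
        ‖tfSym (fun i k => fderiv ℝ (u i) (x - t) (EuclideanSpace.single k 1)) a b‖ₑ := by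
  have hm : ∀ a b, Measurable fun t => ENNReal.ofReal (φ.normed volume t) *
      ‖tfSym (fun i k => fderiv ℝ (u i) (x - t) (EuclideanSpace.single k 1)) a b‖ₑ := fun a b =>
    φ.continuous_normed.measurable.ennreal_ofReal.mul (measurable_tfSym (fun i k =>
      (measurable_partial (u i) k).comp (by fun_prop : Measurable fun t => x - t)) a b).enorm
  simp only [Finset.mul_sum]
  rw [lintegral_finsetSum _ fun a _ => Finset.measurable_sum _ fun b _ => hm a b, lcSum,
    ENNReal.ofReal_sum_of_nonneg fun _ _ => Finset.sum_nonneg fun _ _ => abs_nonneg _]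
  refine Finset.sum_le_sum fun a _ => ?_
  rw [lintegral_finsetSum _ fun b _ => hm a b, ENNReal.ofReal_sum_of_nonneg fun _ _ => abs_nonneg _]
  refine Finset.sum_le_sum fun b _ => ?_
  obtain ⟨K, hK⟩ := φ.hasCompactSupport_normed.exists_bound_of_continuous
    (φ.continuous_normed (μ := (volume : Measure (Euc n))))
  have hM : ∀ i k, Integrable fun t => φ.normed volume t *
      fderiv ℝ (u i) (x - t) (EuclideanSpace.single k 1) := fun i k =>
    ((hi i k).comp_sub_left x).bdd_mul (c := K) φ.continuous_normed.aestronglyMeasurable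
      (Filter.Eventually.of_forall hK)
  rw [← Real.enorm_eq_ofReal_abs, lc_apply]
  simp only [fun i k => pdi_mollify φ (hd i) (hc i) k (hi i k) x]
  rw [tfSym_integral hM]
  simp only [tfSym_const_mul]
  exact enorm_integral_normed_mul_le φ _

theorem exists_compactlySupported_korn (hn : 3 ≤ n) {p q : ℝ} (hpq : p.HolderConjugate q) :
    ∃ C : ℝ≥0∞, C ≠ ⊤ ∧ ∀ u : Fin n → Euc n → ℝ, (∀ i, Differentiable ℝ (u i)) →
      (∀ i, HasCompactSupport (u i)) →
      (∀ i k, ∫⁻ x, ‖fderiv ℝ (u i) x (EuclideanSpace.single k 1)‖ₑ ^ p ≠ ⊤) →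
      ∃ Q ∈ killingCoef n, ∀ i k, ∫⁻ x in closedBall (0 : Euc n) 1,
        ‖fderiv ℝ (u i) x (EuclideanSpace.single k 1) - affMat Q x i k‖ₑ ^ p ≤
        C * ∫⁻ x in closedBall (0 : Euc n) 3, (∑ a, ∑ b,
          ‖tfSym (fun i k => fderiv ℝ (u i) x (EuclideanSpace.single k 1)) a b‖ₑ) ^ p := by
  obtain ⟨C, hC, hK⟩ := exists_local_smooth_korn hn hpq
  refine ⟨C, hC, fun u hd hc hp => ?_⟩
  obtain ⟨D, hD⟩ : ∃ D : Fin n → Fin n → Euc n → ℝ, ∀ i k x,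
    fderiv ℝ (u i) x (EuclideanSpace.single k 1) = D i k x := ⟨_, fun _ _ _ => rfl⟩
  have hDm : ∀ i k, Measurable (D i k) := fun i k => by
    have := measurable_partial (u i) k
    simpa only [hD] using this
  have hi : ∀ i k, Integrable (fun y => fderiv ℝ (u i) y (EuclideanSpace.single k 1)) := fun i k => by
    obtain ⟨R, hR⟩ := (hc i).isCompact.isBounded.subset_closedBall 0
    refine integrable_of_lintegral_rpow_lt_top (measurable_partial (u i) k) (R := R) (fun x hx => ?_)
      hpq (hp i k)
    have : fderiv ℝ (u i) x = 0 := by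
      by_contra h
      exact hx (hR (support_fderiv_subset ℝ h))
    simp [this]
  have hbump : ∀ m : ℕ, ∃ φ : ContDiffBump (0 : Euc n), φ.rOut = 1 / ((m:ℝ) + 1) ∧
      φ.rOut = 2 * φ.rIn := fun m =>
    ⟨⟨1 / ((m:ℝ) + 1) / 2, 1 / ((m:ℝ) + 1), by positivity, half_lt_self (by positivity)⟩, rfl, by
      change 1 / ((m:ℝ) + 1) = 2 * (1 / ((m:ℝ) + 1) / 2); ring⟩
  choose φ hφ hφ2 using hbump
  have hφ1 : ∀ m, (φ m).rOut ≤ 1 := fun m => by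
    rw [hφ, div_le_one (by positivity)]; linarith [(Nat.cast_nonneg m : (0:ℝ) ≤ m)]
  obtain ⟨w, hw⟩ : ∃ w : ℕ → Fin n → ccSmooth n, ∀ m i, w m i =
    mollify (φ m) (u i) (hd i).continuous (hc i) := ⟨fun m i => _, fun m i => rfl⟩
  have hwp : ∀ m i k x, (pdi k (w m i) : Euc n → ℝ) x =
      ∫ t, (φ m).normed volume t * D i k (x - t) := fun m i k x => by
    rw [hw, pdi_mollify (φ m) (hd i) (hc i) k (hi i k) x]
    simp only [hD]
  simp only [hD] at hi hp ⊢
  choose Q hQ hQb using fun m => hK (w m)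
  set A := ∫⁻ x in closedBall (0 : Euc n) 3, (∑ a, ∑ b, ‖tfSym (fun i k => D i k x) a b‖ₑ) ^ p with hA
  have hQA : ∀ m i k, ∫⁻ x in closedBall (0 : Euc n) 1,
      ‖(pdi k (w m i) : Euc n → ℝ) x - affMat (Q m) x i k‖ₑ ^ p ≤ C * A := fun m i k => by
    refine (hQb m i k).trans (mul_le_mul_right ?_ _)
    have hF : Measurable fun x => ∑ a, ∑ b, ‖tfSym (fun i k => D i k x) a b‖ₑ :=
      Finset.measurable_sum _ fun a _ => Finset.measurable_sum _ fun b _ =>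
        (measurable_tfSym (fun i k => hDm i k) a b).enorm
    have h1 := lintegral_rpow_average_le (φ m) (hφ1 m) hpq hF 2
    rw [show (2:ℝ) + 1 = 3 by norm_num] at h1
    refine le_trans (lintegral_mono fun x => ENNReal.rpow_le_rpow ?_ hpq.pos.le) h1
    have h2 := ofReal_lcSum_mollify_le (φ m) hd hc (by simpa only [hD] using hi) x
    simp only [hD] at h2
    rwa [show (fun i => mollify (φ m) (u i) (hd i).continuous (hc i)) = w m from
      funext fun i => (hw m i).symm] at h2
  obtain ⟨B, hB⟩ : ∃ B : ℝ≥0∞, B = ∑ i, ∑ k, ∫⁻ x, ‖D i k x‖ₑ ^ p := ⟨_, rfl⟩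
  have hBf : B ≠ ⊤ := hB ▸ ENNReal.sum_ne_top.2 fun i _ => ENNReal.sum_ne_top.2 fun k _ => hp i k
  have hwB : ∀ m i k, ∫⁻ x in closedBall (0 : Euc n) 1, ‖(pdi k (w m i) : Euc n → ℝ) x‖ₑ ^ p ≤ B :=
    fun m i k => by
    have h1 := lintegral_rpow_average_le (φ m) (hφ1 m) hpq (hDm i k).enorm 1
    refine le_trans (lintegral_mono fun x => ENNReal.rpow_le_rpow ?_ hpq.pos.le) (h1.trans
      ((setLIntegral_le_lintegral _ _).trans ?_))
    · rw [hwp]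
      exact enorm_integral_normed_mul_le (φ m) _
    · rw [hB]
      exact (Finset.single_le_sum (f := fun k => ∫⁻ x, ‖D i k x‖ₑ ^ p) (fun _ _ => zero_le)
        (Finset.mem_univ k)).trans (Finset.single_le_sum
        (f := fun i => ∑ k, ∫⁻ x, ‖D i k x‖ₑ ^ p) (fun _ _ => zero_le) (Finset.mem_univ i))
  by_cases hAf : C * A = ⊤
  · exact ⟨0, Submodule.zero_mem _, fun i k => hAf ▸ le_top⟩
  have hpm : ∀ m i k, Measurable fun x => (pdi k (w m i) : Euc n → ℝ) x := fun m i k =>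
    (ccSmooth_continuous _).measurable
  have hQM : ∀ m i k, ∫⁻ x in ball (0 : Euc n) 1, ‖affMat (Q m) x i k‖ₑ ^ p ≤
      2 ^ (p - 1) * (B + C * A) := fun m i k => by
    refine (lintegral_mono_set ball_subset_closedBall).trans ?_
    have h1 : ∀ x : Euc n, ‖affMat (Q m) x i k‖ₑ ^ p ≤ 2 ^ (p - 1) *
        (‖(pdi k (w m i) : Euc n → ℝ) x‖ₑ ^ p +
          ‖(pdi k (w m i) : Euc n → ℝ) x - affMat (Q m) x i k‖ₑ ^ p) := fun x => by
      refine le_trans (ENNReal.rpow_le_rpow ?_ hpq.pos.le)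
        (ENNReal.rpow_add_le_mul_rpow_add_rpow _ _ hpq.lt.le)
      have := enorm_sub_le (a := (pdi k (w m i) : Euc n → ℝ) x)
        (b := (pdi k (w m i) : Euc n → ℝ) x - affMat (Q m) x i k)
      rwa [sub_sub_cancel] at this
    have hm1 := (hpm m i k).enorm.pow_const p
    have hm2 : Measurable fun x => ‖(pdi k (w m i) : Euc n → ℝ) x - affMat (Q m) x i k‖ₑ ^ p :=
      ((hpm m i k).sub (continuous_affMat (Q m) i k).measurable).enorm.pow_const p
    refine (lintegral_mono h1).trans ?_
    rw [lintegral_const_mul' _ _ (ENNReal.rpow_ne_top_of_nonneg hpq.sub_one_pos.le (by simp)),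
      lintegral_add_left hm1]
    exact mul_le_mul_right (add_le_add (hwB m i k) (hQA m i k)) _
  obtain ⟨R, hR⟩ := exists_norm_le_of_affMat_bound n hpq.lt.le
    (ENNReal.mul_ne_top (ENNReal.rpow_ne_top_of_nonneg hpq.sub_one_pos.le (by simp))
      (ENNReal.add_ne_top.2 ⟨hBf, hAf⟩) : (2:ℝ≥0∞) ^ (p - 1) * (B + C * A) ≠ ⊤)
  obtain ⟨P, -, ψ, hψ, hlim⟩ := tendsto_subseq_of_bounded (isBounded_closedBall (x := (0 : AffCoef n)) (r := R))
    (x := Q) fun m => mem_closedBall_zero_iff.2 (hR (Q m) (hQM m))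
  have hP : P ∈ killingCoef n := (Submodule.closed_of_finiteDimensional (killingCoef n)).mem_of_tendsto
    hlim (Filter.Eventually.of_forall fun m => hQ (ψ m))
  refine ⟨P, hP, fun i k => ?_⟩
  have hae : ∀ᵐ x : Euc n, Filter.Tendsto (fun m => (pdi k (w m i) : Euc n → ℝ) x) Filter.atTop
      (nhds (D i k x)) := by
    have := ContDiffBump.ae_convolution_tendsto_right_of_locallyIntegrable (φ := φ) (l := Filter.atTop)
      (K := 2) (g := D i k) (μ := volume) (by
        simp only [hφ]; exact tendsto_one_div_add_atTop_nhds_zero_nat)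
      (Filter.Eventually.of_forall fun m => (hφ2 m).le) (hi i k).locallyIntegrable
    filter_upwards [this] with x hx
    refine hx.congr fun m => ?_
    rw [hwp]; rfl
  have hae' : ∀ᵐ x ∂(volume.restrict (closedBall (0 : Euc n) 1)),
      ‖D i k x - affMat P x i k‖ₑ ^ p = Filter.liminf (fun m =>
        ‖(pdi k (w (ψ m) i) : Euc n → ℝ) x - affMat (Q (ψ m)) x i k‖ₑ ^ p) Filter.atTop := by
    refine ae_restrict_of_ae ?_
    filter_upwards [hae] with x hx
    have h1 := (hx.comp hψ.tendsto_atTop).sub (((continuous_affMat_coef x i k).tendsto P).comp hlim)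
    have h2 := ((continuous_enorm.tendsto _).comp h1)
    exact (((ENNReal.continuous_rpow_const (y := p)).tendsto _).comp h2).liminf_eq.symm
  rw [lintegral_congr_ae hae']
  refine (lintegral_liminf_le fun m => ((hpm (ψ m) i k).sub
    (continuous_affMat (Q (ψ m)) i k).measurable).enorm.pow_const p).trans ?_
  refine (Filter.liminf_le_liminf (Filter.Eventually.of_forall fun m => hQA (ψ m) i k)).trans ?_
  simp

end CompactlySupportedKorn

section RoughKorn

variable {n : ℕ}

/-- The sum of the absolute values of the entries of a matrix. -/
def entrySum (M : Matrix (Fin n) (Fin n) ℝ) : ℝ≥0∞ := ∑ i, ∑ j, ‖M i j‖ₑ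

/-- The affine matrix field `affMat Q`, with values in the matrices. -/
def affMatrix (Q : AffCoef n) (x : Euc n) : Matrix (Fin n) (Fin n) ℝ := Matrix.of (affMat Q x)

lemma affMatrix_apply (Q : AffCoef n) (x : Euc n) (i j : Fin n) :
    affMatrix Q x i j = affMat Q x i j := rfl

lemma entrySum_add_le (M N : Matrix (Fin n) (Fin n) ℝ) :
    entrySum (M + N) ≤ entrySum M + entrySum N := by
  simp only [entrySum, ← Finset.sum_add_distrib]
  exact Finset.sum_le_sum fun i _ => Finset.sum_le_sum fun j _ => enorm_add_le _ _

lemma entrySum_neg (M : Matrix (Fin n) (Fin n) ℝ) : entrySum (-M) = entrySum M := by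
  simp [entrySum]

lemma enorm_le_entrySum (M : Matrix (Fin n) (Fin n) ℝ) (i j : Fin n) : ‖M i j‖ₑ ≤ entrySum M :=
  (Finset.single_le_sum (f := fun j => ‖M i j‖ₑ) (fun _ _ => zero_le) (Finset.mem_univ j)).trans
    (Finset.single_le_sum (f := fun i => ∑ j, ‖M i j‖ₑ) (fun _ _ => zero_le) (Finset.mem_univ i))

lemma exists_entrySum_rpow_le (n : ℕ) {p : ℝ} (hp : 1 ≤ p) : ∃ K : ℝ≥0∞, K ≠ ⊤ ∧
    ∀ M : Matrix (Fin n) (Fin n) ℝ, entrySum M ^ p ≤ K * ∑ i, ∑ j, ‖M i j‖ₑ ^ p := by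
  obtain ⟨K, hK, h⟩ := ENNReal.rpow_add_sum_le n hp
  have h0 : (0:ℝ≥0∞) ^ p = 0 := ENNReal.zero_rpow_of_pos (by linarith)
  refine ⟨K * K, ENNReal.mul_ne_top hK hK, fun M => ?_⟩
  have h1 := h 0 fun i => ∑ j, ‖M i j‖ₑ
  rw [zero_add, h0, zero_add] at h1
  refine h1.trans ?_
  rw [mul_assoc]
  refine mul_le_mul_right ?_ _
  rw [Finset.mul_sum]
  refine Finset.sum_le_sum fun i _ => ?_
  have h2 := h 0 fun j => ‖M i j‖ₑ
  rwa [zero_add, h0, zero_add] at h2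

lemma lMat_eq_tfSym (v : Euc n → Euc n) (x : Euc n) (a b : Fin n) :
    lMat v x a b = tfSym (Dmat v x) a b := by
  simp only [lMat, epsMat, tfSym, Matrix.sub_apply, Matrix.smul_apply, Matrix.add_apply,
    Matrix.transpose_apply, Matrix.one_apply, smul_eq_mul, Matrix.trace, Matrix.diag_apply]
  split_ifs <;> ring

lemma hasFDerivAt_coord {v : Euc n → Euc n} {x : Euc n} (h : DifferentiableAt ℝ v x) (i : Fin n) :
    HasFDerivAt (fun x => v x i) ((EuclideanSpace.proj (𝕜 := ℝ) i : Euc n →L[ℝ] ℝ) ∘L fderiv ℝ v x) x :=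
  (EuclideanSpace.proj (𝕜 := ℝ) i : Euc n →L[ℝ] ℝ).hasFDerivAt.comp x h.hasFDerivAt

theorem exists_unit_ball_korn (hn : 3 ≤ n) {p q : ℝ} (hpq : p.HolderConjugate q) :
    ∃ C : ℝ≥0∞, C ≠ ⊤ ∧ ∀ v : Euc n → Euc n, (∀ x ∈ ball (0 : Euc n) 4, DifferentiableAt ℝ v x) →
      ∫⁻ x in ball (0 : Euc n) 4, entrySum (Dmat v x) ^ p ≠ ⊤ → ∃ Q ∈ killingCoef n,
        ∫⁻ x in ball (0 : Euc n) 1, entrySum (Dmat v x - affMatrix Q x) ^ p ≤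
          C * ∫⁻ x in ball (0 : Euc n) 4, entrySum (lMat v x) ^ p := by
  obtain ⟨C, hC, hK⟩ := exists_compactlySupported_korn hn hpq
  obtain ⟨K, hKf, hS⟩ := exists_entrySum_rpow_le n hpq.lt.le
  refine ⟨K * ∑ _i : Fin n, ∑ _k : Fin n, C, ENNReal.mul_ne_top hKf (ENNReal.sum_ne_top.2 fun _ _ =>
    ENNReal.sum_ne_top.2 fun _ _ => hC), fun v hv hf => ?_⟩
  let η : ContDiffBump (0 : Euc n) := ⟨16 / 5, 18 / 5, by norm_num, by norm_num⟩
  have hηd : Differentiable ℝ η := η.contDiff.differentiable (n := 1) one_ne_zero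
  have h0 : ∀ x ∉ closedBall (0 : Euc n) (18 / 5), ∀ i,
      (fun x => η x * v x i) =ᶠ[nhds x] fun _ => 0 := fun x hx i => by
    filter_upwards [isClosed_closedBall.isOpen_compl.mem_nhds hx] with z hz
    rw [η.zero_of_le_dist (le_of_lt (not_le.1 hz)), zero_mul]
  have h1 : ∀ x ∈ closedBall (0 : Euc n) 3, (η : Euc n → ℝ) =ᶠ[nhds x] fun _ => 1 := fun x hx => by
    filter_upwards [isOpen_ball.mem_nhds (show x ∈ ball (0 : Euc n) (16 / 5) from
      closedBall_subset_ball (by norm_num) hx)] with z hz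
    exact η.one_of_mem_closedBall (ball_subset_closedBall hz)
  have hder : ∀ x ∈ ball (0 : Euc n) 4, ∀ i, HasFDerivAt (fun x => η x * v x i) _ x := fun x hx i =>
    (hηd x).hasFDerivAt.mul (hasFDerivAt_coord (hv x hx) i)
  have hsub : closedBall (0 : Euc n) (18 / 5) ⊆ ball 0 4 := closedBall_subset_ball (by norm_num)
  have hpart : ∀ x ∈ ball (0 : Euc n) 4, ∀ i k,
      fderiv ℝ (fun x => η x * v x i) x (EuclideanSpace.single k 1) =
        η x * Dmat v x i k + v x i * fderiv ℝ η x (EuclideanSpace.single k 1) := fun x hx i k => by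
    rw [(hder x hx i).fderiv]
    rfl
  have hd : ∀ i, Differentiable ℝ fun x => η x * v x i := fun i x => by
    by_cases hx : x ∈ closedBall (0 : Euc n) (18 / 5)
    · exact (hder x (hsub hx) i).differentiableAt
    · exact (h0 x hx i).differentiableAt_iff.2 (differentiableAt_const _)
  have hvc : ContinuousOn v (closedBall 0 (18 / 5)) := fun x hx =>
    (hv x (hsub hx)).continuousAt.continuousWithinAt
  have hηc : Continuous fun x => fderiv ℝ η x := η.contDiff.continuous_fderiv (n := 1) one_ne_zero
  have hfin : ∀ i k, ∫⁻ x, ‖fderiv ℝ (fun x => η x * v x i) x (EuclideanSpace.single k 1)‖ₑ ^ p ≠ ⊤ := by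
    intro i k
    have hc2 : ContinuousOn (fun x => v x i * fderiv ℝ η x (EuclideanSpace.single k 1))
        (closedBall 0 (18 / 5)) :=
      ((EuclideanSpace.proj (𝕜 := ℝ) i : Euc n →L[ℝ] ℝ).continuous.comp_continuousOn hvc).mul
        (hηc.clm_apply continuous_const).continuousOn
    obtain ⟨B, hB⟩ := (isCompact_closedBall (0 : Euc n) (18 / 5)).exists_bound_of_continuousOn hc2
    have hle : ∀ x, ‖fderiv ℝ (fun x => η x * v x i) x (EuclideanSpace.single k 1)‖ₑ ^ p ≤
        (ball (0 : Euc n) 4).indicator (fun x => 2 ^ (p - 1) * (entrySum (Dmat v x) ^ p +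
          ENNReal.ofReal B ^ p)) x := fun x => by
      by_cases hx : x ∈ closedBall (0 : Euc n) (18 / 5)
      · rw [indicator_of_mem (hsub hx), hpart x (hsub hx)]
        refine le_trans (ENNReal.rpow_le_rpow ((enorm_add_le _ _).trans (add_le_add ?_ ?_)) hpq.pos.le)
          (ENNReal.rpow_add_le_mul_rpow_add_rpow _ _ hpq.lt.le)
        · refine le_trans ?_ (enorm_le_entrySum (Dmat v x) i k)
          rw [Real.enorm_eq_ofReal_abs, Real.enorm_eq_ofReal_abs, abs_mul]
          refine ENNReal.ofReal_le_ofReal (mul_le_of_le_one_left (abs_nonneg _) ?_)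
          rw [abs_of_nonneg η.nonneg]
          exact η.le_one
        · rw [Real.enorm_eq_ofReal_abs]
          exact ENNReal.ofReal_le_ofReal (hB x hx)
      · rw [(h0 x hx i).fderiv_eq]
        simp [hpq.pos]
    refine ne_top_of_le_ne_top ?_ (lintegral_mono hle)
    rw [lintegral_indicator measurableSet_ball, lintegral_const_mul' _ _
      (ENNReal.rpow_ne_top_of_nonneg hpq.sub_one_pos.le (by simp)), lintegral_add_right _ measurable_const,
      setLIntegral_const]
    exact ENNReal.mul_ne_top (ENNReal.rpow_ne_top_of_nonneg hpq.sub_one_pos.le (by simp))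
      (ENNReal.add_ne_top.2 ⟨hf, ENNReal.mul_ne_top (ENNReal.rpow_ne_top_of_nonneg hpq.pos.le (by simp))
        measure_ball_lt_top.ne⟩)
  obtain ⟨Q, hQ, hQb⟩ := hK (fun i x => η x * v x i) hd (fun i => η.hasCompactSupport.mul_right) hfin
  have he : ∀ x ∈ closedBall (0 : Euc n) 3, ∀ i k,
      fderiv ℝ (fun x => η x * v x i) x (EuclideanSpace.single k 1) = Dmat v x i k := fun x hx i k => by
    have e1 : η x = 1 := (h1 x hx).eq_of_nhds
    rw [hpart x (closedBall_subset_ball (by norm_num) hx), e1, (h1 x hx).fderiv_eq]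
    simp
  refine ⟨Q, hQ, ?_⟩
  set A := ∫⁻ x in ball (0 : Euc n) 4, entrySum (lMat v x) ^ p with hA
  have hQA : ∀ i k, ∫⁻ x in ball (0 : Euc n) 1, ‖Dmat v x i k - affMat Q x i k‖ₑ ^ p ≤ C * A :=
    fun i k => by
    have h2 : ∫⁻ x in ball (0 : Euc n) 1, ‖Dmat v x i k - affMat Q x i k‖ₑ ^ p ≤
        ∫⁻ x in closedBall (0 : Euc n) 1, ‖fderiv ℝ (fun x => η x * v x i) x
          (EuclideanSpace.single k 1) - affMat Q x i k‖ₑ ^ p := by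
      refine (lintegral_mono_set ball_subset_closedBall).trans (le_of_eq
        (setLIntegral_congr_fun measurableSet_closedBall fun x hx => ?_))
      simp only [he x (closedBall_subset_closedBall (by norm_num) hx)]
    refine h2.trans ((hQb i k).trans (mul_le_mul_right ?_ _))
    refine le_trans (le_of_eq ?_) (lintegral_mono_set
      (closedBall_subset_ball (by norm_num : (3:ℝ) < 4)))
    refine setLIntegral_congr_fun measurableSet_closedBall fun x hx => ?_
    simp only [he x hx, entrySum, lMat_eq_tfSym]
  have hm : ∀ i k, AEMeasurable (fun x => ‖Dmat v x i k - affMat Q x i k‖ₑ ^ p)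
      (volume.restrict (ball (0 : Euc n) 1)) := fun i k => by
    have h3 : Measurable fun x => ‖fderiv ℝ (fun x => η x * v x i) x
        (EuclideanSpace.single k 1) - affMat Q x i k‖ₑ ^ p :=
      ((measurable_partial _ k).sub (continuous_affMat Q i k).measurable).enorm.pow_const p
    refine h3.aemeasurable.congr ?_
    filter_upwards [ae_restrict_mem measurableSet_ball] with x hx
    simp only [he x (ball_subset_closedBall (ball_subset_ball (by norm_num) hx))]
  refine (lintegral_mono fun x => hS (Dmat v x - affMatrix Q x)).trans ?_
  rw [lintegral_const_mul' _ _ hKf, mul_assoc]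
  refine mul_le_mul_right ?_ _
  simp only [Matrix.sub_apply, affMatrix_apply]
  rw [lintegral_finsetSum' _ fun i _ => Finset.aemeasurable_fun_sum _ fun k _ => hm i k, Finset.sum_mul]
  refine Finset.sum_le_sum fun i _ => ?_
  rw [lintegral_finsetSum' _ fun k _ => hm i k, Finset.sum_mul]
  exact Finset.sum_le_sum fun k _ => hQA i k

end RoughKorn

section BallKorn

variable {n : ℕ}

lemma setLIntegral_ball_scale (g : Euc n → ℝ≥0∞) (x : Euc n) {r : ℝ} (hr : 0 < r) (s : ℝ) :
    ∫⁻ z in ball x (r * s), g z =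
      ENNReal.ofReal (r ^ n) * ∫⁻ y in ball (0 : Euc n) s, g (x + r • y) := by
  have h := lintegral_comp_add_smul (indicator (ball x (r * s)) g) x hr.ne'
  rw [lintegral_indicator measurableSet_ball] at h
  have h2 : ∀ y, indicator (ball x (r * s)) g (x + r • y) =
      indicator (ball (0 : Euc n) s) (fun y => g (x + r • y)) y := fun y => by
    have h3 : x + r • y ∈ ball x (r * s) ↔ y ∈ ball (0 : Euc n) s := by
      rw [mem_ball, mem_ball, dist_zero_right, dist_eq_norm, add_sub_cancel_left, norm_smul,
        Real.norm_of_nonneg hr.le, mul_lt_mul_iff_right₀ hr]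
    by_cases hy : y ∈ ball (0 : Euc n) s
    · rw [indicator_of_mem hy, indicator_of_mem (h3.2 hy)]
    · rw [indicator_of_notMem hy, indicator_of_notMem (mt h3.1 hy)]
  simp only [h2] at h
  rw [lintegral_indicator measurableSet_ball] at h
  rw [h, ← mul_assoc, ← ENNReal.ofReal_mul (by positivity), abs_of_pos (by positivity),
    mul_inv_cancel₀ (by positivity), ENNReal.ofReal_one, one_mul]

lemma exists_affMatrix_scale {Q : AffCoef n} (hQ : Q ∈ killingCoef n) (x : Euc n) {r : ℝ}
    (hr : r ≠ 0) : ∃ P ∈ killingCoef n, ∀ y, affMatrix P (x + r • y) = affMatrix Q y := by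
  have h1 := mem_killingCoef_iff.1 ((killingCoef n).smul_mem r⁻¹ hQ)
  refine ⟨(affMat Q (-(r⁻¹ • x)), r⁻¹ • Q.2), mem_killingCoef_iff.2
    ⟨fun i j => tfSym_affMat hQ _ i j, h1.2.1, h1.2.2⟩, fun y => ?_⟩
  ext i j
  simp only [affMatrix_apply, affMat, PiLp.neg_apply, PiLp.smul_apply, PiLp.add_apply,
    Pi.smul_apply, smul_eq_mul]
  rw [add_assoc, ← Finset.sum_add_distrib]
  refine congrArg _ (Finset.sum_congr rfl fun k _ => ?_)
  field_simp
  ring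

lemma Dmat_scale {v : Euc n → Euc n} {x y : Euc n} {r : ℝ} (hr : r ≠ 0)
    (h : DifferentiableAt ℝ v (x + r • y)) :
    HasFDerivAt (fun y => r⁻¹ • v (x + r • y)) (fderiv ℝ v (x + r • y)) y ∧
    Dmat (fun y => r⁻¹ • v (x + r • y)) y = Dmat v (x + r • y) := by
  have h1 : HasFDerivAt (fun y : Euc n => x + r • y) (r • ContinuousLinearMap.id ℝ (Euc n)) y :=
    ((hasFDerivAt_id y).const_smul r).const_add x
  have h2 : HasFDerivAt (fun y => r⁻¹ • v (x + r • y)) (fderiv ℝ v (x + r • y)) y := by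
    refine ((h.hasFDerivAt.comp y h1).const_smul r⁻¹).congr_fderiv ?_
    ext1 z
    simp [smul_smul, hr]
  refine ⟨h2, ?_⟩
  ext i j
  simp only [Dmat, h2.fderiv]

lemma lMat_congr {v w : Euc n → Euc n} {x y : Euc n} (h : Dmat v x = Dmat w y) :
    lMat v x = lMat w y := by
  ext i j
  rw [lMat_eq_tfSym, lMat_eq_tfSym, h]

theorem exists_ball_korn (hn : 3 ≤ n) {p q : ℝ} (hpq : p.HolderConjugate q) :
    ∃ C : ℝ≥0∞, C ≠ ⊤ ∧ ∀ (v : Euc n → Euc n) (x : Euc n) (r : ℝ), 0 < r →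
      (∀ z ∈ ball x (r * 4), DifferentiableAt ℝ v z) →
      ∫⁻ z in ball x (r * 4), entrySum (Dmat v z) ^ p ≠ ⊤ → ∃ Q ∈ killingCoef n,
        ∫⁻ z in ball x r, entrySum (Dmat v z - affMatrix Q z) ^ p ≤
          C * ∫⁻ z in ball x (r * 4), entrySum (lMat v z) ^ p := by
  obtain ⟨C, hC, h⟩ := exists_unit_ball_korn hn hpq
  refine ⟨C, hC, fun v x r hr hv hf => ?_⟩
  have hmem : ∀ y ∈ ball (0 : Euc n) 4, x + r • y ∈ ball x (r * 4) := fun y hy => by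
    rw [mem_ball_zero_iff] at hy
    rw [mem_ball, dist_eq_norm, add_sub_cancel_left, norm_smul, Real.norm_of_nonneg hr.le]
    exact mul_lt_mul_of_pos_left hy hr
  have hD : ∀ y ∈ ball (0 : Euc n) 4, _ := fun y hy => Dmat_scale hr.ne' (hv _ (hmem y hy))
  have hsub : ball (0 : Euc n) 1 ⊆ ball 0 4 := ball_subset_ball (by norm_num)
  have hr0 : ENNReal.ofReal (r ^ n) ≠ 0 := (ENNReal.ofReal_pos.2 (by positivity)).ne'
  obtain ⟨Q, hQ, hle⟩ := h (fun y => r⁻¹ • v (x + r • y))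
    (fun y hy => (hD y hy).1.differentiableAt) (by
      rw [setLIntegral_ball_scale _ x hr] at hf
      rw [setLIntegral_congr_fun measurableSet_ball fun y hy => by rw [(hD y hy).2]]
      exact fun h => hf (by rw [h, ENNReal.mul_top hr0]))
  obtain ⟨P, hP, hPQ⟩ := exists_affMatrix_scale hQ x hr.ne'
  refine ⟨P, hP, ?_⟩
  rw [setLIntegral_ball_scale _ x hr 4]
  nth_rewrite 1 [← mul_one r]
  rw [setLIntegral_ball_scale _ x hr 1, mul_left_comm]
  refine mul_le_mul_right ?_ _
  simp only [hPQ]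
  refine le_trans (le_of_eq ?_) (hle.trans (le_of_eq (congrArg _ ?_)))
  · exact setLIntegral_congr_fun measurableSet_ball fun y hy => by rw [(hD y (hsub hy)).2]
  · exact setLIntegral_congr_fun measurableSet_ball fun y hy => by rw [lMat_congr (hD y hy).2]

theorem exists_affMatrix_bound (n : ℕ) {p : ℝ} (hp : 1 ≤ p) : ∃ K : ℝ≥0∞, K ≠ ⊤ ∧
    ∀ (Q : AffCoef n) (x z : Euc n) (r : ℝ), 0 < r →
      entrySum (affMatrix Q z) ^ p * ENNReal.ofReal (r ^ n) ≤
        K * ENNReal.ofReal (1 + dist z x / r) ^ p * ∫⁻ y in ball x r, entrySum (affMatrix Q y) ^ p := by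
  obtain ⟨K, hK, h⟩ := exists_affMat_bound n hp
  obtain ⟨S, hS, h2⟩ := exists_entrySum_rpow_le n hp
  refine ⟨S * ∑ _i : Fin n, ∑ _j : Fin n, K, ENNReal.mul_ne_top hS (ENNReal.sum_ne_top.2 fun _ _ =>
    ENNReal.sum_ne_top.2 fun _ _ => hK), fun Q x z r hr => ?_⟩
  refine (mul_le_mul_left (h2 _) _).trans ?_
  simp only [mul_assoc]
  refine mul_le_mul_right ?_ _
  simp only [Finset.sum_mul]
  refine Finset.sum_le_sum fun i _ => Finset.sum_le_sum fun j _ => ?_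
  refine (h Q i j x z r hr).trans ?_
  rw [mul_assoc]
  refine mul_le_mul_right (mul_le_mul_right (lintegral_mono fun y => ?_) _) _
  exact ENNReal.rpow_le_rpow (enorm_le_entrySum (affMatrix Q y) i j) (by linarith)

end BallKorn

section Porosity

variable {n : ℕ} {Ω : Set (Euc n)} {J : ℝ} {x₀ : Euc n}

/-- John domains with a given constant and centre. -/
structure IsJohnWith (Ω : Set (Euc n)) (J : ℝ) (x₀ : Euc n) : Prop where
  isOpen : IsOpen Ω
  frontier_nonempty : (frontier Ω).Nonempty
  one_lt : 1 < J
  mem : x₀ ∈ Ω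
  curve : ∀ y ∈ Ω, ∃ L : ℝ, 0 ≤ L ∧ ∃ γ : ℝ → Euc n, γ 0 = y ∧ γ L = x₀ ∧
    (∀ t ∈ Icc 0 L, γ t ∈ Ω) ∧ (∀ s ∈ Icc 0 L, ∀ t ∈ Icc 0 L, dist (γ s) (γ t) ≤ |s - t|) ∧
    ∀ t ∈ Icc 0 L, t / J ≤ distBd Ω (γ t)

lemma distBd_le_add (Ω : Set (Euc n)) (x y : Euc n) : distBd Ω x ≤ distBd Ω y + dist x y :=
  infDist_le_infDist_add_dist

lemma continuous_distBd (Ω : Set (Euc n)) : Continuous (distBd Ω) := continuous_infDist_pt _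

lemma measurable_distBd (Ω : Set (Euc n)) : Measurable (distBd Ω) :=
  (continuous_distBd Ω).measurable

lemma ball_subset_of_le_distBd (hΩ : IsOpen Ω) {x : Euc n} (hx : x ∈ Ω) {r : ℝ}
    (hr : r ≤ distBd Ω x) : ball x r ⊆ Ω := by
  rcases le_or_gt r 0 with h0 | h0
  · rw [ball_eq_empty.2 h0]
    exact empty_subset _
  have hd : Disjoint (ball x r) (frontier Ω) := disjoint_ball_infDist.mono_left (ball_subset_ball hr)
  refine IsPreconnected.subset_left_of_subset_union hΩ isClosed_closure.isOpen_compl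
    (disjoint_compl_right_iff_subset.2 subset_closure) (fun z hz => ?_) ⟨x, mem_ball_self h0, hx⟩
    (convex_ball x r).isPreconnected
  by_contra hcon
  rw [mem_union, not_or, mem_compl_iff, not_not] at hcon
  refine disjoint_left.1 hd hz ?_
  rw [frontier, hΩ.interior_eq]
  exact ⟨hcon.2, hcon.1⟩

namespace IsJohnWith

lemma distBd_pos (H : IsJohnWith Ω J x₀) {x : Euc n} (hx : x ∈ Ω) : 0 < distBd Ω x := by
  refine (isClosed_frontier.notMem_iff_infDist_pos H.frontier_nonempty).1 fun h => ?_
  rw [frontier, H.isOpen.interior_eq] at h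
  exact h.2 hx

lemma distBd_le (H : IsJohnWith Ω J x₀) {y : Euc n} (hy : y ∈ Ω) :
    distBd Ω y ≤ (1 + J) * distBd Ω x₀ := by
  obtain ⟨L, hL, γ, h0, h1, -, h3, h4⟩ := H.curve y hy
  have hJ := H.one_lt
  have h5 := h4 L ⟨hL, le_rfl⟩
  have h6 := h3 0 ⟨le_rfl, hL⟩ L ⟨hL, le_rfl⟩
  rw [h1, div_le_iff₀ (by linarith)] at h5
  rw [h0, h1, zero_sub, abs_neg, abs_of_nonneg hL] at h6
  linarith [distBd_le_add Ω y x₀]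

lemma exists_ball (H : IsJohnWith Ω J x₀) {y : Euc n} (hy : y ∈ Ω) {δ : ℝ} (hδ : 0 < δ)
    (hyδ : distBd Ω y < δ) (hδ0 : (2 * J + 1) * δ ≤ distBd Ω x₀) : ∃ y', dist y' y ≤ 2 * J * δ ∧
      ∀ w ∈ ball y' δ, w ∈ Ω ∧ δ ≤ distBd Ω w ∧ distBd Ω w < (2 * J + 2) * δ := by
  obtain ⟨L, hL, γ, h0, h1, h2, h3, h4⟩ := H.curve y hy
  have hJ := H.one_lt
  have hLd := h3 0 ⟨le_rfl, hL⟩ L ⟨hL, le_rfl⟩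
  rw [h0, h1, zero_sub, abs_neg, abs_of_nonneg hL] at hLd
  have h5 := distBd_le_add Ω x₀ y
  rw [dist_comm] at h5
  have ht : 2 * J * δ ∈ Icc 0 L := ⟨by positivity, by linarith⟩
  have h6 := h3 _ ht 0 ⟨le_rfl, hL⟩
  rw [h0, sub_zero, abs_of_nonneg ht.1] at h6
  have h7 := h4 _ ht
  rw [div_le_iff₀ (by linarith)] at h7
  have h8 : 2 * δ ≤ distBd Ω (γ (2 * J * δ)) := by
    by_contra hc
    have := mul_lt_mul_of_pos_right (not_le.1 hc) (show 0 < J by linarith)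
    linarith
  refine ⟨_, h6, fun w hw => ?_⟩
  have h9 := distBd_le_add Ω (γ (2 * J * δ)) y
  have h10 := distBd_le_add Ω w (γ (2 * J * δ))
  have h11 := distBd_le_add Ω (γ (2 * J * δ)) w
  rw [dist_comm] at h11
  rw [mem_ball] at hw
  exact ⟨ball_subset_of_le_distBd H.isOpen (h2 _ ht) (by linarith) hw, by linarith, by linarith⟩

end IsJohnWith

lemma mul_volume_le_of_forall_ball {A F : Set (Euc n)} (hA : MeasurableSet A)
    {c : ℝ≥0∞} {r : ℝ} (h : ∀ y ∈ A, c ≤ volume (F ∩ ball y r)) :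
    c * volume A ≤ volume (ball (0 : Euc n) r) * volume F := by
  have hS : MeasurableSet {z : Euc n × Euc n | dist z.2 z.1 < r} :=
    measurableSet_lt (measurable_snd.dist measurable_fst) measurable_const
  calc c * volume A = ∫⁻ _y in A, c := by rw [setLIntegral_const]
    _ ≤ ∫⁻ y in A, ∫⁻ w in F, {z : Euc n × Euc n | dist z.2 z.1 < r}.indicator (1 : Euc n × Euc n → ℝ≥0∞) (y, w) := by
        refine setLIntegral_mono' hA fun y hy => (h y hy).trans (le_of_eq ?_)
        have : ∀ w, {z : Euc n × Euc n | dist z.2 z.1 < r}.indicator (1 : Euc n × Euc n → ℝ≥0∞) (y, w) =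
            (ball y r).indicator 1 w := fun w => rfl
        simp only [this]
        rw [lintegral_indicator_one measurableSet_ball, Measure.restrict_apply measurableSet_ball,
          inter_comm]
    _ = ∫⁻ w in F, ∫⁻ y in A, {z : Euc n × Euc n | dist z.2 z.1 < r}.indicator (1 : Euc n × Euc n → ℝ≥0∞) (y, w) :=
        lintegral_lintegral_swap (measurable_one.indicator hS).aemeasurable
    _ ≤ ∫⁻ _w in F, volume (ball (0 : Euc n) r) := by
        refine lintegral_mono fun w => ?_
        have : ∀ y, {z : Euc n × Euc n | dist z.2 z.1 < r}.indicator (1 : Euc n × Euc n → ℝ≥0∞) (y, w) =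
            (ball w r).indicator 1 y := fun y => by
          simp only [indicator, mem_ofPred_eq, mem_ball, dist_comm w y, Pi.one_apply]
        simp only [this]
        rw [lintegral_indicator_one measurableSet_ball, ← Measure.addHaar_ball_center volume w r]
        exact Measure.restrict_apply_le _ _
    _ = _ := by rw [setLIntegral_const]

lemma IsJohnWith.volume_step (H : IsJohnWith Ω J x₀) {δ : ℝ} (hδ : 0 < δ)
    (hδ0 : (2 * J + 1) * δ ≤ distBd Ω x₀) (z : Euc n) (R : ℝ) :
    (1 + ENNReal.ofReal ((2 * J + 1) ^ n)) * volume ({y ∈ Ω | distBd Ω y < δ} ∩ ball z R) ≤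
      ENNReal.ofReal ((2 * J + 1) ^ n) * volume ({y ∈ Ω | distBd Ω y < (2 * J + 2) * δ} ∩
        ball z (R + (2 * J + 1) * δ)) := by
  have hJ := H.one_lt
  have hmd := measurable_distBd Ω
  have hmΩ := H.isOpen.measurableSet
  set A := {y ∈ Ω | distBd Ω y < δ} ∩ ball z R with hA
  set F := {y ∈ Ω | δ ≤ distBd Ω y ∧ distBd Ω y < (2 * J + 2) * δ} ∩
    ball z (R + (2 * J + 1) * δ) with hF
  set G := {y ∈ Ω | distBd Ω y < (2 * J + 2) * δ} ∩ ball z (R + (2 * J + 1) * δ) with hG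
  have hAm : MeasurableSet A :=
    (hmΩ.inter (measurableSet_lt hmd measurable_const)).inter measurableSet_ball
  have hFm : MeasurableSet F := (hmΩ.inter ((measurableSet_le measurable_const hmd).inter
    (measurableSet_lt hmd measurable_const))).inter measurableSet_ball
  have h1 : volume (ball (0 : Euc n) δ) * volume A ≤
      volume (ball (0 : Euc n) ((2 * J + 1) * δ)) * volume F := by
    refine mul_volume_le_of_forall_ball hAm fun y hy => ?_
    obtain ⟨y', hy', hb⟩ := H.exists_ball hy.1.1 hδ hy.1.2 hδ0
    rw [← Measure.addHaar_ball_center volume y' δ]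
    refine measure_mono fun w hw => ?_
    have hwy : dist w y < (2 * J + 1) * δ := by
      have := dist_triangle w y' y
      rw [mem_ball] at hw
      linarith
    refine ⟨⟨hb w hw, ?_⟩, hwy⟩
    have h2 := hy.2
    have h3 := dist_triangle w y z
    rw [mem_ball] at h2 ⊢
    linarith
  rw [Measure.addHaar_ball_of_pos _ _ hδ, Measure.addHaar_ball_of_pos volume _
    (show 0 < (2 * J + 1) * δ by positivity), mul_pow, ENNReal.ofReal_mul (by positivity),
    finrank_euclideanSpace, Fintype.card_fin] at h1
  set Γ := ENNReal.ofReal ((2 * J + 1) ^ n) with hΓ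
  set B := volume (ball (0 : Euc n) 1) with hB
  set D := ENNReal.ofReal (δ ^ n) with hD
  have hD0 : D * B ≠ 0 := mul_ne_zero (ENNReal.ofReal_pos.2 (by positivity)).ne'
    (measure_ball_pos _ _ one_pos).ne'
  have hDt : D * B ≠ ⊤ := ENNReal.mul_ne_top ENNReal.ofReal_ne_top measure_ball_lt_top.ne
  have h2 : volume A ≤ Γ * volume F := by
    rw [← ENNReal.mul_le_mul_iff_right hD0 hDt]
    exact h1.trans (le_of_eq (by ring))
  have hdisj : Disjoint A F := disjoint_left.2 fun y hy hy' => absurd hy.1.2 (not_lt.2 hy'.1.2.1)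
  have hsub : A ∪ F ⊆ G := by
    rintro y (hy | hy)
    · exact ⟨⟨hy.1.1, hy.1.2.trans_le (le_mul_of_one_le_left hδ.le (by linarith))⟩,
        ball_subset_ball (le_add_of_nonneg_right (by positivity)) hy.2⟩
    · exact ⟨⟨hy.1.1, hy.1.2.2⟩, hy.2⟩
  calc (1 + Γ) * volume A = volume A + Γ * volume A := by ring
    _ ≤ Γ * volume F + Γ * volume A := add_le_add_left h2 _
    _ = Γ * volume (A ∪ F) := by rw [measure_union hdisj hFm]; ring
    _ ≤ Γ * volume G := mul_le_mul_right (measure_mono hsub) _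

lemma IsJohnWith.volume_iter (H : IsJohnWith Ω J x₀) {δ : ℝ} (hδ : 0 < δ)
    (hδ0 : (2 * J + 1) * δ ≤ distBd Ω x₀) (z : Euc n) (R : ℝ) (j : ℕ) :
    volume ({y ∈ Ω | distBd Ω y < δ / (2 * J + 2) ^ j} ∩ ball z (R + δ / (2 * J + 2) ^ j)) ≤
      (ENNReal.ofReal ((2 * J + 1) ^ n) / (1 + ENNReal.ofReal ((2 * J + 1) ^ n))) ^ j *
        volume (ball z (R + δ)) := by
  have hJ := H.one_lt
  induction j with
  | zero =>
    simp only [pow_zero, div_one, one_mul]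
    exact measure_mono inter_subset_right
  | succ j ih =>
    set K := 2 * J + 2 with hK
    have hK0 : 0 < K := by linarith
    have h1 : (2 * J + 1) * (δ / K ^ (j + 1)) ≤ distBd Ω x₀ := by
      refine le_trans (mul_le_mul_of_nonneg_left (div_le_self hδ.le (one_le_pow₀ (by linarith)))
        (by linarith)) hδ0
    have h2 := H.volume_step (δ := δ / K ^ (j + 1)) (by positivity) h1 z (R + δ / K ^ (j + 1))
    have h3 : K * (δ / K ^ (j + 1)) = δ / K ^ j := by
      rw [pow_succ]
      field_simp
    have h4 : R + δ / K ^ (j + 1) + (2 * J + 1) * (δ / K ^ (j + 1)) = R + δ / K ^ j := by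
      rw [← h3, hK]
      ring
    rw [← hK, h3, h4] at h2
    rw [pow_succ' (_ / _), mul_assoc]
    refine le_trans ?_ (mul_le_mul_right ih _)
    rw [mul_comm] at h2
    rw [← ENNReal.mul_div_right_comm]
    exact (ENNReal.le_div_iff_mul_le (Or.inl (by simp)) (Or.inl (by simp))).2 h2

/-- Negative powers of the boundary distance are integrable on balls, with a scale invariant
bound. -/
theorem IsJohnWith.exists_setLIntegral_rpow_neg_le (H : IsJohnWith Ω J x₀) :
    ∃ s : ℝ, 0 < s ∧ ∃ C : ℝ≥0∞, C ≠ ⊤ ∧ ∀ (δ : ℝ), 0 < δ → (2 * J + 1) * δ ≤ distBd Ω x₀ →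
      ∀ (z : Euc n) (R : ℝ), ∫⁻ y in Ω ∩ ball z R, ENNReal.ofReal (distBd Ω y ^ (-s)) ≤
        C * ENNReal.ofReal (δ ^ (-s)) * volume (ball z (R + δ)) := by
  have hJ := H.one_lt
  set g : ℝ := (2 * J + 1) ^ n with hg
  have hg0 : 0 < g := by positivity
  set K := 2 * J + 2 with hK
  have hK1 : 1 < K := by linarith
  have hK0 : 0 < K := by linarith
  set κ : ℝ := 1 + 1 / (2 * g) with hκ
  have hκ1 : 1 < κ := by
    rw [hκ]
    exact lt_add_of_pos_right _ (by positivity)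
  have hs : K ^ Real.logb K κ = κ := Real.rpow_logb hK0 hK1.ne' (by linarith)
  have hs0 : 0 < Real.logb K κ := Real.logb_pos hK1 hκ1
  set s := Real.logb K κ with hsdef
  set θ := ENNReal.ofReal g / (1 + ENNReal.ofReal g) with hθ
  have hθr : θ = ENNReal.ofReal (g / (1 + g)) := by
    rw [ENNReal.ofReal_div_of_pos (by positivity), ENNReal.ofReal_add zero_le_one hg0.le,
      ENNReal.ofReal_one]
  have hκθ : ENNReal.ofReal κ * θ < 1 := by
    rw [hθr, ← ENNReal.ofReal_mul (by linarith), ENNReal.ofReal_lt_one, hκ]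
    have : (1 + 1 / (2 * g)) * (g / (1 + g)) = (g + 1 / 2) / (1 + g) := by
      field_simp
    rw [this, div_lt_one (by positivity)]
    linarith
  set T : ℝ≥0∞ := ∑' j : ℕ, ENNReal.ofReal κ ^ (j + 1) * θ ^ j with hT
  have hTf : T ≠ ⊤ := by
    have : ∀ j : ℕ, ENNReal.ofReal κ ^ (j + 1) * θ ^ j =
        ENNReal.ofReal κ * (ENNReal.ofReal κ * θ) ^ j := fun j => by ring
    simp only [hT, this]
    rw [ENNReal.tsum_mul_left, ENNReal.tsum_geometric]
    exact ENNReal.mul_ne_top ENNReal.ofReal_ne_top (ENNReal.inv_ne_top.2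
      (tsub_pos_of_lt hκθ).ne')
  refine ⟨s, hs0, 1 + T, ENNReal.add_ne_top.2 ⟨ENNReal.one_ne_top, hTf⟩,
    fun δ hδ hδ0 z R => ?_⟩
  have hmd := measurable_distBd Ω
  have hmΩ := H.isOpen.measurableSet
  set E : ℕ → Set (Euc n) := fun j =>
    {y ∈ Ω | distBd Ω y < δ / K ^ j} ∩ ball z (R + δ / K ^ j) with hE
  have hEm : ∀ j, MeasurableSet (E j) := fun j =>
    (hmΩ.inter (measurableSet_lt hmd measurable_const)).inter measurableSet_ball
  have hpt : ∀ y ∈ Ω ∩ ball z R, ENNReal.ofReal (distBd Ω y ^ (-s)) ≤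
      ENNReal.ofReal (δ ^ (-s)) *
        (1 + ∑' j : ℕ, ENNReal.ofReal κ ^ (j + 1) * (E j).indicator 1 y) := fun y hy => by
    have hρ := H.distBd_pos hy.1
    rcases le_or_gt δ (distBd Ω y) with h | h
    · refine le_trans (ENNReal.ofReal_le_ofReal ?_) (le_mul_of_one_le_right' le_self_add)
      exact Real.rpow_le_rpow_of_nonpos hδ h (by linarith)
    obtain ⟨j, hj1, hj2⟩ : ∃ j : ℕ, distBd Ω y < δ / K ^ j ∧ δ / K ^ (j + 1) ≤ distBd Ω y := by
      by_contra! hcon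
      have hall : ∀ j : ℕ, distBd Ω y < δ / K ^ j := fun j => by
        induction j with
        | zero => simpa using h
        | succ j ih => exact hcon j ih
      obtain ⟨j, hj⟩ := pow_unbounded_of_one_lt (δ / distBd Ω y) hK1
      rw [div_lt_iff₀ hρ] at hj
      have := hall j
      rw [lt_div_iff₀ (by positivity)] at this
      linarith
    have h1 : distBd Ω y ^ (-s) ≤ δ ^ (-s) * κ ^ (j + 1) := by
      refine (Real.rpow_le_rpow_of_nonpos (by positivity) hj2 (by linarith)).trans (le_of_eq ?_)
      rw [Real.div_rpow hδ.le (by positivity), Real.rpow_neg (by positivity : 0 ≤ K ^ (j + 1)),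
        div_inv_eq_mul, ← Real.rpow_natCast, ← Real.rpow_mul hK0.le, mul_comm _ s,
        Real.rpow_mul hK0.le, hs, Real.rpow_natCast]
    have h3 : y ∈ E j := ⟨⟨hy.1, hj1⟩, ball_subset_ball (le_add_of_nonneg_right (by positivity)) hy.2⟩
    refine (ENNReal.ofReal_le_ofReal h1).trans ?_
    rw [ENNReal.ofReal_mul (by positivity), ENNReal.ofReal_pow (by linarith)]
    refine mul_le_mul_right (le_add_left ?_) _
    refine le_trans (le_of_eq ?_) (ENNReal.le_tsum j)
    rw [indicator_of_mem h3, Pi.one_apply, mul_one]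
  have hEind : ∀ j, Measurable ((E j).indicator (1 : Euc n → ℝ≥0∞)) := fun j =>
    measurable_one.indicator (hEm j)
  refine (setLIntegral_mono' (hmΩ.inter measurableSet_ball) hpt).trans ?_
  rw [lintegral_const_mul' _ _ ENNReal.ofReal_ne_top, lintegral_add_left measurable_const,
    setLIntegral_const, one_mul, lintegral_tsum fun j => ((hEind j).const_mul _).aemeasurable]
  rw [mul_comm (1 + T), mul_assoc]
  refine mul_le_mul_right ?_ _
  rw [add_mul, one_mul]
  refine add_le_add (measure_mono (inter_subset_right.trans
    (ball_subset_ball (le_add_of_nonneg_right hδ.le)))) ?_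
  rw [hT, ← ENNReal.tsum_mul_right]
  refine ENNReal.tsum_le_tsum fun j => ?_
  rw [lintegral_const_mul' _ _ (ENNReal.pow_ne_top ENNReal.ofReal_ne_top),
    lintegral_indicator_one (hEm j), mul_assoc]
  exact mul_le_mul_right ((Measure.restrict_apply_le _ _).trans (H.volume_iter hδ hδ0 z R j)) _

end Porosity

section Chain

variable {n : ℕ} {Ω : Set (Euc n)} {J : ℝ} {x₀ : Euc n}

lemma IsJohnWith.exists_scaled_lintegral_le (H : IsJohnWith Ω J x₀) : ∃ s : ℝ, 0 < s ∧
    ∀ N : ℝ, 0 < N → ∃ C : ℝ≥0∞, C ≠ ⊤ ∧ ∀ z ∈ Ω,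
      ∫⁻ y in Ω ∩ ball z (N * distBd Ω z), ENNReal.ofReal (distBd Ω y ^ (-s)) ≤
        C * ENNReal.ofReal (distBd Ω z ^ (n - s)) := by
  obtain ⟨s, hs, C, hC, h⟩ := H.exists_setLIntegral_rpow_neg_le
  have hJ := H.one_lt
  refine ⟨s, hs, fun N hN => ?_⟩
  set c : ℝ := ((2 * J + 1) * (1 + J))⁻¹ with hc
  have hc0 : 0 < c := inv_pos.2 (mul_pos (by linarith) (by linarith))
  refine ⟨C * ENNReal.ofReal (c ^ (-s) * (N + c) ^ n) * volume (ball (0 : Euc n) 1),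
    ENNReal.mul_ne_top (ENNReal.mul_ne_top hC ENNReal.ofReal_ne_top) measure_ball_lt_top.ne,
    fun z hz => ?_⟩
  have hρ := H.distBd_pos hz
  have h1 : (2 * J + 1) * (c * distBd Ω z) ≤ distBd Ω x₀ := by
    have h2 := H.distBd_le hz
    have h3 : (2 * J + 1) * (c * distBd Ω z) = distBd Ω z / (1 + J) := by
      rw [hc]
      field_simp
    rw [h3, div_le_iff₀ (by linarith)]
    linarith
  refine (h _ (mul_pos hc0 hρ) h1 z (N * distBd Ω z)).trans (le_of_eq ?_)
  rw [Measure.addHaar_ball_of_pos volume _ (show 0 < N * distBd Ω z + c * distBd Ω z by positivity),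
    finrank_euclideanSpace, Fintype.card_fin, ← add_mul, mul_pow, Real.mul_rpow hc0.le hρ.le,
    sub_eq_add_neg, Real.rpow_add hρ, Real.rpow_natCast]
  rw [ENNReal.ofReal_mul (by positivity), ENNReal.ofReal_mul (by positivity),
    ENNReal.ofReal_mul (by positivity), ENNReal.ofReal_mul (by positivity)]
  ring

lemma inv_pow_le_weight (n : ℕ) {s a b T c : ℝ} (hs : 0 ≤ s) (ha : 0 < a) (hT : 0 < T)
    (hTa : T ≤ c * a) (hab : a ≤ 4 * b) (hba : b ≤ 2 * a) :
    (a ^ n)⁻¹ ≤ 4 ^ s * c ^ s * 2 ^ n * T ^ (-s) * b ^ (s - n) := by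
  have hb : 0 < b := by linarith
  have hc : 0 < c := pos_of_mul_pos_left (hT.trans_le hTa) ha.le
  have h1 : T ^ s ≤ 4 ^ s * c ^ s * b ^ s := by
    rw [← Real.mul_rpow (by norm_num) hc.le, ← Real.mul_rpow (by positivity) hb.le]
    refine Real.rpow_le_rpow hT.le (hTa.trans ?_) hs
    linarith [mul_le_mul_of_nonneg_left hab hc.le]
  have h2 : b ^ n ≤ 2 ^ n * a ^ n := by
    rw [← mul_pow]
    exact pow_le_pow_left₀ hb.le hba n
  rw [Real.rpow_neg hT.le, Real.rpow_sub hb, Real.rpow_natCast]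
  have h3 : (4 : ℝ) ^ s * c ^ s * 2 ^ n * (T ^ s)⁻¹ * (b ^ s / b ^ n) =
      (4 ^ s * c ^ s * b ^ s / T ^ s) * (2 ^ n / b ^ n) := by
    ring
  rw [h3]
  have h4 : 1 ≤ 4 ^ s * c ^ s * b ^ s / T ^ s := (one_le_div (by positivity)).2 h1
  have h5 : (a ^ n)⁻¹ ≤ 2 ^ n / b ^ n := by
    rw [le_div_iff₀ (by positivity), inv_mul_le_iff₀ (by positivity)]
    linarith
  exact h5.trans (le_mul_of_one_le_left (by positivity) h4)

/-- The part of a weighted integral seen from `y` in a John domain. -/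
def chainMass (Ω : Set (Euc n)) (f : Euc n → ℝ≥0∞) (N s : ℝ) (y : Euc n) : ℝ≥0∞ :=
  ∫⁻ z in {z ∈ Ω | dist z y < N * distBd Ω z}, f z * ENNReal.ofReal (distBd Ω z ^ (s - n))

lemma IsJohnWith.lintegral_le_chainMass (H : IsJohnWith Ω J x₀) {s : ℝ} (hs : 0 ≤ s)
    (f : Euc n → ℝ≥0∞) {x y : Euc n} (hx : x ∈ Ω) (hxy : dist x y ≤ J * distBd Ω x) {T c : ℝ}
    (hT : 0 < T) (hTx : T ≤ c * distBd Ω x) :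
    ENNReal.ofReal ((distBd Ω x ^ n)⁻¹) * ∫⁻ z in ball x (distBd Ω x * (3 / 4)), f z ≤
      ENNReal.ofReal (4 ^ s * c ^ s * 2 ^ n * T ^ (-s)) * chainMass Ω f (4 * (1 + J)) s y := by
  have hρ := H.distBd_pos hx
  have hJ := H.one_lt
  have hc : 0 < c := pos_of_mul_pos_left (hT.trans_le hTx) hρ.le
  have hmem : ∀ z ∈ ball x (distBd Ω x * (3 / 4)), distBd Ω x ≤ 4 * distBd Ω z ∧
      distBd Ω z ≤ 2 * distBd Ω x ∧ z ∈ {z ∈ Ω | dist z y < 4 * (1 + J) * distBd Ω z} :=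
    fun z hz => by
    have hzb := hz
    rw [mem_ball] at hz
    have h1 := distBd_le_add Ω x z
    have h2 := distBd_le_add Ω z x
    rw [dist_comm] at h1
    have h3 : distBd Ω x ≤ 4 * distBd Ω z := by linarith
    refine ⟨h3, by linarith, ball_subset_of_le_distBd H.isOpen hx (by linarith) hzb, ?_⟩
    have h4 := dist_triangle z x y
    have h5 := mul_le_mul_of_nonneg_left h3 (show 0 ≤ 1 + J by linarith)
    linarith
  rw [← lintegral_const_mul' _ _ ENNReal.ofReal_ne_top, chainMass,
    ← lintegral_const_mul' _ _ ENNReal.ofReal_ne_top]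
  refine (setLIntegral_mono' measurableSet_ball fun z hz => ?_).trans
    (lintegral_mono_set fun z hz => (hmem z hz).2.2)
  obtain ⟨h1, h2, -⟩ := hmem z hz
  rw [mul_left_comm, mul_comm, ← ENNReal.ofReal_mul (by positivity)]
  exact mul_le_mul_right (ENNReal.ofReal_le_ofReal (inv_pow_le_weight n hs hρ hT hTx h1 h2)) _

lemma affMatrix_sub (P Q : AffCoef n) (x : Euc n) :
    affMatrix (P - Q) x = affMatrix P x - affMatrix Q x := by
  ext i j
  simp only [affMatrix_apply, affMat, Matrix.sub_apply, Prod.fst_sub, Prod.snd_sub, Pi.sub_apply,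
    sub_mul, Finset.sum_sub_distrib]
  ring

lemma measurable_entrySum {D : Euc n → Matrix (Fin n) (Fin n) ℝ}
    (hD : ∀ i j, Measurable fun z => D z i j) : Measurable fun z => entrySum (D z) :=
  Finset.measurable_fun_sum _ fun i _ => Finset.measurable_fun_sum _ fun j _ => (hD i j).enorm

lemma measurable_affMatrix (Q : AffCoef n) (i j : Fin n) : Measurable fun z => affMatrix Q z i j :=
  (continuous_affMat Q i j).measurable

lemma entrySum_sub_rpow_le {p : ℝ} (hp : 1 ≤ p) (A B C : Matrix (Fin n) (Fin n) ℝ) :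
    entrySum (A - C) ^ p ≤ 2 ^ (p - 1) * (entrySum (A - B) ^ p + entrySum (B - C) ^ p) := by
  refine le_trans (ENNReal.rpow_le_rpow ?_ (by linarith)) (ENNReal.rpow_add_le_mul_rpow_add_rpow _ _ hp)
  rw [← sub_add_sub_cancel A B C]
  exact entrySum_add_le _ _

lemma entrySum_sub_comm (A B : Matrix (Fin n) (Fin n) ℝ) : entrySum (A - B) = entrySum (B - A) := by
  rw [← neg_sub, entrySum_neg]

/-- Affine fields that approximate the same matrix field near neighbouring points are close. -/
lemma IsJohnWith.exists_step_bound (H : IsJohnWith Ω J x₀) {p : ℝ} (hp : 1 ≤ p) :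
    ∃ C : ℝ≥0∞, C ≠ ⊤ ∧ ∀ (D : Euc n → Matrix (Fin n) (Fin n) ℝ) (f : Euc n → ℝ≥0∞)
      (Q : Euc n → AffCoef n) (C₁ : ℝ≥0∞), (∀ i j, Measurable fun z => D z i j) →
      (∀ x ∈ Ω, ∫⁻ z in ball x (distBd Ω x / 8), entrySum (D z - affMatrix (Q x) z) ^ p ≤
        C₁ * ∫⁻ z in ball x (distBd Ω x / 2), f z) →
      ∀ x ∈ Ω, ∀ x' ∈ Ω, dist x' x ≤ distBd Ω x / 32 → ∀ z,
        entrySum (affMatrix (Q x') z - affMatrix (Q x) z) ^ p ≤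
          C * C₁ * ENNReal.ofReal (1 + dist z x / distBd Ω x) ^ p *
            (ENNReal.ofReal ((distBd Ω x ^ n)⁻¹) * ∫⁻ z in ball x (distBd Ω x * (3 / 4)), f z) := by
  obtain ⟨K, hK, hKb⟩ := exists_affMatrix_bound n hp
  have hp0 : 0 ≤ p := by linarith
  refine ⟨ENNReal.ofReal (16 ^ n) * K * ENNReal.ofReal 16 ^ p * (2 ^ (p - 1) * 2),
    ENNReal.mul_ne_top (ENNReal.mul_ne_top (ENNReal.mul_ne_top ENNReal.ofReal_ne_top hK)
      (ENNReal.rpow_ne_top_of_nonneg hp0 ENNReal.ofReal_ne_top)) (ENNReal.mul_ne_top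
        (ENNReal.rpow_ne_top_of_nonneg (by linarith) (by simp)) (by simp)),
    fun D f Q C₁ hD hloc x hx x' hx' hxx z => ?_⟩
  have hρ := H.distBd_pos hx
  set ρ := distBd Ω x with hρdef
  have h1 := distBd_le_add Ω x x'
  have h2 := distBd_le_add Ω x' x
  rw [dist_comm] at h1
  set A := ∫⁻ z in ball x (ρ * (3 / 4)), f z with hA
  have hI : ∫⁻ y in ball x (ρ / 16), entrySum (affMatrix (Q x' - Q x) y) ^ p ≤
      2 ^ (p - 1) * 2 * (C₁ * A) := by
    have hle : ∀ y, entrySum (affMatrix (Q x' - Q x) y) ^ p ≤ 2 ^ (p - 1) *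
        (entrySum (D y - affMatrix (Q x') y) ^ p + entrySum (D y - affMatrix (Q x) y) ^ p) :=
      fun y => by
      rw [affMatrix_sub, entrySum_sub_comm (D y) (affMatrix (Q x') y)]
      exact entrySum_sub_rpow_le hp _ _ _
    have hm : Measurable fun y => entrySum (D y - affMatrix (Q x') y) ^ p :=
      (measurable_entrySum fun i j => (hD i j).sub (measurable_affMatrix _ i j)).pow_const p
    refine (lintegral_mono hle).trans ?_
    rw [lintegral_const_mul' _ _ (ENNReal.rpow_ne_top_of_nonneg (by linarith) (by simp)),
      lintegral_add_left hm, mul_assoc, two_mul]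
    refine mul_le_mul_right (add_le_add ?_ ?_) _
    · refine (lintegral_mono_set (ball_subset_ball' ?_)).trans ((hloc x' hx').trans
        (mul_le_mul_right (lintegral_mono_set (ball_subset_ball' ?_)) _))
      · rw [dist_comm]
        linarith
      · linarith
    · exact (lintegral_mono_set (ball_subset_ball (by linarith))).trans ((hloc x hx).trans
        (mul_le_mul_right (lintegral_mono_set (ball_subset_ball (by linarith))) _))
  have h3 := hKb (Q x' - Q x) x z (ρ / 16) (by positivity)
  have h4 : ENNReal.ofReal (1 + dist z x / (ρ / 16)) ^ p ≤
      ENNReal.ofReal 16 ^ p * ENNReal.ofReal (1 + dist z x / ρ) ^ p := by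
    rw [← ENNReal.mul_rpow_of_nonneg _ _ hp0, ← ENNReal.ofReal_mul (by norm_num)]
    refine ENNReal.rpow_le_rpow (ENNReal.ofReal_le_ofReal ?_) hp0
    have : dist z x / (ρ / 16) = 16 * (dist z x / ρ) := by
      field_simp
    linarith
  have h5 : ENNReal.ofReal ((ρ / 16) ^ n) * (ENNReal.ofReal (16 ^ n) * ENNReal.ofReal ((ρ ^ n)⁻¹)) = 1 := by
    rw [← ENNReal.ofReal_mul (by positivity), ← ENNReal.ofReal_mul (by positivity), div_pow,
      ENNReal.ofReal_eq_one]
    field_simp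
  rw [← affMatrix_sub]
  calc entrySum (affMatrix (Q x' - Q x) z) ^ p
      = entrySum (affMatrix (Q x' - Q x) z) ^ p * ENNReal.ofReal ((ρ / 16) ^ n) *
          (ENNReal.ofReal (16 ^ n) * ENNReal.ofReal ((ρ ^ n)⁻¹)) := by rw [mul_assoc, h5, mul_one]
    _ ≤ K * (ENNReal.ofReal 16 ^ p * ENNReal.ofReal (1 + dist z x / ρ) ^ p) *
          (2 ^ (p - 1) * 2 * (C₁ * A)) * (ENNReal.ofReal (16 ^ n) * ENNReal.ofReal ((ρ ^ n)⁻¹)) :=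
        mul_le_mul_left (h3.trans (mul_le_mul' (mul_le_mul_right h4 _) hI)) _
    _ = _ := by ring

end Chain

section ChainSum

variable {n : ℕ} {Ω : Set (Euc n)} {J : ℝ} {x₀ : Euc n}

/-- A chain of points along a John curve, with geometrically growing steps. -/
lemma IsJohnWith.exists_chain (H : IsJohnWith Ω J x₀) {y : Euc n} (hy : y ∈ Ω) :
    ∃ x : ℕ → Euc n, x 0 = y ∧ (∃ m, x m = x₀) ∧ (∀ k, x k ∈ Ω) ∧ ∀ k, x (k + 1) = x k ∨
      (dist (x (k + 1)) (x k) ≤ distBd Ω (x k) / 32 ∧ dist (x k) y ≤ J * distBd Ω (x k) ∧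
        distBd Ω y + dist (x k) y ≤ distBd Ω y * (1 + (32 * (1 + 2 * J))⁻¹) ^ k ∧
        distBd Ω y * (1 + (32 * (1 + 2 * J))⁻¹) ^ k ≤ (1 + 2 * J) * distBd Ω (x k)) := by
  obtain ⟨L, hL, γ, h0, h1, h2, h3, h4⟩ := H.curve y hy
  have hJ := H.one_lt
  have hρ := H.distBd_pos hy
  set ρ := distBd Ω y with hρdef
  set μ : ℝ := (32 * (1 + 2 * J))⁻¹ with hμ
  have hμ0 : 0 < μ := inv_pos.2 (by linarith)
  have hμ1 : μ * (1 + 2 * J) = 1 / 32 := by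
    rw [hμ]
    field_simp
  set t : ℕ → ℝ := fun k => ρ * ((1 + μ) ^ k - 1) with ht
  have ht0 : ∀ k, 0 ≤ t k := fun k =>
    mul_nonneg hρ.le (sub_nonneg.2 (one_le_pow₀ (by linarith)))
  have hts : ∀ k, t (k + 1) = t k + μ * (ρ * (1 + μ) ^ k) := fun k => by
    simp only [ht]
    ring
  have hmem : ∀ k, min L (t k) ∈ Icc 0 L := fun k => ⟨le_min hL (ht0 k), min_le_left _ _⟩
  refine ⟨fun k => γ (min L (t k)), ?_, ?_, fun k => h2 _ (hmem k), fun k => ?_⟩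
  · simp only [ht, pow_zero, sub_self, mul_zero, min_eq_right hL, h0]
  · obtain ⟨m, hm⟩ := pow_unbounded_of_one_lt (L / ρ + 1) (show 1 < 1 + μ by linarith)
    refine ⟨m, ?_⟩
    have h5 : L ≤ t m := by
      have h6 : L / ρ ≤ (1 + μ) ^ m - 1 := by linarith
      rw [div_le_iff₀ hρ] at h6
      simp only [ht]
      linarith
    simp only [min_eq_left h5, h1]
  · have htm : t k ≤ t (k + 1) := by
      rw [hts]
      exact le_add_of_nonneg_right (by positivity)
    rcases le_or_gt L (t k) with h | h
    · left
      simp only [min_eq_left h, min_eq_left (h.trans htm)]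
    right
    simp only [min_eq_right h.le]
    have hk : t k ∈ Icc 0 L := ⟨ht0 k, h.le⟩
    have h5 := h3 _ hk 0 ⟨le_rfl, hL⟩
    rw [h0, sub_zero, abs_of_nonneg (ht0 k)] at h5
    have h6 := h4 _ hk
    rw [div_le_iff₀ (by linarith)] at h6
    have h7 := h3 _ (hmem (k + 1)) _ hk
    have h8 : |min L (t (k + 1)) - t k| ≤ μ * (ρ * (1 + μ) ^ k) := by
      rw [abs_of_nonneg (sub_nonneg.2 (le_min h.le htm)), sub_le_iff_le_add, add_comm (μ * _), ← hts]
      exact min_le_right _ _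
    have h9 := distBd_le_add Ω y (γ (t k))
    rw [dist_comm] at h9
    have h10 : ρ * (1 + μ) ^ k = ρ + t k := by
      simp only [ht]
      ring
    have h11 : ρ * (1 + μ) ^ k ≤ (1 + 2 * J) * distBd Ω (γ (t k)) := by
      rw [h10]
      linarith
    refine ⟨?_, by linarith, by linarith, h11⟩
    have h12 := mul_le_mul_of_nonneg_left h11 hμ0.le
    have h13 : μ * ((1 + 2 * J) * distBd Ω (γ (t k))) = distBd Ω (γ (t k)) / 32 := by
      rw [← mul_assoc, hμ1]
      ring
    linarith

lemma entrySum_sub_le_sum (A : ℕ → Matrix (Fin n) (Fin n) ℝ) (m : ℕ) :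
    entrySum (A m - A 0) ≤ ∑ k ∈ Finset.range m, entrySum (A (k + 1) - A k) := by
  induction m with
  | zero => simp [entrySum]
  | succ m ih =>
    rw [Finset.sum_range_succ, ← sub_add_sub_cancel (A (m + 1)) (A m) (A 0), add_comm]
    exact (entrySum_add_le _ _).trans (add_le_add_left ih _)

/-- Along John chains, local approximations stay close to the one at the centre. -/
theorem IsJohnWith.exists_chain_bound (H : IsJohnWith Ω J x₀) {p s : ℝ} (hp : 1 ≤ p)
    (hs : 0 < s) : ∃ C : ℝ≥0∞, C ≠ ⊤ ∧ ∀ (D : Euc n → Matrix (Fin n) (Fin n) ℝ)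
      (f : Euc n → ℝ≥0∞) (Q : Euc n → AffCoef n) (C₁ : ℝ≥0∞),
      (∀ i j, Measurable fun z => D z i j) →
      (∀ x ∈ Ω, ∫⁻ z in ball x (distBd Ω x / 8), entrySum (D z - affMatrix (Q x) z) ^ p ≤
        C₁ * ∫⁻ z in ball x (distBd Ω x / 2), f z) →
      ∀ y ∈ Ω, ∀ z ∈ ball y (distBd Ω y / 8),
        entrySum (affMatrix (Q x₀) z - affMatrix (Q y) z) ^ p ≤
          C * C₁ * ENNReal.ofReal (distBd Ω y ^ (-s)) * chainMass Ω f (4 * (1 + J)) s y := by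
  obtain ⟨C, hC, hstep⟩ := H.exists_step_bound hp
  have hJ := H.one_lt
  have hp0 : 0 < p := by linarith
  set c : ℝ := 1 + 2 * J with hc
  set l : ℝ := 1 + (32 * c)⁻¹ with hl
  have hl1 : 1 < l := by
    rw [hl]
    exact lt_add_of_pos_right _ (inv_pos.2 (by linarith))
  set W : ℝ := 4 ^ s * c ^ s * 2 ^ n with hW
  have hW0 : 0 ≤ W := by positivity
  set μ : ℝ≥0∞ := ENNReal.ofReal (l ^ (-s)) ^ p⁻¹ with hμ
  have hμ1 : μ < 1 := ENNReal.rpow_lt_one (ENNReal.ofReal_lt_one.2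
    (Real.rpow_lt_one_of_one_lt_of_neg hl1 (by linarith))) (inv_pos.2 hp0)
  refine ⟨C * ENNReal.ofReal (1 + c) ^ p * ENNReal.ofReal W * ((1 - μ)⁻¹) ^ p,
    ENNReal.mul_ne_top (ENNReal.mul_ne_top (ENNReal.mul_ne_top hC
      (ENNReal.rpow_ne_top_of_nonneg hp0.le ENNReal.ofReal_ne_top)) ENNReal.ofReal_ne_top)
      (ENNReal.rpow_ne_top_of_nonneg hp0.le (ENNReal.inv_ne_top.2 (tsub_pos_of_lt hμ1).ne')),
    fun D f Q C₁ hD hloc y hy z hz => ?_⟩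
  obtain ⟨x, hx0, ⟨m, hm⟩, hxΩ, hx⟩ := H.exists_chain hy
  have hρ := H.distBd_pos hy
  set B := C * C₁ * ENNReal.ofReal (1 + c) ^ p * (ENNReal.ofReal W *
    ENNReal.ofReal (distBd Ω y ^ (-s)) * chainMass Ω f (4 * (1 + J)) s y) with hB
  have hd : ∀ k, entrySum (affMatrix (Q (x (k + 1))) z - affMatrix (Q (x k)) z) ≤
      B ^ p⁻¹ * μ ^ k := fun k => by
    rcases hx k with h | ⟨h1, h2, h3, h4⟩
    · rw [h, sub_self]
      simp [entrySum]
    have hρk := H.distBd_pos (hxΩ k)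
    set T := distBd Ω y * l ^ k with hT
    have hT0 : 0 < T := by positivity
    have h5 := hstep D f Q C₁ hD hloc _ (hxΩ k) _ (hxΩ (k + 1)) h1 z
    have h6 := H.lintegral_le_chainMass hs.le f (hxΩ k) h2 hT0 h4
    have h7 : 1 + dist z (x k) / distBd Ω (x k) ≤ 1 + c := by
      refine add_le_add le_rfl ((div_le_iff₀ hρk).2 ?_)
      have := dist_triangle z y (x k)
      rw [mem_ball] at hz
      rw [dist_comm y] at this
      linarith
    have h8 : ENNReal.ofReal (W * T ^ (-s)) =
        ENNReal.ofReal W * ENNReal.ofReal (distBd Ω y ^ (-s)) * ENNReal.ofReal (l ^ (-s)) ^ k := by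
      rw [← ENNReal.ofReal_pow (by positivity), ← ENNReal.ofReal_mul hW0,
        ← ENNReal.ofReal_mul (by positivity), hT, Real.mul_rpow hρ.le (by positivity),
        ← Real.rpow_natCast, ← Real.rpow_natCast, ← Real.rpow_mul (by positivity),
        ← Real.rpow_mul (by positivity), mul_comm (k : ℝ)]
      exact congrArg _ (by ring)
    rw [← hW, h8] at h6
    rw [← ENNReal.rpow_rpow_inv hp0.ne' (entrySum _)]
    have h9 : B ^ p⁻¹ * μ ^ k = (B * ENNReal.ofReal (l ^ (-s)) ^ k) ^ p⁻¹ := by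
      rw [ENNReal.mul_rpow_of_nonneg B _ (inv_pos.2 hp0).le, hμ, ← ENNReal.rpow_natCast,
        ← ENNReal.rpow_mul, ← ENNReal.rpow_natCast, ← ENNReal.rpow_mul _ _ p⁻¹, mul_comm p⁻¹]
    rw [h9]
    refine ENNReal.rpow_le_rpow (h5.trans ?_) (inv_pos.2 hp0).le
    refine (mul_le_mul' (mul_le_mul_right (ENNReal.rpow_le_rpow (ENNReal.ofReal_le_ofReal h7)
      hp0.le) _) h6).trans (le_of_eq ?_)
    rw [hB]
    ring
  have hsum : entrySum (affMatrix (Q x₀) z - affMatrix (Q y) z) ≤ B ^ p⁻¹ * (1 - μ)⁻¹ := by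
    have h1 := entrySum_sub_le_sum (fun k => affMatrix (Q (x k)) z) m
    simp only [hm, hx0] at h1
    refine h1.trans ((Finset.sum_le_sum fun k _ => hd k).trans ?_)
    rw [← Finset.mul_sum, ← ENNReal.tsum_geometric]
    exact mul_le_mul_right (ENNReal.sum_le_tsum _) _
  refine (ENNReal.rpow_le_rpow hsum hp0.le).trans (le_of_eq ?_)
  rw [ENNReal.mul_rpow_of_nonneg _ _ hp0.le, ENNReal.rpow_inv_rpow hp0.ne', hB]
  ring

end ChainSum

section GlobalBound

variable {n : ℕ} {Ω : Set (Euc n)} {J : ℝ} {x₀ : Euc n}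

/-- Integrals over the domain are controlled by averages over Whitney balls. -/
lemma IsJohnWith.exists_lintegral_le_average (H : IsJohnWith Ω J x₀) : ∃ C : ℝ≥0∞, C ≠ ⊤ ∧
    ∀ g : Euc n → ℝ≥0∞, Measurable g → ∫⁻ z in Ω, g z ≤
      C * ∫⁻ y in Ω, ENNReal.ofReal ((distBd Ω y ^ n)⁻¹) *
        ∫⁻ z in ball y (distBd Ω y / 8), g z := by
  have hmd := measurable_distBd Ω
  have hmΩ := H.isOpen.measurableSet
  set c : ℝ≥0∞ := ENNReal.ofReal ((1 / 32) ^ n) * volume (ball (0 : Euc n) 1) with hc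
  have hc0 : c ≠ 0 := mul_ne_zero (ENNReal.ofReal_pos.2 (by positivity)).ne'
    (measure_ball_pos _ _ one_pos).ne'
  have hct : c ≠ ⊤ := ENNReal.mul_ne_top ENNReal.ofReal_ne_top measure_ball_lt_top.ne
  refine ⟨c⁻¹, ENNReal.inv_ne_top.2 hc0, fun g hg => ?_⟩
  rw [← ENNReal.mul_le_iff_le_inv hc0 hct, ← lintegral_const_mul c hg]
  set S : Set (Euc n × Euc n) := {w | dist w.2 w.1 < distBd Ω w.1 / 8} with hS
  have hSm : MeasurableSet S := measurableSet_lt (measurable_snd.dist measurable_fst)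
    ((hmd.comp measurable_fst).div_const 8)
  set k : Euc n × Euc n → ℝ≥0∞ :=
    S.indicator fun w => ENNReal.ofReal ((distBd Ω w.1 ^ n)⁻¹) * g w.2 with hk
  have hkm : Measurable k :=
    (((((hmd.comp measurable_fst).pow_const n).inv).ennreal_ofReal).mul
      (hg.comp measurable_snd)).indicator hSm
  calc ∫⁻ z in Ω, c * g z ≤ ∫⁻ z in Ω, ∫⁻ y in Ω, k (y, z) := by
        refine setLIntegral_mono' hmΩ fun z hz => ?_
        have hρ := H.distBd_pos hz
        have hmem : ∀ y ∈ ball z (distBd Ω z / 16), y ∈ Ω ∧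
            ENNReal.ofReal (((2 * distBd Ω z) ^ n)⁻¹) * g z ≤ k (y, z) := fun y hy => by
          have hy' := hy
          rw [mem_ball] at hy'
          have h1 := distBd_le_add Ω z y
          have h2 := distBd_le_add Ω y z
          rw [dist_comm] at h1
          have hyΩ := ball_subset_of_le_distBd H.isOpen hz (by linarith) hy
          have hyS : (y, z) ∈ S := by
            change dist z y < distBd Ω y / 8
            rw [dist_comm]
            linarith
          refine ⟨hyΩ, ?_⟩
          rw [hk, indicator_of_mem hyS]
          refine mul_le_mul_left (ENNReal.ofReal_le_ofReal ?_) _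
          have := H.distBd_pos hyΩ
          exact inv_anti₀ (by positivity) (pow_le_pow_left₀ this.le (by linarith) n)
        refine le_trans (le_of_eq ?_) ((setLIntegral_mono' measurableSet_ball fun y hy =>
          (hmem y hy).2).trans (lintegral_mono_set fun y hy => (hmem y hy).1))
        rw [setLIntegral_const, Measure.addHaar_ball_of_pos volume _
          (show 0 < distBd Ω z / 16 by positivity), finrank_euclideanSpace, Fintype.card_fin, hc]
        have : (1 / 32 : ℝ) ^ n = ((2 * distBd Ω z) ^ n)⁻¹ * (distBd Ω z / 16) ^ n := by
          rw [← inv_pow, ← mul_pow]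
          congr 1
          field_simp
          norm_num
        rw [this, ENNReal.ofReal_mul (by positivity)]
        ring
    _ = ∫⁻ y in Ω, ∫⁻ z in Ω, k (y, z) := (lintegral_lintegral_swap (f := fun y z => k (y, z)) hkm.aemeasurable).symm
    _ ≤ _ := by
        refine lintegral_mono fun y => ?_
        rw [← lintegral_const_mul _ hg, ← lintegral_indicator measurableSet_ball]
        exact setLIntegral_le_lintegral _ _

lemma IsJohnWith.exists_lintegral_chainMass_le (H : IsJohnWith Ω J x₀) {t : ℝ} (ht : 0 ≤ t) :
    ∃ s : ℝ, 0 < s ∧ ∃ C : ℝ≥0∞, C ≠ ⊤ ∧ ∀ f : Euc n → ℝ≥0∞, Measurable f →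
      ∫⁻ y in Ω, ENNReal.ofReal (distBd Ω y ^ t) * ENNReal.ofReal (distBd Ω y ^ (-s)) *
          chainMass Ω f (4 * (1 + J)) s y ≤
        C * ∫⁻ z in Ω, f z * ENNReal.ofReal (distBd Ω z ^ t) := by
  obtain ⟨s, hs, h⟩ := H.exists_scaled_lintegral_le
  have hJ := H.one_lt
  set N := 4 * (1 + J) with hN
  have hN0 : 0 < N := by linarith
  obtain ⟨C, hC, hCb⟩ := h N hN0
  have hmd := measurable_distBd Ω
  have hmΩ := H.isOpen.measurableSet
  refine ⟨s, hs, ENNReal.ofReal ((1 + N) ^ t) * C, ENNReal.mul_ne_top ENNReal.ofReal_ne_top hC,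
    fun f hf => ?_⟩
  set S : Set (Euc n × Euc n) := {w | dist w.2 w.1 < N * distBd Ω w.2} with hS
  have hSm : MeasurableSet S := measurableSet_lt (measurable_snd.dist measurable_fst)
    ((hmd.comp measurable_snd).const_mul N)
  have hpm : ∀ a : ℝ, Measurable fun y => ENNReal.ofReal (distBd Ω y ^ a) := fun a =>
    (hmd.pow_const a).ennreal_ofReal
  have hφm : Measurable fun z => f z * ENNReal.ofReal (distBd Ω z ^ (s - n)) := hf.mul (hpm _)
  have hψm : Measurable fun y => ENNReal.ofReal (distBd Ω y ^ t) *
    ENNReal.ofReal (distBd Ω y ^ (-s)) := (hpm _).mul (hpm _)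
  set k : Euc n × Euc n → ℝ≥0∞ := S.indicator fun w =>
    (ENNReal.ofReal (distBd Ω w.1 ^ t) * ENNReal.ofReal (distBd Ω w.1 ^ (-s))) *
      (f w.2 * ENNReal.ofReal (distBd Ω w.2 ^ (s - n))) with hk
  have hkm : Measurable k :=
    ((hψm.comp measurable_fst).mul (hφm.comp measurable_snd)).indicator hSm
  calc _ = ∫⁻ y in Ω, ∫⁻ z in Ω, k (y, z) := by
        refine lintegral_congr fun y => ?_
        have hm : MeasurableSet {z | dist z y < N * distBd Ω z} :=
          measurableSet_lt (measurable_id.dist measurable_const) (hmd.const_mul N)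
        have hset : {z ∈ Ω | dist z y < N * distBd Ω z} = {z | dist z y < N * distBd Ω z} ∩ Ω := by
          ext z
          exact and_comm
        rw [chainMass, hset, ← Measure.restrict_restrict hm, ← lintegral_const_mul _ hφm,
          ← lintegral_indicator hm]
        rfl
    _ = ∫⁻ z in Ω, ∫⁻ y in Ω, k (y, z) :=
        lintegral_lintegral_swap (f := fun y z => k (y, z)) hkm.aemeasurable
    _ ≤ ∫⁻ z in Ω, ENNReal.ofReal ((1 + N) ^ t) * C * (f z * ENNReal.ofReal (distBd Ω z ^ t)) := by
        refine setLIntegral_mono' hmΩ fun z hz => ?_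
        have hρ := H.distBd_pos hz
        have h1 : ∀ y ∈ Ω, k (y, z) ≤ (ball z (N * distBd Ω z)).indicator (fun y =>
            (f z * ENNReal.ofReal (distBd Ω z ^ (s - n)) * ENNReal.ofReal ((1 + N) ^ t) *
              ENNReal.ofReal (distBd Ω z ^ t)) * ENNReal.ofReal (distBd Ω y ^ (-s))) y :=
          fun y hy => by
          by_cases hyz : dist y z < N * distBd Ω z
          · have hyS : (y, z) ∈ S := by
              change dist z y < N * distBd Ω z
              rwa [dist_comm]
            rw [hk, indicator_of_mem hyS, indicator_of_mem (show y ∈ ball z _ from hyz)]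
            have h2 : ENNReal.ofReal (distBd Ω y ^ t) ≤
                ENNReal.ofReal ((1 + N) ^ t) * ENNReal.ofReal (distBd Ω z ^ t) := by
              rw [← ENNReal.ofReal_mul (by positivity), ← Real.mul_rpow (by linarith) hρ.le]
              refine ENNReal.ofReal_le_ofReal (Real.rpow_le_rpow (H.distBd_pos hy).le ?_ ht)
              linarith [distBd_le_add Ω y z]
            refine (mul_le_mul_left (mul_le_mul_left h2 _) _).trans (le_of_eq ?_)
            ring
          · have hyS : (y, z) ∉ S := fun h => hyz (by
              rw [dist_comm]
              exact h)
            rw [hk, indicator_of_notMem hyS]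
            exact zero_le
        refine (setLIntegral_mono' hmΩ h1).trans ?_
        rw [lintegral_indicator measurableSet_ball, Measure.restrict_restrict measurableSet_ball,
          inter_comm, lintegral_const_mul _ (hpm _)]
        refine (mul_le_mul_right (hCb z hz) _).trans (le_of_eq ?_)
        have h3 : ENNReal.ofReal (distBd Ω z ^ (s - n)) * ENNReal.ofReal (distBd Ω z ^ (n - s)) = 1 := by
          rw [← ENNReal.ofReal_mul (by positivity), ← Real.rpow_add hρ]
          simp
        calc _ = ENNReal.ofReal ((1 + N) ^ t) * C * (f z * ENNReal.ofReal (distBd Ω z ^ t)) *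
              (ENNReal.ofReal (distBd Ω z ^ (s - n)) * ENNReal.ofReal (distBd Ω z ^ (n - s))) := by
              ring
          _ = _ := by rw [h3, mul_one]
    _ = _ := lintegral_const_mul _ (hf.mul (hpm _))

/-- Local approximation by affine fields in Whitney balls implies global approximation in weighted
spaces. -/
theorem IsJohnWith.exists_global_bound (H : IsJohnWith Ω J x₀) {p t : ℝ} (hp : 1 ≤ p)
    (ht : 0 ≤ t) : ∃ C : ℝ≥0∞, C ≠ ⊤ ∧ ∀ (D : Euc n → Matrix (Fin n) (Fin n) ℝ)
      (f : Euc n → ℝ≥0∞) (Q : Euc n → AffCoef n) (C₁ : ℝ≥0∞),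
      C₁ ≠ ⊤ → (∀ i j, Measurable fun z => D z i j) → Measurable f →
      (∀ x ∈ Ω, ∫⁻ z in ball x (distBd Ω x / 8), entrySum (D z - affMatrix (Q x) z) ^ p ≤
        C₁ * ∫⁻ z in ball x (distBd Ω x / 2), f z) →
      ∫⁻ z in Ω, entrySum (D z - affMatrix (Q x₀) z) ^ p * ENNReal.ofReal (distBd Ω z ^ t) ≤
        C * C₁ * ∫⁻ z in Ω, f z * ENNReal.ofReal (distBd Ω z ^ t) := by
  obtain ⟨A, hA, hAb⟩ := H.exists_lintegral_le_average
  obtain ⟨s, hs, B, hB, hBb⟩ := H.exists_lintegral_chainMass_le ht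
  obtain ⟨C, hC, hCb⟩ := H.exists_chain_bound hp hs
  have hJ := H.one_lt
  have hmΩ := H.isOpen.measurableSet
  have hp2 : (2 : ℝ≥0∞) ^ (p - 1) ≠ ⊤ := ENNReal.rpow_ne_top_of_nonneg (by linarith) (by simp)
  set W : ℝ := 4 ^ s * 1 ^ s * 2 ^ n with hW
  set ω := volume (ball (0 : Euc n) 1) with hω
  have hωt : ω ≠ ⊤ := measure_ball_lt_top.ne
  set G : ℝ≥0∞ := 2 ^ (p - 1) * ENNReal.ofReal (2 ^ t) * (ENNReal.ofReal W + C * ω) with hG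
  have hGt : G ≠ ⊤ := ENNReal.mul_ne_top (ENNReal.mul_ne_top hp2 ENNReal.ofReal_ne_top)
    (ENNReal.add_ne_top.2 ⟨ENNReal.ofReal_ne_top, ENNReal.mul_ne_top hC hωt⟩)
  refine ⟨A * G * B, ENNReal.mul_ne_top (ENNReal.mul_ne_top hA hGt) hB,
    fun D f Q C₁ hC1 hD hf hloc => ?_⟩
  have hEm : ∀ P : AffCoef n, Measurable fun z => entrySum (D z - affMatrix P z) ^ p := fun P =>
    (measurable_entrySum fun i j => (hD i j).sub (measurable_affMatrix P i j)).pow_const p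
  have hwm : Measurable fun z => ENNReal.ofReal (distBd Ω z ^ t) :=
    ((measurable_distBd Ω).pow_const t).ennreal_ofReal
  have hy : ∀ y ∈ Ω, ENNReal.ofReal ((distBd Ω y ^ n)⁻¹) * ∫⁻ z in ball y (distBd Ω y / 8),
      entrySum (D z - affMatrix (Q x₀) z) ^ p * ENNReal.ofReal (distBd Ω z ^ t) ≤
      G * C₁ * (ENNReal.ofReal (distBd Ω y ^ t) * ENNReal.ofReal (distBd Ω y ^ (-s)) *
        chainMass Ω f (4 * (1 + J)) s y) := fun y hy => by
    have hρ := H.distBd_pos hy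
    set M := chainMass Ω f (4 * (1 + J)) s y with hM
    set w := ENNReal.ofReal (distBd Ω y ^ (-s)) with hw
    have h1 : ∀ z ∈ ball y (distBd Ω y / 8), entrySum (D z - affMatrix (Q x₀) z) ^ p *
        ENNReal.ofReal (distBd Ω z ^ t) ≤ (2 ^ (p - 1) * (ENNReal.ofReal (2 ^ t) *
          ENNReal.ofReal (distBd Ω y ^ t))) * (entrySum (D z - affMatrix (Q y) z) ^ p +
            C * C₁ * w * M) := fun z hz => by
      have h2 := hCb D f Q C₁ hD hloc y hy z hz
      have h3 := entrySum_sub_rpow_le hp (D z) (affMatrix (Q y) z) (affMatrix (Q x₀) z)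
      rw [entrySum_sub_comm (affMatrix (Q y) z)] at h3
      have h4 : ENNReal.ofReal (distBd Ω z ^ t) ≤
          ENNReal.ofReal (2 ^ t) * ENNReal.ofReal (distBd Ω y ^ t) := by
        rw [← ENNReal.ofReal_mul (by positivity), ← Real.mul_rpow (by norm_num) hρ.le]
        refine ENNReal.ofReal_le_ofReal (Real.rpow_le_rpow infDist_nonneg ?_ ht)
        have := distBd_le_add Ω z y
        rw [mem_ball] at hz
        linarith
      refine (mul_le_mul' (h3.trans (mul_le_mul_right (add_le_add_right h2 _) _)) h4).trans
        (le_of_eq ?_)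
      ring
    have h5 : ∫⁻ z in ball y (distBd Ω y / 8), entrySum (D z - affMatrix (Q y) z) ^ p ≤
        C₁ * ∫⁻ z in ball y (distBd Ω y * (3 / 4)), f z :=
      (hloc y hy).trans (mul_le_mul_right (lintegral_mono_set (ball_subset_ball (by linarith))) _)
    have h6 := H.lintegral_le_chainMass hs.le f hy (by
      rw [dist_self]
      positivity : dist y y ≤ J * distBd Ω y) hρ (one_mul (distBd Ω y)).ge
    rw [← hW, ENNReal.ofReal_mul (by positivity), ← hM, ← hw] at h6
    have h7 : volume (ball y (distBd Ω y / 8)) ≤ ENNReal.ofReal (distBd Ω y ^ n) * ω := by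
      rw [Measure.addHaar_ball_of_pos volume _ (show 0 < distBd Ω y / 8 by positivity),
        finrank_euclideanSpace, Fintype.card_fin]
      exact mul_le_mul_left (ENNReal.ofReal_le_ofReal
        (pow_le_pow_left₀ (by positivity) (by linarith) n)) _
    have h8 : ENNReal.ofReal ((distBd Ω y ^ n)⁻¹) * ENNReal.ofReal (distBd Ω y ^ n) = 1 := by
      rw [← ENNReal.ofReal_mul (by positivity), inv_mul_cancel₀ (by positivity), ENNReal.ofReal_one]
    have h9 : ∫⁻ z in ball y (distBd Ω y / 8), entrySum (D z - affMatrix (Q x₀) z) ^ p *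
        ENNReal.ofReal (distBd Ω z ^ t) ≤ (2 ^ (p - 1) * (ENNReal.ofReal (2 ^ t) *
          ENNReal.ofReal (distBd Ω y ^ t))) * (C₁ * (∫⁻ z in ball y (distBd Ω y * (3 / 4)), f z) +
            C * C₁ * w * M * (ENNReal.ofReal (distBd Ω y ^ n) * ω)) := by
      refine (setLIntegral_mono' measurableSet_ball h1).trans ?_
      rw [lintegral_const_mul' _ _ (ENNReal.mul_ne_top hp2 (ENNReal.mul_ne_top
        ENNReal.ofReal_ne_top ENNReal.ofReal_ne_top)), lintegral_add_right _ measurable_const,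
        setLIntegral_const]
      exact mul_le_mul_right (add_le_add h5 (mul_le_mul_right h7 _)) _
    set a := ENNReal.ofReal ((distBd Ω y ^ n)⁻¹) with ha
    set b := ENNReal.ofReal (distBd Ω y ^ n) with hb
    set I := ∫⁻ z in ball y (distBd Ω y * (3 / 4)), f z with hI
    set u := ENNReal.ofReal (distBd Ω y ^ t) with hu
    calc _ ≤ a * ((2 ^ (p - 1) * (ENNReal.ofReal (2 ^ t) * u)) *
            (C₁ * I + C * C₁ * w * M * (b * ω))) := mul_le_mul_right h9 _
      _ = (2 ^ (p - 1) * (ENNReal.ofReal (2 ^ t) * u)) *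
            (C₁ * (a * I) + C * C₁ * w * M * ((a * b) * ω)) := by ring
      _ ≤ (2 ^ (p - 1) * (ENNReal.ofReal (2 ^ t) * u)) *
            (C₁ * (ENNReal.ofReal W * w * M) + C * C₁ * w * M * (1 * ω)) := by
          rw [h8]
          exact mul_le_mul_right (add_le_add_left (mul_le_mul_right h6 _) _) _
      _ = _ := by
          rw [hG]
          ring
  refine (hAb _ ((hEm (Q x₀)).mul hwm)).trans ?_
  have h10 := setLIntegral_mono' hmΩ hy (μ := volume)
  rw [lintegral_const_mul' _ _ (ENNReal.mul_ne_top hGt hC1)] at h10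
  refine (mul_le_mul_right (h10.trans (mul_le_mul_right (hBb f hf) _)) _).trans (le_of_eq ?_)
  ring

end GlobalBound

section MatrixNorm

variable {n : ℕ}

lemma matNorm_nonneg (M : Matrix (Fin n) (Fin n) ℝ) : 0 ≤ matNorm M := Real.sqrt_nonneg _

lemma abs_le_matNorm (M : Matrix (Fin n) (Fin n) ℝ) (i j : Fin n) : |M i j| ≤ matNorm M := by
  refine Real.abs_le_sqrt ((Finset.single_le_sum (f := fun j => M i j ^ 2)
    (fun _ _ => sq_nonneg _) (Finset.mem_univ j)).trans ?_)
  exact Finset.single_le_sum (f := fun i => ∑ j, M i j ^ 2)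
    (fun _ _ => Finset.sum_nonneg fun _ _ => sq_nonneg _) (Finset.mem_univ i)

lemma ofReal_matNorm_le (M : Matrix (Fin n) (Fin n) ℝ) : ENNReal.ofReal (matNorm M) ≤ entrySum M := by
  have h1 : entrySum M = ENNReal.ofReal (∑ i, ∑ j, |M i j|) := by
    rw [ENNReal.ofReal_sum_of_nonneg (f := fun i => ∑ j, |M i j|)
      fun i _ => Finset.sum_nonneg fun j _ => abs_nonneg (M i j)]
    refine Finset.sum_congr rfl fun i _ => ?_
    rw [ENNReal.ofReal_sum_of_nonneg (f := fun j => |M i j|) fun j _ => abs_nonneg (M i j)]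
    exact Finset.sum_congr rfl fun j _ => Real.enorm_eq_ofReal_abs _
  rw [h1]
  refine ENNReal.ofReal_le_ofReal (Real.sqrt_le_iff.2
    ⟨Finset.sum_nonneg fun _ _ => Finset.sum_nonneg fun _ _ => abs_nonneg _, ?_⟩)
  refine le_trans (Finset.sum_le_sum fun i _ => ?_) (Finset.sum_sq_le_sq_sum_of_nonneg
    fun i _ => Finset.sum_nonneg fun j _ => abs_nonneg (M i j))
  refine le_trans (le_of_eq (Finset.sum_congr rfl fun j _ => (sq_abs _).symm))
    (Finset.sum_sq_le_sq_sum_of_nonneg fun j _ => abs_nonneg (M i j))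

lemma entrySum_le_of_abs_le {M : Matrix (Fin n) (Fin n) ℝ} {a : ℝ} (h : ∀ i j, |M i j| ≤ a) :
    entrySum M ≤ n * n * ENNReal.ofReal a := by
  refine (Finset.sum_le_sum fun i _ => Finset.sum_le_sum fun j _ =>
    (Real.enorm_eq_ofReal_abs (M i j)).trans_le (ENNReal.ofReal_le_ofReal (h i j))).trans ?_
  simp [mul_assoc]

lemma measurable_matNorm {D : Euc n → Matrix (Fin n) (Fin n) ℝ}
    (hD : ∀ i j, Measurable fun z => D z i j) : Measurable fun z => matNorm (D z) :=
  (Finset.measurable_fun_sum _ fun i _ => Finset.measurable_fun_sum _ fun j _ =>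
    (hD i j).pow_const 2).sqrt

lemma measurable_Dmat (v : Euc n → Euc n) (i j : Fin n) : Measurable fun z => Dmat v z i j :=
  (EuclideanSpace.proj (𝕜 := ℝ) i : Euc n →L[ℝ] ℝ).continuous.measurable.comp
    (measurable_fderiv_apply_const ℝ v _)

lemma measurable_lMat (v : Euc n → Euc n) (i j : Fin n) : Measurable fun z => lMat v z i j := by
  have h : (fun z => lMat v z i j) = fun z => 1 / 2 * (Dmat v z i j + Dmat v z j i) -
      (if i = j then 1 / (n:ℝ) else 0) * ∑ a, Dmat v z a a := funext fun z => lMat_eq_tfSym v z i j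
  rw [h]
  exact (((measurable_Dmat v i j).add (measurable_Dmat v j i)).const_mul _).sub
    ((Finset.measurable_fun_sum _ fun a _ => measurable_Dmat v a a).const_mul _)

lemma abs_lMat_le (v : Euc n → Euc n) (z : Euc n) (i j : Fin n) :
    |lMat v z i j| ≤ 2 * matNorm (Dmat v z) := by
  have hn : (0:ℝ) < n := Nat.cast_pos.2 (Fin.pos i)
  rw [lMat_eq_tfSym]
  change |1 / 2 * (Dmat v z i j + Dmat v z j i) -
    (if i = j then 1 / (n:ℝ) else 0) * ∑ a, Dmat v z a a| ≤ _
  have h := abs_le_matNorm (Dmat v z)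
  set m := matNorm (Dmat v z) with hm
  have hm0 : 0 ≤ m := matNorm_nonneg _
  have h1 : |1 / 2 * (Dmat v z i j + Dmat v z j i)| ≤ m := by
    rw [abs_mul, abs_of_pos (by norm_num : (0:ℝ) < 1 / 2)]
    linarith [abs_add_le (Dmat v z i j) (Dmat v z j i), h i j, h j i]
  have h2 : |(if i = j then 1 / (n:ℝ) else 0) * ∑ a, Dmat v z a a| ≤ m := by
    have h3 : |∑ a, Dmat v z a a| ≤ n * m := (Finset.abs_sum_le_sum_abs _ _).trans
      ((Finset.sum_le_sum fun a _ => h a a).trans (by simp))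
    rw [abs_mul]
    split_ifs
    · rw [abs_of_pos (by positivity), one_div, inv_mul_le_iff₀ hn]
      exact h3
    · rw [abs_zero, zero_mul]
      exact hm0
  linarith [abs_sub (1 / 2 * (Dmat v z i j + Dmat v z j i))
    ((if i = j then 1 / (n:ℝ) else 0) * ∑ a, Dmat v z a a)]

lemma exists_killing_field {Q : AffCoef n} (hQ : Q ∈ killingCoef n) : ∃ w : Euc n → Euc n,
    Differentiable ℝ w ∧ (∀ x, lMat w x = 0) ∧ ∀ x, Dmat w x = affMatrix Q x := by
  have hd : Differentiable ℝ fun x => (WithLp.toLp 2 (quadField 0 Q x) : Euc n) :=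
    differentiable_euclidean.2 fun i => (contDiff_quadField 0 Q i).differentiable (by simp)
  have hD : ∀ x, Dmat (fun x => (WithLp.toLp 2 (quadField 0 Q x) : Euc n)) x = affMatrix Q x :=
    fun x => by
    ext i j
    rw [affMatrix_apply, ← fderiv_quadField 0 (mem_killingCoef_iff.1 hQ).2.2 x i j]
    exact (congrArg (fun L : Euc n →L[ℝ] ℝ => L (EuclideanSpace.single j 1))
      (hasFDerivAt_coord (hd x) i).fderiv).symm
  refine ⟨_, hd, fun x => ?_, hD⟩
  ext i j
  rw [lMat_eq_tfSym, hD]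
  exact tfSym_affMat hQ x i j

lemma frontier_nonempty_of_isBounded (hn : 0 < n) {Ω : Set (Euc n)} (h : Ω.Nonempty)
    (hb : Bornology.IsBounded Ω) : (frontier Ω).Nonempty := by
  have : Nonempty (Fin n) := ⟨⟨0, hn⟩⟩
  refine nonempty_frontier_iff.2 ⟨h, fun hu => ?_⟩
  rw [hu] at hb
  exact NormedSpace.unbounded_univ ℝ (Euc n) hb

end MatrixNorm

section WeightedIntegrals

variable {n : ℕ}

lemma entrySum_rpow_mul_le {M : Matrix (Fin n) (Fin n) ℝ} {a p s : ℝ} (ha : 0 ≤ a) (hp : 0 ≤ p)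
    (h : ∀ i j, |M i j| ≤ a) :
    entrySum M ^ p * ENNReal.ofReal s ≤ ((n:ℝ≥0∞) * n) ^ p * ENNReal.ofReal (a ^ p * s) := by
  rw [ENNReal.ofReal_mul (Real.rpow_nonneg ha p), ← ENNReal.ofReal_rpow_of_nonneg ha hp, ← mul_assoc,
    ← ENNReal.mul_rpow_of_nonneg _ _ hp]
  gcongr
  exact entrySum_le_of_abs_le h

lemma ofReal_matNorm_rpow_mul_le (M : Matrix (Fin n) (Fin n) ℝ) {p : ℝ} (s : ℝ) (hp : 0 ≤ p) :
    ENNReal.ofReal (matNorm M ^ p * s) ≤ entrySum M ^ p * ENNReal.ofReal s := by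
  rw [ENNReal.ofReal_mul (Real.rpow_nonneg (matNorm_nonneg M) p),
    ← ENNReal.ofReal_rpow_of_nonneg (matNorm_nonneg M) hp]
  gcongr
  exact ofReal_matNorm_le M

lemma matNorm_rpow_mul_distBd_nonneg (M : Matrix (Fin n) (Fin n) ℝ) (Ω : Set (Euc n)) (p t : ℝ)
    (x : Euc n) : 0 ≤ matNorm M ^ p * distBd Ω x ^ t :=
  mul_nonneg (Real.rpow_nonneg (matNorm_nonneg M) p) (Real.rpow_nonneg Metric.infDist_nonneg t)

lemma integral_matNorm_rpow_mul {D : Euc n → Matrix (Fin n) (Fin n) ℝ}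
    (hD : ∀ i j, Measurable fun z => D z i j) (Ω : Set (Euc n)) (p t : ℝ) :
    ∫ x in Ω, matNorm (D x) ^ p * distBd Ω x ^ t =
      (∫⁻ x in Ω, ENNReal.ofReal (matNorm (D x) ^ p * distBd Ω x ^ t)).toReal :=
  integral_eq_lintegral_of_nonneg_ae
    (ae_of_all _ fun x => matNorm_rpow_mul_distBd_nonneg (D x) Ω p t x)
    (((measurable_matNorm hD).pow_const p).mul
      ((measurable_distBd Ω).pow_const t)).aestronglyMeasurable

lemma lintegral_matNorm_lt_top {D : Euc n → Matrix (Fin n) (Fin n) ℝ} {Ω : Set (Euc n)} {p t : ℝ}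
    (h : IntegrableOn (fun x => matNorm (D x) ^ p * distBd Ω x ^ t) Ω) :
    ∫⁻ x in Ω, ENNReal.ofReal (matNorm (D x) ^ p * distBd Ω x ^ t) < ⊤ := by
  refine lt_of_le_of_lt (lintegral_mono fun x => ?_) h.hasFiniteIntegral
  exact Real.ofReal_le_enorm _

lemma lintegral_ball_entrySum_ne_top {D : Euc n → Matrix (Fin n) (Fin n) ℝ} {Ω : Set (Euc n)}
    {p t : ℝ} (hp : 0 ≤ p) (ht : 0 ≤ t) (hΩ : IsOpen Ω)
    (h : IntegrableOn (fun x => matNorm (D x) ^ p * distBd Ω x ^ t) Ω) {x : Euc n} (hx : x ∈ Ω)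
    (hρ : 0 < distBd Ω x) : ∫⁻ z in ball x (distBd Ω x / 2), entrySum (D z) ^ p ≠ ⊤ := by
  set c := (distBd Ω x / 2) ^ t with hc
  have hc0 : 0 < c := Real.rpow_pos_of_pos (half_pos hρ) t
  have hK : ((n:ℝ≥0∞) * n) ^ p ≠ ⊤ := ENNReal.rpow_ne_top_of_nonneg hp
    (ENNReal.mul_ne_top (ENNReal.natCast_ne_top n) (ENNReal.natCast_ne_top n))
  have h1 : ∫⁻ z in ball x (distBd Ω x / 2), entrySum (D z) ^ p * ENNReal.ofReal c ≤
      ((n:ℝ≥0∞) * n) ^ p * ∫⁻ z in Ω, ENNReal.ofReal (matNorm (D z) ^ p * distBd Ω z ^ t) := by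
    rw [← lintegral_const_mul' _ _ hK]
    refine (setLIntegral_mono' measurableSet_ball fun z hz => ?_).trans
      (lintegral_mono_set (ball_subset_of_le_distBd hΩ hx (half_le_self hρ.le)))
    refine le_trans ?_ (entrySum_rpow_mul_le (matNorm_nonneg _) hp (abs_le_matNorm (D z)))
    gcongr
    refine Real.rpow_le_rpow (half_pos hρ).le ?_ ht
    have := distBd_le_add Ω x z
    rw [mem_ball, dist_comm] at hz
    linarith
  rw [lintegral_mul_const' _ _ ENNReal.ofReal_ne_top] at h1
  intro htop
  rw [htop, ENNReal.top_mul (by simpa using hc0), top_le_iff] at h1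
  exact ENNReal.mul_ne_top hK (lintegral_matNorm_lt_top h).ne h1

lemma lintegral_matNorm_lMat_ne_top {v : Euc n → Euc n} {Ω : Set (Euc n)} {p t : ℝ} (hp : 0 ≤ p)
    (h : IntegrableOn (fun x => matNorm (Dmat v x) ^ p * distBd Ω x ^ t) Ω) :
    ∫⁻ x in Ω, ENNReal.ofReal (matNorm (lMat v x) ^ p * distBd Ω x ^ t) ≠ ⊤ := by
  have hK : ((n:ℝ≥0∞) * n) ^ p * ENNReal.ofReal (2 ^ p) ≠ ⊤ :=
    ENNReal.mul_ne_top (ENNReal.rpow_ne_top_of_nonneg hp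
      (ENNReal.mul_ne_top (ENNReal.natCast_ne_top n) (ENNReal.natCast_ne_top n)))
      ENNReal.ofReal_ne_top
  refine ne_top_of_le_ne_top (ENNReal.mul_ne_top hK (lintegral_matNorm_lt_top h).ne) ?_
  rw [← lintegral_const_mul' _ _ hK]
  refine lintegral_mono fun x => (ofReal_matNorm_rpow_mul_le _ _ hp).trans
    ((entrySum_rpow_mul_le (mul_nonneg zero_le_two (matNorm_nonneg _)) hp
      (abs_lMat_le v x)).trans (le_of_eq ?_))
  rw [Real.mul_rpow zero_le_two (matNorm_nonneg _), mul_assoc (2 ^ p : ℝ),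
    ENNReal.ofReal_mul (Real.rpow_nonneg zero_le_two p), mul_assoc]

theorem IsJohnWith.exists_weighted_korn {Ω : Set (Euc n)} {J : ℝ} {x₀ : Euc n}
    (H : IsJohnWith Ω J x₀) (hn : 3 ≤ n) {p t : ℝ} (hp : 1 < p) (ht : 0 ≤ t) :
    ∃ C : ℝ≥0∞, C ≠ ⊤ ∧ ∀ v : Euc n → Euc n, (∀ x ∈ Ω, DifferentiableAt ℝ v x) →
      IntegrableOn (fun x => matNorm (Dmat v x) ^ p * distBd Ω x ^ t) Ω →
      ∃ w : Euc n → Euc n, Differentiable ℝ w ∧ (∀ x, lMat w x = 0) ∧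
        ∫⁻ x in Ω, ENNReal.ofReal (matNorm (Dmat v x - Dmat w x) ^ p * distBd Ω x ^ t) ≤
          C * ∫⁻ x in Ω, ENNReal.ofReal (matNorm (lMat v x) ^ p * distBd Ω x ^ t) := by
  have hp0 : 0 ≤ p := zero_le_one.trans hp.le
  obtain ⟨C₁, hC₁, hloc⟩ := exists_ball_korn hn (Real.HolderConjugate.conjExponent hp)
  obtain ⟨C₂, hC₂, hglob⟩ := H.exists_global_bound hp.le ht
  have hK : ((n:ℝ≥0∞) * n) ^ p ≠ ⊤ := ENNReal.rpow_ne_top_of_nonneg hp0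
    (ENNReal.mul_ne_top (ENNReal.natCast_ne_top n) (ENNReal.natCast_ne_top n))
  refine ⟨C₂ * C₁ * ((n:ℝ≥0∞) * n) ^ p, ENNReal.mul_ne_top (ENNReal.mul_ne_top hC₂ hC₁) hK,
    fun v hv hInt => ?_⟩
  have hex : ∀ x ∈ Ω, ∃ Q ∈ killingCoef n, ∫⁻ z in ball x (distBd Ω x / 8),
      entrySum (Dmat v z - affMatrix Q z) ^ p ≤
        C₁ * ∫⁻ z in ball x (distBd Ω x / 2), entrySum (lMat v z) ^ p := fun x hx => by
    have hρ := H.distBd_pos hx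
    have he : distBd Ω x / 8 * 4 = distBd Ω x / 2 := by ring
    have := hloc v x (distBd Ω x / 8) (by positivity)
    rw [he] at this
    exact this (fun z hz => hv z (ball_subset_of_le_distBd H.isOpen hx (half_le_self hρ.le) hz))
      (lintegral_ball_entrySum_ne_top hp0 ht H.isOpen hInt hx hρ)
  choose! Q hQ hQb using hex
  obtain ⟨w, hw, hlw, hDw⟩ := exists_killing_field (hQ x₀ H.mem)
  refine ⟨w, hw, hlw, ?_⟩
  have hf : Measurable fun z => entrySum (lMat v z) ^ p :=
    (measurable_entrySum (measurable_lMat v)).pow_const p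
  refine (lintegral_mono fun x => ofReal_matNorm_rpow_mul_le _ _ hp0).trans ?_
  simp only [hDw]
  refine (hglob (Dmat v) _ Q C₁ hC₁ (measurable_Dmat v) hf hQb).trans ?_
  rw [mul_assoc (C₂ * C₁), ← lintegral_const_mul' _ _ hK]
  refine mul_le_mul_right (lintegral_mono fun x => ?_) _
  exact entrySum_rpow_mul_le (matNorm_nonneg _) hp0 (abs_le_matNorm _)

end WeightedIntegrals

/-- weighted generalized (conformal) Korn inequality on bounded John
domains, with weights `ρ^β`, `β ≥ 0`, where `ρ` is the distance to the boundary. -/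
theorem weighted_generalized_korn_on_john_domains
    {n : ℕ} (hn : 3 ≤ n) (Ω : Set (Euc n)) (hΩo : IsOpen Ω) (hΩc : IsConnected Ω)
    (hΩb : Bornology.IsBounded Ω) (hJ : IsJohnDomain Ω)
    (p β : ℝ) (hp1 : 1 < p) (hβ : 0 ≤ β) :
    ∃ C : ℝ, 0 < C ∧ ∀ v : Euc n → Euc n,
      (∀ x ∈ Ω, DifferentiableAt ℝ v x) →
      IntegrableOn (fun x => ‖v x‖ ^ p * distBd Ω x ^ (p * β)) Ω →
      IntegrableOn (fun x => matNorm (Dmat v x) ^ p * distBd Ω x ^ (p * β)) Ω →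
      sInf {r : ℝ | ∃ w : Euc n → Euc n, Differentiable ℝ w ∧ (∀ x ∈ Ω, lMat w x = 0) ∧
          r = (∫ x in Ω, matNorm (Dmat v x - Dmat w x) ^ p * distBd Ω x ^ (p * β)) ^ (1 / p)}
        ≤ C * (∫ x in Ω, matNorm (lMat v x) ^ p * distBd Ω x ^ (p * β)) ^ (1 / p) := by
  have hn0 : 0 < n := by omega
  obtain ⟨J, hJ1, x₀, hx₀, hcurve⟩ := hJ
  have H : IsJohnWith Ω J x₀ := ⟨hΩo, frontier_nonempty_of_isBounded hn0 ⟨x₀, hx₀⟩ hΩb, hJ1, hx₀,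
    hcurve⟩
  have hp0 : 0 < p := zero_lt_one.trans hp1
  obtain ⟨C, hC, hkorn⟩ := H.exists_weighted_korn hn hp1 (mul_nonneg hp0.le hβ)
  refine ⟨C.toReal ^ (1 / p) + 1, by positivity, fun v hv _ hInt => ?_⟩
  obtain ⟨w, hw, hlw, hle⟩ := hkorn v hv hInt
  have hnonneg : ∀ D : Euc n → Matrix (Fin n) (Fin n) ℝ,
      0 ≤ ∫ x in Ω, matNorm (D x) ^ p * distBd Ω x ^ (p * β) := fun D =>
    integral_nonneg fun x => matNorm_rpow_mul_distBd_nonneg (D x) Ω p (p * β) x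
  have hbound : ∫ x in Ω, matNorm (Dmat v x - Dmat w x) ^ p * distBd Ω x ^ (p * β) ≤
      C.toReal * ∫ x in Ω, matNorm (lMat v x) ^ p * distBd Ω x ^ (p * β) := by
    rw [integral_matNorm_rpow_mul (D := fun x => Dmat v x - Dmat w x)
      fun i j => (measurable_Dmat v i j).sub (measurable_Dmat w i j),
      integral_matNorm_rpow_mul (measurable_lMat v), ← ENNReal.toReal_mul]
    exact ENNReal.toReal_mono
      (ENNReal.mul_ne_top hC (lintegral_matNorm_lMat_ne_top hp0.le hInt)) hle
  refine le_trans (csInf_le ⟨0, ?_⟩ ⟨w, hw, fun x _ => hlw x, rfl⟩) ?_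
  · rintro r ⟨u, -, -, rfl⟩
    exact Real.rpow_nonneg (hnonneg fun x => Dmat v x - Dmat u x) _
  · refine (Real.rpow_le_rpow (hnonneg fun x => Dmat v x - Dmat w x) hbound
      (one_div_nonneg.2 hp0.le)).trans ?_
    rw [Real.mul_rpow ENNReal.toReal_nonneg (hnonneg (lMat v))]
    exact mul_le_mul_of_nonneg_right (le_add_of_nonneg_right zero_le_one)
      (Real.rpow_nonneg (hnonneg (lMat v)) _)

end
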